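/- Degree distribution on the spanning tree trunk: as n → ∞, among spanning trees T of G_n whose trunk contains e₀, the proportion of trees in which the vertex (1,0) has degree exactly d in T converges to 1/2 when d = 2, to √2 − 1 when d = 3, and to 3/2 − √2 when d = 4. -/

import Mathlib

/-- Vertex type for the wired grid graphs: lattice points together with the two extra
vertices `L = Sum.inr false` and `R = Sum.inr true`. -/
abbrev GridV : Type := (ℤ × ℤ) ⊕ Bool

/-- The left wired vertex `L`. -/
def Lv : GridV := Sum.inr false

/-- The right wired vertex `R`. -/
def Rv : GridV := Sum.inr true

/-- The adjacency generator of the graph `G_n`: two lattice points of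
`{-n,…,n} × {-n,…,n}` are related when at Euclidean distance `1`; `L` is related to
every vertex `(-n, y)` and `R` to every vertex `(n, y)` with `|y| ≤ n`. -/
def gridRel (n : ℕ) : GridV → GridV → Prop
  | Sum.inl p, Sum.inl q =>
      |p.1| ≤ (n : ℤ) ∧ |p.2| ≤ (n : ℤ) ∧ |q.1| ≤ (n : ℤ) ∧ |q.2| ≤ (n : ℤ) ∧
        (p.1 - q.1) ^ 2 + (p.2 - q.2) ^ 2 = 1
  | Sum.inr b, Sum.inl p =>
      |p.2| ≤ (n : ℤ) ∧ ((b = false ∧ p.1 = -(n : ℤ)) ∨ (b = true ∧ p.1 = (n : ℤ)))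
  | _, _ => False

/-- The graph `G_n`: the `{-n,…,n} × {-n,…,n}` grid with wired left and right
boundaries `L` and `R`. -/
def gridGraph (n : ℕ) : SimpleGraph GridV := SimpleGraph.fromRel (gridRel n)

/-- The vertex set of `G_n`: the lattice points of `{-n,…,n} × {-n,…,n}` together
with `L` and `R`. -/
def gridVerts (n : ℕ) : Set GridV :=
  {v | ∃ p : ℤ × ℤ, v = Sum.inl p ∧ |p.1| ≤ (n : ℤ) ∧ |p.2| ≤ (n : ℤ)} ∪ {Lv, Rv}

/-- `T` is a spanning tree of `G_n`: a subgraph whose vertex set is all of `G_n`'s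
vertex set and which is a tree. -/
def IsSpanningTree (n : ℕ) (T : (gridGraph n).Subgraph) : Prop :=
  T.verts = gridVerts n ∧ T.coe.IsTree

/-- The horizontal edge `e_j = {(j,0), (j+1,0)}`. -/
def hEdge (j : ℕ) : Sym2 GridV := s(Sum.inl ((j : ℤ), 0), Sum.inl ((j : ℤ) + 1, 0))

/-- The trunk of a spanning tree `T` (the unique path in `T` from `L` to `R`)
contains the edge `e`: equivalently, `e` is an edge of `T` whose removal disconnects
`L` from `R`. -/
def TrunkContains (n : ℕ) (T : (gridGraph n).Subgraph) (e : Sym2 GridV) : Prop :=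
  e ∈ T.edgeSet ∧ ¬ (T.deleteEdges {e}).spanningCoe.Reachable Lv Rv

namespace TrunkDegree

open Finset

set_option linter.unusedSectionVars false

section FunctionalGraph

variable {I : Type*} [Fintype I] [DecidableEq I]

/-- The self-map of `I ⊕ Bool` which follows `f` on `I` and fixes the two roots. -/
def nxt (f : I → I ⊕ Bool) : I ⊕ Bool → I ⊕ Bool := Sum.elim f Sum.inr

/-- The weight `φ` extended by `1` to the roots. -/
def rootedWeight (φ : I → ℝ) : I ⊕ Bool → ℝ := Sum.elim φ (fun _ => 1)

/-- The product of weights along the first `k` steps of the orbit of `w`. -/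
def pathWeight (f : I → I ⊕ Bool) (φ : I → ℝ) (k : ℕ) (w : I ⊕ Bool) : ℝ :=
  ∏ i ∈ range k, rootedWeight φ ((nxt f)^[i] w)

/-- The vertex `w` flows into the root `β`. -/
def ReachesRoot (f : I → I ⊕ Bool) (w : I ⊕ Bool) (β : Bool) : Prop :=
  ∃ k, (nxt f)^[k] w = Sum.inr β

/-- The matrix with rows `δ_v - φ v δ_{f v}` for `v ∈ I`, and `δ_a`, `δ_b` for the two roots. -/
def rootedMatrix (f : I → I ⊕ Bool) (φ : I → ℝ) (a b : I) : Matrix (I ⊕ Bool) (I ⊕ Bool) ℝ :=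
  Matrix.of fun u w => Sum.elim
    (fun v => (if w = Sum.inl v then 1 else 0) - φ v * (if w = f v then 1 else 0))
    (fun β => if w = Sum.inl (bif β then b else a) then 1 else 0) u

/-- The block of `rootedMatrix` indexed by `I`. -/
def innerMatrix (f : I → I ⊕ Bool) (φ : I → ℝ) : Matrix I I ℝ :=
  Matrix.of fun v w => (if w = v then 1 else 0) - φ v * (if Sum.inl w = f v then 1 else 0)

lemma iterate_nxt_inr (f : I → I ⊕ Bool) (k : ℕ) (β : Bool) :
    (nxt f)^[k] (Sum.inr β) = Sum.inr β :=
  Function.iterate_fixed rfl k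

lemma iterate_nxt_of_le {f : I → I ⊕ Bool} {k m : ℕ} {w : I ⊕ Bool} {β : Bool}
    (h : (nxt f)^[k] w = Sum.inr β) (hkm : k ≤ m) : (nxt f)^[m] w = Sum.inr β := by
  obtain ⟨j, rfl⟩ := Nat.exists_eq_add_of_le hkm
  rw [add_comm, Function.iterate_add_apply, h, iterate_nxt_inr]

lemma ReachesRoot.unique {f : I → I ⊕ Bool} {w : I ⊕ Bool} {β γ : Bool}
    (h : ReachesRoot f w β) (h' : ReachesRoot f w γ) : β = γ := by
  obtain ⟨k, hk⟩ := h
  obtain ⟨m, hm⟩ := h'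
  have h1 := iterate_nxt_of_le hk (le_max_left k m)
  have h2 := iterate_nxt_of_le hm (le_max_right k m)
  rw [h1] at h2
  exact Sum.inr_injective h2

lemma reachesRoot_inr (f : I → I ⊕ Bool) {β γ : Bool} :
    ReachesRoot f (Sum.inr β) γ ↔ β = γ := by
  simp [ReachesRoot, iterate_nxt_inr]

lemma reachesRoot_inl (f : I → I ⊕ Bool) (v : I) (β : Bool) :
    ReachesRoot f (Sum.inl v) β ↔ ReachesRoot f (f v) β := by
  constructor
  · rintro ⟨k, hk⟩
    refine ⟨k, ?_⟩
    have := iterate_nxt_of_le hk (Nat.le_succ k)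
    rwa [Function.iterate_succ_apply] at this
  · rintro ⟨k, hk⟩
    exact ⟨k + 1, by rwa [Function.iterate_succ_apply]⟩

lemma exists_uniform_time (f : I → I ⊕ Bool) :
    ∃ K : ℕ, ∀ w β, ReachesRoot f w β → (nxt f)^[K] w = Sum.inr β := by
  classical
  have : ∀ w : I ⊕ Bool, ∃ k, ∀ β, ReachesRoot f w β → (nxt f)^[k] w = Sum.inr β := by
    intro w
    by_cases h : ∃ β, ReachesRoot f w β
    · obtain ⟨β, k, hk⟩ := h
      refine ⟨k, fun γ hγ => ?_⟩
      rw [hk, ReachesRoot.unique ⟨k, hk⟩ hγ]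
    · exact ⟨0, fun β hβ => absurd ⟨β, hβ⟩ h⟩
  choose k hk using this
  refine ⟨univ.sup k, fun w β hw => iterate_nxt_of_le (hk w β hw) (le_sup (mem_univ w))⟩

lemma pathWeight_succ (f : I → I ⊕ Bool) (φ : I → ℝ) (k : ℕ) (v : I) :
    pathWeight f φ (k + 1) (Sum.inl v) = φ v * pathWeight f φ k (f v) := by
  simp only [pathWeight, prod_range_succ', Function.iterate_succ_apply, Function.iterate_zero, id]
  rw [mul_comm]
  rfl

lemma pathWeight_of_le {f : I → I ⊕ Bool} {φ : I → ℝ} {k m : ℕ} {w : I ⊕ Bool} {β : Bool}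
    (h : (nxt f)^[k] w = Sum.inr β) (hkm : k ≤ m) : pathWeight f φ m w = pathWeight f φ k w := by
  induction m, hkm using Nat.le_induction with
  | base => rfl
  | succ m hm ih =>
    rw [pathWeight, prod_range_succ, ← pathWeight, ih, iterate_nxt_of_le h hm]
    simp [rootedWeight]

/-- The determinant of `rootedMatrix` factors over the paths from `a` and `b`. -/
lemma det_rootedMatrix (f : I → I ⊕ Bool) (φ : I → ℝ) (a b : I) :
    ∃ ψ : I → Bool → ℝ,
      (∀ v β, ¬ ReachesRoot f (Sum.inl v) β → ψ v β = 0) ∧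
      (∀ v β k, (nxt f)^[k] (Sum.inl v) = Sum.inr β → ψ v β = pathWeight f φ k (Sum.inl v)) ∧
      (rootedMatrix f φ a b).det = (innerMatrix f φ).det *
        (ψ a false * ψ b true - ψ a true * ψ b false) := by
  classical
  obtain ⟨K, hK⟩ := exists_uniform_time f
  let Ψ : I ⊕ Bool → Bool → ℝ := fun w β =>
    if (nxt f)^[K] w = Sum.inr β then pathWeight f φ K w else 0
  have hΨ : ∀ v β, Ψ (Sum.inl v) β = φ v * Ψ (f v) β := by
    intro v β
    have hiff : (nxt f)^[K] (Sum.inl v) = Sum.inr β ↔ (nxt f)^[K] (f v) = Sum.inr β := by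
      constructor
      · exact fun h => hK _ _ ((reachesRoot_inl f v β).1 ⟨K, h⟩)
      · exact fun h => hK _ _ ((reachesRoot_inl f v β).2 ⟨K, h⟩)
    by_cases h : (nxt f)^[K] (Sum.inl v) = Sum.inr β
    · simp only [Ψ, if_pos h, if_pos (hiff.1 h)]
      rw [← pathWeight_succ, pathWeight_of_le h (Nat.le_succ K)]
    · simp only [Ψ, if_neg h, if_neg (fun h' => h (hiff.2 h')), mul_zero]
  have hΨr : ∀ β γ, Ψ (Sum.inr β) γ = if β = γ then 1 else 0 := by
    intro β γ
    simp [Ψ, iterate_nxt_inr, pathWeight, rootedWeight]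
  refine ⟨fun v β => Ψ (Sum.inl v) β, ?_, ?_, ?_⟩
  · intro v β h
    exact if_neg fun h' => h ⟨K, h'⟩
  · intro v β k hk
    have h1 := hK _ _ ⟨k, hk⟩
    simp only [Ψ, if_pos h1]
    rcases le_total k K with h | h
    · exact pathWeight_of_le hk h
    · exact (pathWeight_of_le h1 h).symm
  · let Q : Matrix I Bool ℝ := Matrix.of fun v β => - (φ v * (if Sum.inr β = f v then 1 else 0))
    let R : Matrix Bool I ℝ := Matrix.of fun β w => if w = (bif β then b else a) then 1 else 0
    let P : Matrix I Bool ℝ := Matrix.of fun v β => Ψ (Sum.inl v) β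
    have hM : rootedMatrix f φ a b = Matrix.fromBlocks (innerMatrix f φ) Q R 0 := by
      ext u w
      rcases u with v | β <;> rcases w with w | γ <;>
        simp [rootedMatrix, innerMatrix, Q, R]
    have hPQ : innerMatrix f φ * P + Q = 0 := by
      ext v β
      simp only [Matrix.add_apply, Matrix.mul_apply, innerMatrix, sub_mul, sum_sub_distrib, P, Q,
        Matrix.of_apply, Matrix.zero_apply, ite_mul, one_mul, zero_mul, sum_ite_eq', mem_univ, if_true]
      rw [hΨ v β]
      rcases h : f v with w | γ
      · simp
      · simp [hΨr, eq_comm]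
    have hRP : R * P = Matrix.of fun β γ => Ψ (Sum.inl (bif β then b else a)) γ := by
      ext β γ
      simp [Matrix.mul_apply, R, P]
    have hdet : (rootedMatrix f φ a b).det =
        (rootedMatrix f φ a b * Matrix.fromBlocks 1 P 0 1).det := by
      rw [Matrix.det_mul, Matrix.det_fromBlocks_zero₂₁]
      simp
    rw [hdet, hM, Matrix.fromBlocks_multiply]
    simp only [mul_one, add_zero, Matrix.mul_one, Matrix.mul_zero, hPQ]
    rw [Matrix.det_fromBlocks_zero₁₂, hRP]
    congr 1
    rw [← Matrix.det_submatrix_equiv_self finTwoEquiv, Matrix.det_fin_two]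
    simp [finTwoEquiv]

/-- If every vertex flows into a root then `innerMatrix` is unipotent. -/
lemma det_innerMatrix_of_reaches (f : I → I ⊕ Bool) (φ : I → ℝ)
    (h : ∀ v : I, ∃ β, ReachesRoot f (Sum.inl v) β) : (innerMatrix f φ).det = 1 := by
  classical
  have h' : ∀ v : I, ∃ k, ∃ β, (nxt f)^[k] (Sum.inl v) = Sum.inr β := fun v => by
    obtain ⟨β, k, hk⟩ := h v
    exact ⟨k, β, hk⟩
  let r : I → ℕ := fun v => Nat.find (h' v)
  have hr : ∀ v w, f v = Sum.inl w → r w < r v := by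
    intro v w hvw
    obtain ⟨β, hβ⟩ := Nat.find_spec (h' v)
    rcases hk : Nat.find (h' v) with _ | k
    · rw [hk] at hβ; simp at hβ
    · rw [hk, Function.iterate_succ_apply] at hβ
      have : Nat.find (h' w) ≤ k := Nat.find_min' _ ⟨β, by rw [← hvw]; exact hβ⟩
      simp only [r, hk]; omega
  have hbt : (innerMatrix f φ).BlockTriangular (fun v => OrderDual.toDual (r v)) := by
    intro v w hvw
    have hvw' : r v < r w := hvw
    have h1 : w ≠ v := by rintro rfl; exact lt_irrefl _ hvw'
    have h2 : Sum.inl w ≠ f v := fun h => by have := hr v w h.symm; omega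
    simp [innerMatrix, h1, h2]
  rw [hbt.det]
  refine prod_eq_one fun c _ => ?_
  have : (innerMatrix f φ).toSquareBlock (fun v => OrderDual.toDual (r v)) c = 1 := by
    ext ⟨v, hv⟩ ⟨w, hw⟩
    have h2 : Sum.inl w ≠ f v := fun h => by
      have h3 := hr v w h.symm
      have h4 : r v = r w := by
        have := hv.trans hw.symm
        exact this
      omega
    simp [Matrix.toSquareBlock_def, innerMatrix, h2, Matrix.one_apply, eq_comm (a := v)]
  rw [this, Matrix.det_one]

/-- A periodic orbit of total weight one makes `innerMatrix` singular. -/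
lemma det_innerMatrix_of_cycle (f : I → I ⊕ Bool) (φ : I → ℝ) (c : ℕ → I) (p : ℕ) (hp : 0 < p)
    (hc : ∀ j, f (c j) = Sum.inl (c (j + 1))) (hcp : c p = c 0)
    (hmin : ∀ j, 0 < j → j < p → c j ≠ c 0)
    (hφ : ∏ j ∈ range p, φ (c j) = 1) : (innerMatrix f φ).det = 0 := by
  classical
  rw [← Matrix.exists_vecMul_eq_zero_iff]
  let y : I → ℝ := fun w => ∑ j ∈ range p, (if w = c j then ∏ i ∈ range j, φ (c i) else 0)
  refine ⟨y, ?_, ?_⟩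
  · intro h0
    have : y (c 0) = 1 := by
      simp only [y]
      rw [sum_eq_single 0]
      · simp
      · intro j hj hj0
        rw [if_neg]
        exact fun h => hmin j (Nat.pos_of_ne_zero hj0) (mem_range.1 hj) h.symm
      · simp [hp.ne']
    rw [h0] at this
    simp at this
  · ext w
    simp only [Matrix.vecMul, dotProduct, y, Pi.zero_apply, sum_mul]
    rw [sum_comm]
    have : ∀ j ∈ range p, ∑ v, (if v = c j then ∏ i ∈ range j, φ (c i) else 0) * innerMatrix f φ v w
        = (if w = c j then ∏ i ∈ range j, φ (c i) else 0)
          - (if w = c (j + 1) then ∏ i ∈ range (j + 1), φ (c i) else 0) := by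
      intro j _
      simp only [ite_mul, zero_mul, sum_ite_eq', mem_univ, if_true, innerMatrix, hc, Matrix.of_apply,
        Sum.inl.injEq, prod_range_succ]
      split_ifs <;> ring
    rw [sum_congr rfl this, sum_range_sub', hφ, hcp]
    simp

end FunctionalGraph

end TrunkDegree

namespace TrunkDegree

open Finset

section LatticeWalk

/-- The four lattice directions: east, north, west, south. -/
def dir : Fin 4 → ℤ × ℤ := ![(1, 0), (0, 1), (-1, 0), (0, -1)]

/-- The lattice box `{-n,…,n} × {-n,…,n}`. -/
def InBox (n : ℤ) (p : ℤ × ℤ) : Prop := -n ≤ p.1 ∧ p.1 ≤ n ∧ -n ≤ p.2 ∧ p.2 ≤ n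

/-- The parity of the number of times a step from `p` to `q` uses the edge `{u, w}`. -/
def stepParity (p q u w : ℤ × ℤ) : ZMod 2 :=
  (if p = u ∧ q = w then 1 else 0) + (if p = w ∧ q = u then 1 else 0)

/-- The parity of the number of times the first `m` steps of `v` use the edge `{u, w}`. -/
def walkParity (v : ℕ → ℤ × ℤ) (m : ℕ) (u w : ℤ × ℤ) : ZMod 2 :=
  ∑ j ∈ range m, stepParity (v j) (v (j + 1)) u w

/-- The first `m` steps of `v` are lattice steps. -/
def IsLatticeWalk (v : ℕ → ℤ × ℤ) (m : ℕ) : Prop := ∀ j < m, ∃ d, v (j + 1) = v j + dir d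

/-- Parity of the number of horizontal edges crossed when moving up column `x` to height `y`. -/
noncomputable def faceParity (n : ℤ) (e : ℤ × ℤ → ℤ × ℤ → ZMod 2) (x y : ℤ) : ZMod 2 :=
  ∑ y' ∈ Icc (-n) y, e (x, y') (x + 1, y')

lemma zmod_two_add_self (a : ZMod 2) : a + a = 0 := CharTwo.add_self_eq_zero a

lemma stepParity_comm (p q u w : ℤ × ℤ) : stepParity p q u w = stepParity p q w u := by
  rw [stepParity, stepParity, add_comm]

lemma walkParity_comm (v : ℕ → ℤ × ℤ) (m : ℕ) (u w : ℤ × ℤ) :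
    walkParity v m u w = walkParity v m w u :=
  sum_congr rfl fun _ _ => stepParity_comm _ _ _ _

lemma walkParity_eq_zero {v : ℕ → ℤ × ℤ} {m : ℕ} {u w : ℤ × ℤ}
    (h : ∀ j < m, ¬ (v j = u ∧ v (j + 1) = w) ∧ ¬ (v j = w ∧ v (j + 1) = u)) :
    walkParity v m u w = 0 := by
  refine sum_eq_zero fun j hj => ?_
  obtain ⟨h1, h2⟩ := h j (mem_range.1 hj)
  simp [stepParity, h1, h2]

lemma stepParity_vertex (p : ℤ × ℤ) (d : Fin 4) (u : ℤ × ℤ) :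
    ∑ d', stepParity p (p + dir d) u (u + dir d')
      = (if p = u then 1 else 0) + (if p + dir d = u then 1 else 0) := by
  obtain ⟨p1, p2⟩ := p
  obtain ⟨u1, u2⟩ := u
  by_cases h : p1 = u1 ∧ p2 = u2
  · obtain ⟨rfl, rfl⟩ := h
    rw [Fin.sum_univ_four]
    fin_cases d <;> simp [stepParity, dir]
  · have h0 : ¬ ((p1, p2) : ℤ × ℤ) = (u1, u2) := by simpa [Prod.ext_iff] using h
    simp only [stepParity, h0, false_and, if_false, zero_add, Fin.sum_univ_four]
    by_cases h2 : ((p1, p2) : ℤ × ℤ) + dir d = (u1, u2)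
    · obtain ⟨rfl, rfl⟩ : u1 = p1 + (dir d).1 ∧ u2 = p2 + (dir d).2 := by
        simp only [Prod.ext_iff, Prod.fst_add, Prod.snd_add] at h2
        exact ⟨h2.1.symm, h2.2.symm⟩
      fin_cases d <;> simp [dir, Prod.ext_iff] <;> omega
    · simp [h2]

lemma walkParity_vertex {v : ℕ → ℤ × ℤ} {m : ℕ} (hv : IsLatticeWalk v m) (u : ℤ × ℤ) :
    ∑ d, walkParity v m u (u + dir d)
      = (if v 0 = u then 1 else 0) + (if v m = u then 1 else 0) := by
  induction m with
  | zero => simp [walkParity, zmod_two_add_self]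
  | succ m ih =>
    obtain ⟨d, hd⟩ := hv m (Nat.lt_succ_self m)
    have h1 := ih (fun j hj => hv j (by omega))
    have h2 := stepParity_vertex (v m) d u
    simp only [walkParity, sum_range_succ, sum_add_distrib] at h1 ⊢
    rw [h1, hd, h2]
    linear_combination zmod_two_add_self (if v m = u then 1 else 0)

lemma faceParity_hor (n : ℤ) (e : ℤ × ℤ → ℤ × ℤ → ZMod 2) (x : ℤ) {y : ℤ} (hy : -n ≤ y) :
    faceParity n e x y = faceParity n e x (y - 1) + e (x, y) (x + 1, y) := by
  have : Icc (-n) y = insert y (Icc (-n) (y - 1)) := by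
    ext z; simp only [mem_Icc, mem_insert]; omega
  rw [faceParity, this, sum_insert (by simp), add_comm]
  rfl

lemma faceParity_ver {n : ℤ} {e : ℤ × ℤ → ℤ × ℤ → ZMod 2} (hsymm : ∀ u w, e u w = e w u)
    (heven : ∀ u, InBox n u → ∑ d, e u (u + dir d) = 0)
    (hbot : ∀ x, e (x, -n - 1) (x, -n) = 0) {x y : ℤ} (hx : -n ≤ x ∧ x ≤ n)
    (hy : -n - 1 ≤ y) (hyn : y ≤ n) :
    faceParity n e x y + faceParity n e (x - 1) y = e (x, y) (x, y + 1) := by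
  induction y, hy using Int.leInduction with
  | base =>
    simp [faceParity, hbot]
  | succ y hy ih =>
    have h1 := faceParity_hor n e x (y := y + 1) (by omega)
    have h2 := faceParity_hor n e (x - 1) (y := y + 1) (by omega)
    have h3 := heven (x, y + 1) ⟨hx.1, hx.2, by simp only; omega, hyn⟩
    simp only [Fin.sum_univ_four, dir, Matrix.cons_val, Prod.mk_add_mk, add_zero] at h3
    rw [add_sub_cancel_right] at h1 h2
    rw [hsymm (x, y + 1) (x + -1, y + 1), hsymm (x, y + 1) (x, y + 1 + -1),
      show y + 1 + -1 = y by ring, show x + -1 = x - 1 by ring] at h3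
    rw [sub_add_cancel] at h2
    have h4 := ih (by omega)
    rw [h1, h2]
    linear_combination h3 + h4 - zmod_two_add_self (e (x, y + 1) (x, y + 1 + 1))

/-- The four faces around a vertex, compared across its four edges. -/
lemma faceParity_around {n : ℤ} {e : ℤ × ℤ → ℤ × ℤ → ZMod 2} (hsymm : ∀ u w, e u w = e w u)
    (heven : ∀ u, InBox n u → ∑ d, e u (u + dir d) = 0)
    (hbot : ∀ x, e (x, -n - 1) (x, -n) = 0) {x y : ℤ} (h : InBox n (x, y)) :
    faceParity n e x y + faceParity n e x (y - 1) = e (x, y) ((x, y) + dir 0) ∧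
    faceParity n e x y + faceParity n e (x - 1) y = e (x, y) ((x, y) + dir 1) ∧
    faceParity n e (x - 1) y + faceParity n e (x - 1) (y - 1) = e (x, y) ((x, y) + dir 2) ∧
    faceParity n e x (y - 1) + faceParity n e (x - 1) (y - 1) = e (x, y) ((x, y) + dir 3) := by
  obtain ⟨hx1, hx2, hy1, hy2⟩ := h
  simp only at hx1 hx2 hy1 hy2
  have h1 := faceParity_hor n e x hy1
  have h2 := faceParity_hor n e (x - 1) hy1
  have h3 := faceParity_ver hsymm heven hbot (x := x) (y := y) ⟨hx1, hx2⟩ (by omega) hy2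
  have h4 := faceParity_ver hsymm heven hbot (x := x) (y := y - 1) ⟨hx1, hx2⟩ (by omega) (by omega)
  rw [sub_add_cancel] at h2 h4
  simp only [dir, Matrix.cons_val, Prod.mk_add_mk, add_zero, ← sub_eq_add_neg]
  rw [hsymm (x, y) (x - 1, y), hsymm (x, y) (x, y - 1)]
  refine ⟨?_, h3, ?_, h4⟩
  · rw [h1]; linear_combination zmod_two_add_self (faceParity n e x (y - 1))
  · rw [h2]; linear_combination zmod_two_add_self (faceParity n e (x - 1) (y - 1))

/-- A closed walk disjoint from a walk leading from the origin out of the box crosses the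
ray below the origin an even number of times. -/
lemma faceParity_closed {n : ℤ} {v u : ℕ → ℤ × ℤ} {m k : ℕ}
    (hv : IsLatticeWalk v m) (hbox : ∀ j ≤ m, InBox n (v j)) (hclosed : v m = v 0)
    (hu : IsLatticeWalk u (k + 1)) (hubox : ∀ j ≤ k, InBox n (u j)) (hu0 : u 0 = (0, 0))
    (hexit : (u (k + 1)).1 = -n - 1 ∨ (u (k + 1)).1 = n + 1)
    (hdisj : ∀ i ≤ k, ∀ j ≤ m, u i ≠ v j) :
    faceParity n (walkParity v m) 0 (-1) = 0 := by
  have hout : ∀ p q, ¬ InBox n p → walkParity v m p q = 0 := by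
    intro p q hp
    refine walkParity_eq_zero fun j hj => ⟨?_, ?_⟩
    · rintro ⟨h, -⟩; exact hp (h ▸ hbox j (by omega))
    · rintro ⟨-, h⟩; exact hp (h ▸ hbox (j + 1) (by omega))
  have hoff : ∀ i ≤ k, ∀ q, walkParity v m (u i) q = 0 := by
    intro i hi q
    refine walkParity_eq_zero fun j hj => ⟨?_, ?_⟩
    · rintro ⟨h, -⟩; exact hdisj i hi j (by omega) h.symm
    · rintro ⟨-, h⟩; exact hdisj i hi (j + 1) (by omega) h.symm
  have hsymm := walkParity_comm v m
  have heven : ∀ w, InBox n w → ∑ d, walkParity v m w (w + dir d) = 0 := by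
    intro w _
    rw [walkParity_vertex hv, hclosed, zmod_two_add_self]
  have hbot : ∀ x, walkParity v m (x, -n - 1) (x, -n) = 0 := fun x =>
    hout _ _ (by simp only [InBox]; omega)
  have hzero : ∀ a b : ZMod 2, a + b = 0 → a = b := by decide
  have key : ∀ i ≤ k, ∀ x y, u i = (x, y) →
      (faceParity n (walkParity v m) x y = faceParity n (walkParity v m) 0 (-1) ∧
      faceParity n (walkParity v m) (x - 1) y = faceParity n (walkParity v m) 0 (-1) ∧
      faceParity n (walkParity v m) x (y - 1) = faceParity n (walkParity v m) 0 (-1) ∧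
      faceParity n (walkParity v m) (x - 1) (y - 1) = faceParity n (walkParity v m) 0 (-1)) := by
    intro i
    induction i with
    | zero =>
      intro hi x y hxy
      obtain ⟨rfl, rfl⟩ : x = 0 ∧ y = 0 := by
        rw [hu0] at hxy; simp only [Prod.mk.injEq] at hxy; omega
      obtain ⟨h1, h2, h3, h4⟩ := faceParity_around hsymm heven hbot (hu0 ▸ hubox 0 hi)
      have h := hoff 0 hi
      rw [hu0] at h
      rw [h] at h1 h2 h3 h4
      have := hzero _ _ h1; have := hzero _ _ h2; have := hzero _ _ h3; have := hzero _ _ h4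
      grind
    | succ i ih =>
      intro hi x y hxy
      obtain ⟨h1, h2, h3, h4⟩ := faceParity_around hsymm heven hbot (hxy ▸ hubox (i + 1) hi)
      have h := hoff (i + 1) hi
      rw [hxy] at h
      rw [h] at h1 h2 h3 h4
      have e1 := hzero _ _ h1; have e2 := hzero _ _ h2
      have e3 := hzero _ _ h3; have e4 := hzero _ _ h4
      obtain ⟨d, hd⟩ := hu i (by omega)
      obtain ⟨i1, i2, i3, i4⟩ := ih (by omega) (u i).1 (u i).2 rfl
      rw [hxy] at hd
      have hx : x = (u i).1 + (dir d).1 := congrArg Prod.fst hd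
      have hy : y = (u i).2 + (dir d).2 := congrArg Prod.snd hd
      have : faceParity n (walkParity v m) (x - 1) (y - 1) =
          faceParity n (walkParity v m) 0 (-1) := by
        fin_cases d <;> simp [dir] at hx hy
        · rw [hx, hy, add_sub_cancel_right]; exact i3
        · rw [hx, hy, add_sub_cancel_right]; exact i2
        · rw [← e3, ← e2, hx, hy, show (u i).1 + -1 = (u i).1 - 1 by ring]; exact i2
        · rw [← e4, ← e1, hx, hy, show (u i).2 + -1 = (u i).2 - 1 by ring]; exact i3
      grind
  obtain ⟨d, hd⟩ := hu k (by omega)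
  obtain ⟨k1, k2, -, -⟩ := key k le_rfl (u k).1 (u k).2 rfl
  obtain ⟨b1, b2, b3, b4⟩ := hubox k le_rfl
  have hd1 : (u (k + 1)).1 = (u k).1 + (dir d).1 := congrArg Prod.fst hd
  have hd2 : -1 ≤ (dir d).1 ∧ (dir d).1 ≤ 1 := by fin_cases d <;> simp [dir]
  rcases hexit with h | h
  · rw [← k2]
    refine sum_eq_zero fun y' _ => hout _ _ ?_
    simp only [InBox]; omega
  · rw [← k1]
    refine sum_eq_zero fun y' _ => ?_
    rw [hsymm]
    refine hout _ _ ?_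
    simp only [InBox]; omega

/-- The face to the right of a step leaving `(x, y)` in direction `d`. -/
def rightFaceOut (s : ℤ → ℤ → ZMod 2) (x y : ℤ) : Fin 4 → ZMod 2 :=
  ![s x (y - 1), s x y, s (x - 1) y, s (x - 1) (y - 1)]

/-- The face to the right of a step arriving at `(x, y)` in direction `d`. -/
def rightFaceIn (s : ℤ → ℤ → ZMod 2) (x y : ℤ) : Fin 4 → ZMod 2 :=
  ![s (x - 1) (y - 1), s x (y - 1), s x y, s (x - 1) y]

lemma rightFace_turn {s : ℤ → ℤ → ZMod 2} {e : Fin 4 → ZMod 2} {x y : ℤ}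
    (h0 : s x y + s x (y - 1) = e 0) (h1 : s x y + s (x - 1) y = e 1)
    (h2 : s (x - 1) y + s (x - 1) (y - 1) = e 2)
    (h3 : s x (y - 1) + s (x - 1) (y - 1) = e 3) {din dout : Fin 4}
    (hne : dir din + dir dout ≠ 0)
    (hzero : ∀ d, dir d ≠ dir dout → dir d + dir din ≠ 0 → e d = 0) :
    rightFaceIn s x y din = rightFaceOut s x y dout := by
  have hz : ∀ a b : ZMod 2, a + b = 0 → a = b := by decide
  have g0 := hzero 0
  have g1 := hzero 1
  have g2 := hzero 2
  have g3 := hzero 3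
  rw [← h0] at g0
  rw [← h1] at g1
  rw [← h2] at g2
  rw [← h3] at g3
  clear hzero h0 h1 h2 h3
  fin_cases din <;> fin_cases dout <;>
    simp [dir, rightFaceIn, rightFaceOut] at g0 g1 g2 g3 hne ⊢ <;>
    grind

/-- Two disjoint walks leaving the box from `(0,0)` and `(1,0)` through opposite sides cross the
ray below the edge `{(0,0), (1,0)}` evenly if the first one leaves to the left, and oddly if it
leaves to the right. -/
lemma faceParity_paths {n : ℤ} (hn : 1 ≤ n) {u v : ℕ → ℤ × ℤ} {k m : ℕ} {σ : ℤ}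
    (hσ : σ = 1 ∨ σ = -1)
    (hu : IsLatticeWalk u (k + 1)) (hubox : ∀ j ≤ k, InBox n (u j)) (hu0 : u 0 = (0, 0))
    (hv : IsLatticeWalk v (m + 1)) (hvbox : ∀ j ≤ m, InBox n (v j)) (hv0 : v 0 = (1, 0))
    (huexit : (u (k + 1)).1 = σ * (n + 1)) (hvexit : (v (m + 1)).1 = - (σ * (n + 1)))
    (hinj : ∀ i ≤ k, ∀ j ≤ k, u i = u j → i = j)
    (hdisj : ∀ i ≤ k, ∀ j ≤ m, u i ≠ v j) :
    faceParity n (walkParity u (k + 1)) 0 (-1) + faceParity n (walkParity v (m + 1)) 0 (-1)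
      = if σ = -1 then 0 else 1 := by
  have hstep : ∀ d, -1 ≤ (dir d).1 ∧ (dir d).1 ≤ 1 := by decide
  have hstep2 : ∀ d, (dir d).1 = 0 ∨ (dir d).2 = 0 := by decide
  have hstep1 : ∀ d, (dir d).1 = -1 → d = 2 := by decide
  have hstep0 : ∀ d, (dir d).1 = 1 → d = 0 := by decide
  have hstepb : ∀ d, dir d + dir 2 ≠ 0 →
      stepParity (0, 0) (1, 0) (0, 0) ((0, 0) + dir d) = 0 := by decide
  obtain ⟨du, hdu⟩ := hu k (by omega)
  obtain ⟨dv, hdv⟩ := hv m (by omega)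
  have hdu1 : (u (k + 1)).1 = (u k).1 + (dir du).1 := congrArg Prod.fst hdu
  have hdu2 : (u (k + 1)).2 = (u k).2 + (dir du).2 := congrArg Prod.snd hdu
  have hdv1 : (v (m + 1)).1 = (v m).1 + (dir dv).1 := congrArg Prod.fst hdv
  have hdv2 : (v (m + 1)).2 = (v m).2 + (dir dv).2 := congrArg Prod.snd hdv
  have huk := hubox k le_rfl
  have hvm := hvbox m le_rfl
  simp only [InBox] at huk hvm
  have hduσ : (dir du).1 = σ := by have := hstep du; rcases hσ with rfl | rfl <;> omega
  have hdvσ : (dir dv).1 = -σ := by have := hstep dv; rcases hσ with rfl | rfl <;> omega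
  have hdu2' : (dir du).2 = 0 := by have := hstep2 du; omega
  have hdv2' : (dir dv).2 = 0 := by have := hstep2 dv; omega
  have huk1 : (u k).1 = σ * n := by rcases hσ with rfl | rfl <;> omega
  have huall : ∀ j ≤ k + 1, -n ≤ (u j).2 ∧ (u j).2 ≤ n := by
    intro j hj
    rcases hj.lt_or_eq with h | rfl
    · exact (hubox j (by omega)).2.2
    · omega
  have hvall : ∀ j ≤ m + 1, -n ≤ (v j).2 ∧ (v j).2 ≤ n := by
    intro j hj
    rcases hj.lt_or_eq with h | rfl
    · exact (hvbox j (by omega)).2.2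
    · omega
  have huv : ∀ i ≤ k, ∀ j ≤ m + 1, u i ≠ v j := by
    intro i hi j hj h
    rcases hj.lt_or_eq with h' | rfl
    · exact hdisj i hi j (by omega) h
    · have := hubox i hi
      rw [h] at this
      simp only [InBox] at this
      rcases hσ with rfl | rfl <;> omega
  have hvu : ∀ i ≤ k + 1, ∀ j ≤ m, u i ≠ v j := by
    intro i hi j hj h
    rcases hi.lt_or_eq with h' | rfl
    · exact hdisj i (by omega) j hj h
    · have := hvbox j hj
      rw [← h] at this
      simp only [InBox] at this
      rcases hσ with rfl | rfl <;> omega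
  have hinj' : ∀ i ≤ k, ∀ j ≤ k + 1, u i = u j → i = j := by
    intro i hi j hj h
    rcases hj.lt_or_eq with h' | rfl
    · exact hinj i hi j (by omega) h
    · have := hubox i hi
      rw [h] at this
      simp only [InBox] at this
      rcases hσ with rfl | rfl <;> omega
  let e : ℤ × ℤ → ℤ × ℤ → ZMod 2 := fun p q =>
    walkParity u (k + 1) p q + walkParity v (m + 1) p q + stepParity (0, 0) (1, 0) p q
  have hsymm : ∀ p q, e p q = e q p := by
    intro p q
    simp only [e, walkParity_comm u _ p q, walkParity_comm v _ p q, stepParity_comm _ _ p q]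
  have heven : ∀ w, InBox n w → ∑ d, e w (w + dir d) = 0 := by
    intro w hw
    have h1 := stepParity_vertex (0, 0) 0 w
    have h0 : ((0, 0) : ℤ × ℤ) + dir 0 = (1, 0) := rfl
    rw [h0] at h1
    have hu1 : u (k + 1) ≠ w := by
      rintro rfl; simp only [InBox] at hw; rcases hσ with rfl | rfl <;> omega
    have hv1 : v (m + 1) ≠ w := by
      rintro rfl; simp only [InBox] at hw; rcases hσ with rfl | rfl <;> omega
    simp only [e, sum_add_distrib, walkParity_vertex hu, walkParity_vertex hv, h1, hu0, hv0,
      if_neg hu1, if_neg hv1]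
    linear_combination zmod_two_add_self (if ((0, 0) : ℤ × ℤ) = w then 1 else 0) +
      zmod_two_add_self (if ((1, 0) : ℤ × ℤ) = w then 1 else 0)
  have hbot : ∀ x, e (x, -n - 1) (x, -n) = 0 := by
    intro x
    have h1 : walkParity u (k + 1) (x, -n - 1) (x, -n) = 0 := by
      refine walkParity_eq_zero fun j hj => ⟨?_, ?_⟩
      · rintro ⟨h, -⟩; have := huall j (by omega); rw [h] at this; simp only at this; omega
      · rintro ⟨-, h⟩; have := huall (j + 1) (by omega); rw [h] at this; simp only at this; omega
    have h2 : walkParity v (m + 1) (x, -n - 1) (x, -n) = 0 := by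
      refine walkParity_eq_zero fun j hj => ⟨?_, ?_⟩
      · rintro ⟨h, -⟩; have := hvall j (by omega); rw [h] at this; simp only at this; omega
      · rintro ⟨-, h⟩; have := hvall (j + 1) (by omega); rw [h] at this; simp only at this; omega
    simp only [e, h1, h2, stepParity, Prod.mk.injEq]
    rw [if_neg (by omega), if_neg (by omega)]
    rfl
  have key : ∀ i ≤ k, ∀ d, u (i + 1) = u i + dir d →
      rightFaceOut (faceParity n e) (u i).1 (u i).2 d = faceParity n e 0 0 := by
    intro i
    induction i with
    | zero =>
      intro hi d hd
      have hb := hubox 0 hi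
      rw [hu0] at hb
      obtain ⟨h1, h2, h3, h4⟩ := faceParity_around hsymm heven hbot hb
      have := rightFace_turn (e := fun d => e (0, 0) ((0, 0) + dir d)) (din := 2) (dout := d)
        h1 h2 h3 h4 ?_ ?_
      · rw [hu0, ← this]; rfl
      · intro h
        have h5 : u 1 = (1, 0) := by
          rw [zero_add] at hd
          rw [hd, hu0, show dir d = (1, 0) by
            have : dir d = - dir 2 := by linear_combination h
            rw [this]; rfl]
          rfl
        exact hvu 1 (by omega) 0 (by omega) (by rw [h5, hv0])
      · intro d' h5 h6
        have hd'0 : ((0, 0) : ℤ × ℤ) + dir d' = dir d' := zero_add _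
        have g1 : walkParity u (k + 1) (0, 0) ((0, 0) + dir d') = 0 := by
          refine walkParity_eq_zero fun j hj => ⟨?_, ?_⟩
          · rintro ⟨h7, h8⟩
            have := hinj 0 (by omega) j (by omega) (by rw [hu0, h7])
            subst this
            rw [hd, hu0] at h8
            exact h5 (add_left_cancel h8).symm
          · rintro ⟨-, h8⟩
            have := hinj' 0 (by omega) (j + 1) (by omega) (by rw [hu0, h8])
            omega
        have g2 : walkParity v (m + 1) (0, 0) ((0, 0) + dir d') = 0 := by
          refine walkParity_eq_zero fun j hj => ⟨?_, ?_⟩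
          · rintro ⟨h7, h8⟩
            exact huv 0 (by omega) j (by omega) (by rw [hu0, h7])
          · rintro ⟨-, h8⟩
            exact huv 0 (by omega) (j + 1) (by omega) (by rw [hu0, h8])
        have g3 : stepParity (0, 0) (1, 0) (0, 0) ((0, 0) + dir d') = 0 := by
          exact hstepb d' h6
        simp only [e, g1, g2, g3, add_zero]
    | succ i ih =>
      intro hi d hd
      obtain ⟨d0, hd0⟩ := hu i (by omega)
      obtain ⟨h1, h2, h3, h4⟩ := faceParity_around hsymm heven hbot
        (x := (u (i + 1)).1) (y := (u (i + 1)).2) (hubox (i + 1) hi)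
      have hi0 := ih (by omega) d0 hd0
      have hin : rightFaceOut (faceParity n e) (u i).1 (u i).2 d0 =
          rightFaceIn (faceParity n e) (u (i + 1)).1 (u (i + 1)).2 d0 := by
        rw [hd0]
        fin_cases d0 <;> simp [rightFaceIn, rightFaceOut, dir, ← sub_eq_add_neg]
      rw [← hi0, hin]
      symm
      refine rightFace_turn (e := fun d => e (u (i + 1)) (u (i + 1) + dir d))
        h1 h2 h3 h4 ?_ ?_
      · intro h
        have : u i = u (i + 2) := by rw [hd, hd0, add_assoc, h, add_zero]
        have := hinj' i (by omega) (i + 2) (by omega) this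
        omega
      · intro d' h5 h6
        have g1 : walkParity u (k + 1) (u (i + 1)) (u (i + 1) + dir d') = 0 := by
          refine walkParity_eq_zero fun j hj => ⟨?_, ?_⟩
          · rintro ⟨h7, h8⟩
            have := hinj (i + 1) hi j (by omega) h7.symm
            subst this
            rw [hd] at h8
            exact h5 (add_left_cancel h8).symm
          · rintro ⟨h7, h8⟩
            have := hinj' (i + 1) hi (j + 1) (by omega) h8.symm
            obtain rfl : i = j := by omega
            apply h6
            rw [hd0, add_assoc] at h7
            have h9 : u i + 0 = u i + (dir d0 + dir d') := by rw [add_zero]; exact h7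
            rw [add_comm]
            exact (add_left_cancel h9).symm
        have g2 : walkParity v (m + 1) (u (i + 1)) (u (i + 1) + dir d') = 0 := by
          refine walkParity_eq_zero fun j hj => ⟨?_, ?_⟩
          · rintro ⟨h7, h8⟩
            exact huv (i + 1) hi j (by omega) h7.symm
          · rintro ⟨-, h8⟩
            exact huv (i + 1) hi (j + 1) (by omega) h8.symm
        have g3 : stepParity (0, 0) (1, 0) (u (i + 1)) (u (i + 1) + dir d') = 0 := by
          have h7 : ((0, 0) : ℤ × ℤ) ≠ u (i + 1) := by
            intro h
            have := hinj 0 (by omega) (i + 1) hi (by rw [hu0, h])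
            omega
          have h8 : ((1, 0) : ℤ × ℤ) ≠ u (i + 1) := by
            intro h
            exact hvu (i + 1) (by omega) 0 (by omega) (by rw [hv0, h])
          simp [stepParity, h7, h8]
        simp only [e, g1, g2, g3, add_zero]
  have hsplit : faceParity n e 0 0 = faceParity n (walkParity u (k + 1)) 0 (-1) +
      faceParity n (walkParity v (m + 1)) 0 (-1) + 1 := by
    rw [faceParity_hor n e 0 (by omega)]
    have h1 : e (0, 0) (0 + 1, 0) = 1 := by
      have g1 : walkParity u (k + 1) (0, 0) (1, 0) = 0 := by
        refine walkParity_eq_zero fun j hj => ⟨?_, ?_⟩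
        · rintro ⟨-, h⟩; exact hvu (j + 1) (by omega) 0 (by omega) (by rw [hv0, h])
        · rintro ⟨h, -⟩; exact hvu j (by omega) 0 (by omega) (by rw [hv0, h])
      have g2 : walkParity v (m + 1) (0, 0) (1, 0) = 0 := by
        refine walkParity_eq_zero fun j hj => ⟨?_, ?_⟩
        · rintro ⟨h, -⟩; exact huv 0 (by omega) j (by omega) (by rw [hu0, h])
        · rintro ⟨-, h⟩; exact huv 0 (by omega) (j + 1) (by omega) (by rw [hu0, h])
      simp only [e, zero_add, g1, g2]
      decide
    rw [h1]
    congr 1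
    simp only [faceParity, e, ← sum_add_distrib]
    refine sum_congr rfl fun y hy => ?_
    rw [mem_Icc] at hy
    rw [stepParity, if_neg, if_neg]
    · simp
    · simp only [Prod.mk.injEq]; omega
    · simp only [Prod.mk.injEq]; omega
  have hlast := key k le_rfl du hdu
  have hterm : ∀ x x' y', x' = x + 1 → (x < -n ∨ n < x') →
      e (x, y') (x', y') = stepParity (u k) (u (k + 1)) (x, y') (x', y')
        + stepParity (v m) (v (m + 1)) (x, y') (x', y') := by
    intro x x' y' hx' hx
    have g1 : walkParity u k (x, y') (x', y') = 0 := by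
      refine walkParity_eq_zero fun j hj => ?_
      have h1 := hubox j (by omega)
      have h2 := hubox (j + 1) (by omega)
      simp only [InBox] at h1 h2
      constructor
      · rintro ⟨h, h'⟩; rw [h] at h1; rw [h'] at h2; simp only at h1 h2; omega
      · rintro ⟨h, h'⟩; rw [h] at h1; rw [h'] at h2; simp only at h1 h2; omega
    have g2 : walkParity v m (x, y') (x', y') = 0 := by
      refine walkParity_eq_zero fun j hj => ?_
      have h1 := hvbox j (by omega)
      have h2 := hvbox (j + 1) (by omega)
      simp only [InBox] at h1 h2
      constructor
      · rintro ⟨h, h'⟩; rw [h] at h1; rw [h'] at h2; simp only at h1 h2; omega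
      · rintro ⟨h, h'⟩; rw [h] at h1; rw [h'] at h2; simp only at h1 h2; omega
    have g3 : stepParity (0, 0) (1, 0) (x, y') (x', y') = 0 := by
      rw [stepParity, if_neg, if_neg]
      · simp
      · simp only [Prod.mk.injEq]; omega
      · simp only [Prod.mk.injEq]; omega
    simp only [e, g3, add_zero]
    rw [walkParity, sum_range_succ, ← walkParity, g1, walkParity, sum_range_succ, ← walkParity, g2,
      zero_add, zero_add]
  have two : (1 : ZMod 2) + 1 = 0 := by decide
  rcases hσ with rfl | rfl
  · obtain rfl := hstep0 du hduσ
    have hq : faceParity n e (u k).1 ((u k).2 - 1) = 0 := by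
      refine sum_eq_zero fun y' hy' => ?_
      rw [mem_Icc] at hy'
      rw [hterm _ _ _ rfl (by omega), stepParity, stepParity, if_neg, if_neg, if_neg, if_neg]
      · simp
      all_goals
        simp only [Prod.ext_iff]
        omega
    have : faceParity n e 0 0 = 0 := by rw [← hlast]; exact hq
    rw [hsplit] at this
    simp only [show ¬ (1 : ℤ) = -1 by omega, if_false]
    linear_combination this - two
  · obtain rfl := hstep1 du hduσ
    have hq : faceParity n e ((u k).1 - 1) (u k).2 = 1 := by
      rw [faceParity, sum_eq_single (u k).2]
      · rw [hterm _ _ _ rfl (by omega), stepParity, stepParity, if_neg, if_pos, if_neg, if_neg]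
        · simp
        all_goals
          simp only [Prod.ext_iff, and_true]
          omega
      · intro y' _ hy'
        rw [hterm _ _ _ rfl (by omega), stepParity, stepParity, if_neg, if_neg, if_neg, if_neg]
        · simp
        all_goals
          simp only [Prod.ext_iff]
          omega
      · intro h
        exact absurd (mem_Icc.2 ⟨huk.2.2.1, le_rfl⟩) h
    have : faceParity n e 0 0 = 1 := by rw [← hlast]; exact hq
    rw [hsplit] at this
    simp only [if_true]
    linear_combination this

end LatticeWalk

end TrunkDegree

namespace TrunkDegree

open Finset

section GridDeterminant

/-- Expansion of a determinant along rows which are linear combinations. -/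
lemma det_sum_rows {I J κ : Type*} [Fintype I] [DecidableEq I] [Fintype J] [DecidableEq J]
    [Fintype κ] (c : I → κ → ℝ) (r : I → κ → I ⊕ J → ℝ) (s : J → I ⊕ J → ℝ) :
    (Matrix.of (Sum.elim (fun v w => ∑ d, c v d * r v d w) s)).det =
      ∑ F : I → κ, (∏ v, c v (F v)) * (Matrix.of (Sum.elim (fun v => r v (F v)) s)).det := by
  classical
  let g := (Matrix.detRowAlternating (n := I ⊕ J) (R := ℝ)).toMultilinearMap.currySum
  have hg : ∀ x : I → I ⊕ J → ℝ, g x s = (Matrix.of (Sum.elim x s)).det := by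
    intro x
    rfl
  rw [← hg]
  have h1 : (fun v w => ∑ d, c v d * r v d w) = fun v => ∑ d, c v d • r v d := by
    ext v w
    simp
  rw [h1, MultilinearMap.map_sum, _root_.sum_apply]
  refine sum_congr rfl fun F _ => ?_
  rw [MultilinearMap.map_smul_univ, smul_apply, hg, smul_eq_mul]

/-- The lattice points of the box. -/
noncomputable def boxPoints (n : ℕ) : Finset (ℤ × ℤ) := Icc (-(n : ℤ)) n ×ˢ Icc (-(n : ℤ)) n

/-- The sites of the box, as a type. -/
abbrev Site (n : ℕ) : Type := {p : ℤ × ℤ // p ∈ boxPoints n}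

lemma mem_boxPoints {n : ℕ} {p : ℤ × ℤ} : p ∈ boxPoints n ↔ InBox n p := by
  simp [boxPoints, InBox, and_assoc]

/-- The endpoint of the step in direction `d` from `v`, where leaving the box means stepping to
one of the two roots. -/
noncomputable def step {n : ℕ} (v : Site n) (d : Fin 4) : Site n ⊕ Bool :=
  if h : v.1 + dir d ∈ boxPoints n then Sum.inl ⟨v.1 + dir d, h⟩
  else Sum.inr (decide (0 < (dir d).1))

/-- A step is allowed if it does not leave through the top or the bottom of the box and is not
along the edge `{(0,0), (1,0)}`. -/
def Allowed {n : ℕ} (v : Site n) (d : Fin 4) : Prop :=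
  (-(n : ℤ) ≤ v.1.2 + (dir d).2 ∧ v.1.2 + (dir d).2 ≤ n) ∧
    ¬ (v.1 = (0, 0) ∧ d = 0) ∧ ¬ (v.1 = (1, 0) ∧ d = 2)

instance {n : ℕ} (v : Site n) (d : Fin 4) : Decidable (Allowed v d) := by
  unfold Allowed; infer_instance

/-- The sign `-1` on the edges between columns `0` and `1` below the horizontal axis. -/
noncomputable def zipperSign (p : ℤ × ℤ) (d : Fin 4) : ℝ :=
  if p.2 < 0 ∧ (p.1 = 0 ∧ d = 0 ∨ p.1 = 1 ∧ d = 2) then -1 else 1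

/-- The weight of a step: in-edges of `(1,0)` have weight `t`. -/
noncomputable def stepWeight {n : ℕ} (t : ℝ) (v : Site n) (d : Fin 4) : ℝ :=
  if Allowed v d then (if v.1 + dir d = (1, 0) then t else 1) else 0

/-- The signed weighted Laplacian with two extra rows `δ_a` and `δ_b`. -/
noncomputable def gridMatrix {n : ℕ} (a b : Site n) (t : ℝ) : Matrix (Site n ⊕ Bool) (Site n ⊕ Bool) ℝ :=
  Matrix.of (Sum.elim
    (fun v w => ∑ d, stepWeight t v d *
      ((if w = Sum.inl v then 1 else 0) - zipperSign v.1 d * (if w = step v d then 1 else 0)))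
    (fun β w => if w = Sum.inl (bif β then b else a) then 1 else 0))

/-- Direction fields pointing along allowed steps, flowing into the roots, and separating
`a` from `b`. -/
def GoodField {n : ℕ} (a b : Site n) (F : Site n → Fin 4) : Prop :=
  (∀ v, Allowed v (F v)) ∧
  (∀ v, ∃ β, ReachesRoot (fun v => step v (F v)) (Sum.inl v) β) ∧
  ∃ β, ReachesRoot (fun v => step v (F v)) (Sum.inl a) β ∧
    ReachesRoot (fun v => step v (F v)) (Sum.inl b) (!β)

/-- The character `ZMod 2 → {1, -1}`. -/
noncomputable def parityChar (x : ZMod 2) : ℝ := if x = 0 then 1 else -1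

lemma parityChar_add (x y : ZMod 2) : parityChar (x + y) = parityChar x * parityChar y := by
  have h : ∀ z : ZMod 2, z = 0 ∨ z = 1 := by decide
  have h1 : (1 : ZMod 2) ≠ 0 := by decide
  have h2 : (1 : ZMod 2) + 1 = 0 := by decide
  rcases h x with rfl | rfl <;> rcases h y with rfl | rfl <;> simp [parityChar, h1, h2]

lemma parityChar_sum {ι : Type*} (s : Finset ι) (f : ι → ZMod 2) :
    parityChar (∑ i ∈ s, f i) = ∏ i ∈ s, parityChar (f i) := by
  classical
  induction s using Finset.induction_on with
  | empty => simp [parityChar]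
  | insert i s hi ih => rw [sum_insert hi, prod_insert hi, parityChar_add, ih]

lemma prod_zipperSign {n : ℕ} {v : ℕ → ℤ × ℤ} {m : ℕ} {d : ℕ → Fin 4}
    (hbox : ∀ j < m, InBox n (v j)) (hd : ∀ j < m, v (j + 1) = v j + dir (d j)) :
    ∏ j ∈ range m, zipperSign (v j) (d j)
      = parityChar (faceParity n (walkParity v m) 0 (-1)) := by
  simp only [faceParity, walkParity]
  rw [sum_comm, parityChar_sum]
  refine prod_congr rfl fun j hj => ?_
  rw [mem_range] at hj
  have hb := hbox j hj
  rw [hd j hj]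
  generalize v j = p at hb
  generalize d j = d
  obtain ⟨x, y⟩ := p
  simp only [InBox] at hb
  have hd' : ∀ d, dir d = (1, 0) ∧ d = 0 ∨ dir d = (0, 1) ∧ d = 1 ∨ dir d = (-1, 0) ∧ d = 2 ∨
    dir d = (0, -1) ∧ d = 3 := by decide
  by_cases hc : y < 0 ∧ (x = 0 ∧ d = 0 ∨ x = 1 ∧ d = 2)
  · rw [zipperSign, if_pos hc, sum_eq_single y]
    · obtain ⟨-, ⟨rfl, rfl⟩ | ⟨rfl, rfl⟩⟩ := hc <;> simp [stepParity, dir, parityChar]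
    · intro y' _ hy'
      have : ¬ y = y' := fun h => hy' h.symm
      simp [stepParity, this]
    · intro h
      rw [mem_Icc] at h
      omega
  · rw [zipperSign, if_neg hc, sum_eq_zero]
    · simp [parityChar]
    · intro y' hy'
      rw [mem_Icc] at hy'
      rw [stepParity, if_neg, if_neg]
      · simp
      · rintro ⟨h1, h2⟩
        rcases hd' d with ⟨h, h'⟩ | ⟨h, h'⟩ | ⟨h, h'⟩ | ⟨h, h'⟩ <;> rw [h] at h2 <;>
          simp only [Prod.mk_add_mk, Prod.mk.injEq] at h1 h2 <;> omega
      · rintro ⟨h1, h2⟩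
        rcases hd' d with ⟨h, h'⟩ | ⟨h, h'⟩ | ⟨h, h'⟩ | ⟨h, h'⟩ <;> rw [h] at h2 <;>
          simp only [Prod.mk_add_mk, Prod.mk.injEq] at h1 h2 <;> omega

lemma step_eq_inl {n : ℕ} {v w : Site n} {d : Fin 4} (h : step v d = Sum.inl w) :
    w.1 = v.1 + dir d := by
  unfold step at h
  split_ifs at h with h1
  rw [← Sum.inl_injective h]

lemma step_eq_inr {n : ℕ} {v : Site n} {d : Fin 4} {β : Bool} (hall : Allowed v d)
    (h : step v d = Sum.inr β) :
    (v.1 + dir d).1 = (bif β then 1 else -1) * ((n : ℤ) + 1) ∧ dir d = (bif β then 1 else -1, 0) := by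
  unfold step at h
  split_ifs at h with h1
  rw [mem_boxPoints] at h1
  have h2 := mem_boxPoints.1 v.2
  have h3 := hall.1
  rw [← Sum.inr_injective h]
  simp only [InBox, Prod.fst_add, Prod.snd_add] at *
  fin_cases d <;> simp [dir] at * <;> omega

/-- The orbit of a vertex which flows into a root, as a lattice walk leaving the box. -/
lemma exists_exit_walk {n : ℕ} {F : Site n → Fin 4} (hF : ∀ v, Allowed v (F v)) {a : Site n}
    {β : Bool} (h : ReachesRoot (fun v => step v (F v)) (Sum.inl a) β) :
    ∃ (k : ℕ) (c : ℕ → Site n) (u : ℕ → ℤ × ℤ),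
      (∀ j ≤ k, (nxt fun v => step v (F v))^[j] (Sum.inl a) = Sum.inl (c j)) ∧
      (nxt fun v => step v (F v))^[k + 1] (Sum.inl a) = Sum.inr β ∧
      (∀ j ≤ k, u j = (c j).1) ∧ (∀ j < k + 1, u (j + 1) = u j + dir (F (c j))) ∧
      (u (k + 1)).1 = (bif β then 1 else -1) * ((n : ℤ) + 1) ∧
      (∀ i ≤ k, ∀ j ≤ k, c i = c j → i = j) := by
  classical
  set f := fun v => step v (F v) with hf
  have h' : ∃ k, ∃ β, (nxt f)^[k] (Sum.inl a) = Sum.inr β := by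
    obtain ⟨k, hk⟩ := h; exact ⟨k, β, hk⟩
  obtain ⟨γ, hγ⟩ := Nat.find_spec h'
  have hmin : ∀ j < Nat.find h', ∃ w, (nxt f)^[j] (Sum.inl a) = Sum.inl w := by
    intro j hj
    have := Nat.find_min h' hj
    rcases hw : (nxt f)^[j] (Sum.inl a) with w | γ
    · exact ⟨w, rfl⟩
    · exact absurd ⟨γ, hw⟩ this
  rcases hk : Nat.find h' with _ | k
  · rw [hk] at hγ; simp at hγ
  rw [hk] at hγ hmin
  obtain rfl : γ = β := ReachesRoot.unique ⟨_, hγ⟩ h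
  have hch : ∀ j, ∃ w, j ≤ k → (nxt f)^[j] (Sum.inl a) = Sum.inl w := by
    intro j
    by_cases hj : j ≤ k
    · obtain ⟨w, hw⟩ := hmin j (by omega)
      exact ⟨w, fun _ => hw⟩
    · exact ⟨a, fun h => absurd h hj⟩
  choose c hc using hch
  have hlast : step (c k) (F (c k)) = Sum.inr γ := by
    rw [Function.iterate_succ_apply', hc k le_rfl] at hγ
    exact hγ
  have hstep : ∀ j < k, (c (j + 1)).1 = (c j).1 + dir (F (c j)) := by
    intro j hj
    apply step_eq_inl
    have := hc (j + 1) (by omega)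
    rw [Function.iterate_succ_apply', hc j (by omega)] at this
    exact this
  refine ⟨k, c, fun j => if j ≤ k then (c j).1 else (c k).1 + dir (F (c k)), hc, hγ, ?_, ?_, ?_, ?_⟩
  · intro j hj; simp [hj]
  · intro j hj
    rcases Nat.lt_or_ge j k with h1 | h1
    · simp only [show j + 1 ≤ k by omega, show j ≤ k by omega, if_true]
      exact hstep j h1
    · obtain rfl : j = k := by omega
      simp
  · simp only [show ¬ k + 1 ≤ k by omega, if_false]
    exact (step_eq_inr (hF _) hlast).1
  · intro i hi j hj hij
    by_contra hne
    wlog hlt : i < j generalizing i j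
    · exact this j hj i hi hij.symm (fun h => hne h.symm) (by omega)
    have h1 : (nxt f)^[i] (Sum.inl a) = (nxt f)^[j] (Sum.inl a) := by rw [hc i hi, hc j hj, hij]
    have h2 : (nxt f)^[k + 1 - j + i] (Sum.inl a) = Sum.inr γ := by
      rw [Function.iterate_add_apply, h1, ← Function.iterate_add_apply,
        show k + 1 - j + j = k + 1 by omega, hγ]
    obtain ⟨w, hw⟩ := hmin (k + 1 - j + i) (by omega)
    rw [hw] at h2
    exact Sum.inl_ne_inr h2

/-- The signed determinant detects good direction fields. -/
lemma det_rootedMatrix_step {n : ℕ} (hn : 1 ≤ n) {a b : Site n} (ha : a.1 = (0, 0))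
    (hb : b.1 = (1, 0)) {F : Site n → Fin 4} (hF : ∀ v, Allowed v (F v)) :
    (GoodField a b F →
      (rootedMatrix (fun v => step v (F v)) (fun v => zipperSign v.1 (F v)) a b).det = 1) ∧
    (¬ GoodField a b F →
      (rootedMatrix (fun v => step v (F v)) (fun v => zipperSign v.1 (F v)) a b).det = 0) := by
  classical
  set f := fun v => step v (F v) with hf
  set φ := fun v : Site n => zipperSign v.1 (F v) with hφ
  obtain ⟨ψ, hψ0, hψ1, hdet⟩ := det_rootedMatrix f φ a b
  rw [hdet]
  have hn' : (1 : ℤ) ≤ n := by exact_mod_cast hn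
  have hpw : ∀ (k : ℕ) (w : Site n) (c : ℕ → Site n),
      (∀ j ≤ k, (nxt f)^[j] (Sum.inl w) = Sum.inl (c j)) →
      pathWeight f φ (k + 1) (Sum.inl w) = ∏ j ∈ range (k + 1), zipperSign (c j).1 (F (c j)) := by
    intro k w c hc
    refine prod_congr rfl fun j hj => ?_
    rw [mem_range] at hj
    rw [hc j (by omega)]
    rfl
  by_cases hsep : ∃ β, ReachesRoot f (Sum.inl a) β ∧ ReachesRoot f (Sum.inl b) (!β)
  · obtain ⟨β, haβ, hbβ⟩ := hsep
    obtain ⟨k, c, u, hc, hcend, huc, hu, huexit, hcinj⟩ := exists_exit_walk hF haβ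
    have hu0 : u 0 = (0, 0) := by
      rw [huc 0 (by omega), ← ha]
      have := hc 0 (by omega)
      rw [Function.iterate_zero, id] at this
      rw [Sum.inl_injective this]
    have huw : IsLatticeWalk u (k + 1) := fun j hj => ⟨_, hu j hj⟩
    have hubox : ∀ j ≤ k, InBox n (u j) := fun j hj => by
      rw [huc j hj]; exact mem_boxPoints.1 (c j).2
    by_cases hall : ∀ v, ∃ β, ReachesRoot f (Sum.inl v) β
    · refine ⟨fun _ => ?_, fun h => absurd ⟨hF, hall, β, haβ, hbβ⟩ h⟩
      rw [det_innerMatrix_of_reaches f φ hall, one_mul]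
      obtain ⟨m, c', v, hc', hcend', hvc, hv, hvexit, hcinj'⟩ := exists_exit_walk hF hbβ
      have hv0 : v 0 = (1, 0) := by
        rw [hvc 0 (by omega), ← hb]
        have := hc' 0 (by omega)
        rw [Function.iterate_zero, id] at this
        rw [Sum.inl_injective this]
      have hvw : IsLatticeWalk v (m + 1) := fun j hj => ⟨_, hv j hj⟩
      have hvbox : ∀ j ≤ m, InBox n (v j) := fun j hj => by
        rw [hvc j hj]; exact mem_boxPoints.1 (c' j).2
      have hpar := faceParity_paths hn' (σ := bif β then 1 else -1) (by cases β <;> simp)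
        huw hubox hu0 hvw hvbox hv0 huexit (by rw [hvexit]; cases β <;> simp)
        (fun i hi j hj hij => hcinj i hi j hj (by
          rw [huc i hi, huc j hj] at hij; exact Subtype.ext hij))
        (fun i hi j hj hij => by
          rw [huc i hi, hvc j hj] at hij
          have h1 : (nxt f)^[i] (Sum.inl a) = (nxt f)^[j] (Sum.inl b) := by
            rw [hc i hi, hc' j hj, Subtype.ext hij]
          have h2 : (nxt f)^[k + 1 + i] (Sum.inl a) = Sum.inr β := iterate_nxt_of_le hcend (by omega)
          have h3 : (nxt f)^[m + 1 + j] (Sum.inl b) = Sum.inr (!β) :=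
            iterate_nxt_of_le hcend' (by omega)
          rw [Function.iterate_add_apply] at h2 h3
          rw [← h1] at h3
          exact absurd (ReachesRoot.unique ⟨_, h2⟩ ⟨_, h3⟩) (by cases β <;> simp))
      have hza := hψ1 a β (k + 1) hcend
      have hzb := hψ1 b (!β) (m + 1) hcend'
      rw [hpw k a c hc, prod_congr rfl (fun j hj => by
          rw [← huc j (by rw [mem_range] at hj; omega)]),
        prod_zipperSign (n := n) (d := fun j => F (c j)) (fun j hj => hubox j (by omega)) hu] at hza
      rw [hpw m b c' hc', prod_congr rfl (fun j hj => by
          rw [← hvc j (by rw [mem_range] at hj; omega)]),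
        prod_zipperSign (n := n) (d := fun j => F (c' j)) (fun j hj => hvbox j (by omega)) hv] at hzb
      have hprod : ψ a β * ψ b (!β) = bif β then -1 else 1 := by
        rw [hza, hzb, ← parityChar_add, hpar]
        cases β <;> simp [parityChar]
      have hz1 : ψ a (!β) = 0 := hψ0 a _ fun h =>
        absurd (ReachesRoot.unique haβ h) (by cases β <;> simp)
      cases β
      · simp only [Bool.not_false, cond_false] at hprod hz1
        rw [hprod, hz1]; ring
      · simp only [Bool.not_true, cond_true] at hprod hz1
        rw [hprod, hz1]; ring
    · refine ⟨fun h => absurd h.2.1 hall, fun _ => ?_⟩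
      push Not at hall
      obtain ⟨v, hv⟩ := hall
      have hch : ∀ j, ∃ w, (nxt f)^[j] (Sum.inl v) = Sum.inl w := by
        intro j
        rcases hw : (nxt f)^[j] (Sum.inl v) with w | γ
        · exact ⟨w, rfl⟩
        · exact absurd ⟨j, hw⟩ (hv γ)
      choose e he using hch
      obtain ⟨i, j, hij, heij⟩ := Finite.exists_ne_map_eq_of_infinite e
      wlog hlt : i < j generalizing i j
      · exact this j i hij.symm heij.symm (by omega)
      have hper : ∃ p, 0 < p ∧ e (i + p) = e i :=
        ⟨j - i, by omega, by rw [show i + (j - i) = j by omega, heij]⟩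
      obtain ⟨hp0, hp1⟩ := Nat.find_spec hper
      have hmin : ∀ q, 0 < q → q < Nat.find hper → e (i + q) ≠ e i := fun q h1 h2 h3 =>
        Nat.find_min hper h2 ⟨h1, h3⟩
      generalize Nat.find hper = p at hp0 hp1 hmin
      have hfe : ∀ q, f (e q) = Sum.inl (e (q + 1)) := by
        intro q
        have := he (q + 1)
        rw [Function.iterate_succ_apply', he q] at this
        exact this
      have hclosed := faceParity_closed (n := n) (v := fun q => (e (i + q)).1) (u := u) (m := p)
        (k := k) (fun q _ => ⟨F (e (i + q)), step_eq_inl (hfe (i + q))⟩)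
        (fun q _ => mem_boxPoints.1 (e (i + q)).2) (by simp only [hp1, add_zero]) huw hubox hu0
        (by rw [huexit]; cases β <;> simp; omega)
        (fun q hq r hr hqr => by
          rw [huc q hq] at hqr
          have h1 : (nxt f)^[q] (Sum.inl a) = (nxt f)^[i + r] (Sum.inl v) := by
            rw [hc q hq, he, Subtype.ext hqr]
          have h2 : (nxt f)^[k + 1 + q] (Sum.inl a) = Sum.inr β := iterate_nxt_of_le hcend (by omega)
          rw [Function.iterate_add_apply, h1, ← Function.iterate_add_apply] at h2
          exact hv β ⟨_, h2⟩)
      rw [det_innerMatrix_of_cycle f φ (fun q => e (i + q)) p hp0 (fun q => hfe (i + q)) hp1 hmin ?_,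
        zero_mul]
      have := prod_zipperSign (n := n) (v := fun q => (e (i + q)).1) (m := p)
        (d := fun q => F (e (i + q))) (fun q _ => mem_boxPoints.1 (e (i + q)).2)
        (fun q _ => step_eq_inl (hfe (i + q)))
      rw [hclosed] at this
      rw [hφ, this]
      simp [parityChar]
  · refine ⟨fun h => absurd h.2.2 hsep, fun _ => ?_⟩
    have : ψ a false * ψ b true - ψ a true * ψ b false = 0 := by
      have h1 : ∀ β, ψ a β * ψ b (!β) = 0 := by
        intro β
        by_cases h : ReachesRoot f (Sum.inl a) β
        · rw [hψ0 b _ (fun h' => hsep ⟨β, h, h'⟩), mul_zero]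
        · rw [hψ0 a _ h, zero_mul]
      have h2 := h1 false
      have h3 := h1 true
      simp only [Bool.not_false, Bool.not_true] at h2 h3
      rw [h2, h3, sub_zero]
    rw [this, mul_zero]

/-- The number of in-edges of `b` in a direction field. -/
noncomputable def inDegree {n : ℕ} (F : Site n → Fin 4) : ℕ := #{v | v.1 + dir (F v) = (1, 0)}

open Classical in
/-- The determinant of `gridMatrix` is the generating function of the in-degree of `b`. -/
lemma det_gridMatrix {n : ℕ} (hn : 1 ≤ n) {a b : Site n} (ha : a.1 = (0, 0))
    (hb : b.1 = (1, 0)) (t : ℝ) :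
    (gridMatrix a b t).det = ∑ F with GoodField a b F, t ^ inDegree F := by
  rw [gridMatrix, det_sum_rows, sum_filter]
  refine sum_congr rfl fun F _ => ?_
  have hM : (Matrix.of (Sum.elim (fun v w => (if w = Sum.inl v then 1 else 0) -
      zipperSign v.1 (F v) * (if w = step v (F v) then 1 else 0))
      (fun β w => if w = Sum.inl (bif β then b else a) then 1 else 0)) :
      Matrix (Site n ⊕ Bool) (Site n ⊕ Bool) ℝ) =
      rootedMatrix (fun v => step v (F v)) (fun v => zipperSign v.1 (F v)) a b := by
    ext u w
    rcases u with v | β <;> rfl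
  rw [hM]
  by_cases hF : ∀ v, Allowed v (F v)
  · have hw : ∏ v, stepWeight t v (F v) = t ^ inDegree F := by
      simp only [stepWeight, hF, if_true]
      rw [prod_ite]
      simp [inDegree]
    rw [hw]
    split_ifs with hgood
    · rw [(det_rootedMatrix_step hn ha hb hF).1 hgood, mul_one]
    · rw [(det_rootedMatrix_step hn ha hb hF).2 hgood, mul_zero]
  · have hbad : ¬ GoodField a b F := fun h => hF h.1
    push Not at hF
    obtain ⟨v, hv⟩ := hF
    rw [if_neg hbad, prod_eq_zero (mem_univ v) (by simp [stepWeight, hv]), zero_mul]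

end GridDeterminant

end TrunkDegree

namespace TrunkDegree

open Finset

set_option linter.unusedSectionVars false

section TreeOfMap

variable {I : Type*} [Fintype I] [DecidableEq I]

/-- The graph with the edges `{v, f v}` and `{a, b}`. -/
def treeOf (f : I → I ⊕ Bool) (a b : I) : SimpleGraph (I ⊕ Bool) :=
  SimpleGraph.fromEdgeSet (insert s(Sum.inl a, Sum.inl b) (Set.range fun v => s(Sum.inl v, f v)))

/-- Maps following edges of `G` other than `{a, b}`, flowing into the roots, and
separating `a` from `b`. -/
structure GoodMap (G : SimpleGraph (I ⊕ Bool)) (a b : I) (f : I → I ⊕ Bool) : Prop where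
  adj : ∀ v, G.Adj (Sum.inl v) (f v)
  ne : ∀ v, s(Sum.inl v, f v) ≠ s(Sum.inl a, Sum.inl b)
  reach : ∀ v, ∃ β, ReachesRoot f (Sum.inl v) β
  sep : ∃ β, ReachesRoot f (Sum.inl a) β ∧ ReachesRoot f (Sum.inl b) (!β)

/-- Spanning trees of `G` in which `{a, b}` separates the two roots. -/
structure TrunkTree (G : SimpleGraph (I ⊕ Bool)) (a b : I) (T : SimpleGraph (I ⊕ Bool)) : Prop where
  le : T ≤ G
  tree : T.IsTree
  adj : T.Adj (Sum.inl a) (Sum.inl b)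
  sep : ¬ (T.deleteEdges {s(Sum.inl a, Sum.inl b)}).Reachable (Sum.inr false) (Sum.inr true)

lemma not_two_cycle {f : I → I ⊕ Bool} {v w : I} {β : Bool} (hv : ReachesRoot f (Sum.inl v) β)
    (h1 : f v = Sum.inl w) (h2 : f w = Sum.inl v) : False := by
  obtain ⟨k, hk⟩ := hv
  have key : ∀ k, (nxt f)^[k] (Sum.inl v) = Sum.inl v ∨ (nxt f)^[k] (Sum.inl v) = Sum.inl w := by
    intro k
    induction k with
    | zero => simp
    | succ k ih =>
      rw [Function.iterate_succ_apply']
      rcases ih with h | h <;> rw [h] <;> simp [nxt, h1, h2]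
  rcases key k with h | h <;> rw [h] at hk <;> exact Sum.inl_ne_inr hk

variable {G : SimpleGraph (I ⊕ Bool)} {a b : I} {f g : I → I ⊕ Bool}

lemma GoodMap.a_ne_b (hf : GoodMap G a b f) : a ≠ b := by
  rintro rfl
  obtain ⟨β, h1, h2⟩ := hf.sep
  exact absurd (h1.unique h2) (by cases β <;> simp)

lemma treeOf_adj (hf : GoodMap G a b f) {u w : I ⊕ Bool} : (treeOf f a b).Adj u w ↔
    s(u, w) = s(Sum.inl a, Sum.inl b) ∨ ∃ v, s(Sum.inl v, f v) = s(u, w) := by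
  simp only [treeOf, SimpleGraph.fromEdgeSet_adj, Set.mem_insert_iff, Set.mem_range]
  refine ⟨fun h => h.1, fun h => ⟨h, ?_⟩⟩
  rintro rfl
  rcases h with h | ⟨v, h⟩
  · rw [Sym2.eq_iff] at h
    have : a = b := by
      rcases h with ⟨h1, h2⟩ | ⟨h1, h2⟩
      · exact Sum.inl_injective (h1.symm.trans h2)
      · exact Sum.inl_injective (h2.symm.trans h1)
    exact hf.a_ne_b this
  · rw [Sym2.eq_iff] at h
    have h' : f v = Sum.inl v := by
      rcases h with ⟨h1, h2⟩ | ⟨h1, h2⟩ <;> rw [h1, h2]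
    exact (hf.adj v).ne h'.symm

lemma GoodMap.reachable_root (hf : GoodMap G a b f) {w : I ⊕ Bool} {β : Bool}
    (h : ReachesRoot f w β) : (treeOf f a b).Reachable w (Sum.inr β) := by
  obtain ⟨k, hk⟩ := h
  induction k generalizing w with
  | zero => rw [Function.iterate_zero, id] at hk; rw [hk]
  | succ k ih =>
    rw [Function.iterate_succ_apply] at hk
    refine SimpleGraph.Reachable.trans ?_ (ih hk)
    rcases w with v | γ
    · exact SimpleGraph.Adj.reachable ((treeOf_adj hf).2 (Or.inr ⟨v, rfl⟩))
    · exact SimpleGraph.Reachable.refl _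

lemma GoodMap.connected (hf : GoodMap G a b f) : (treeOf f a b).Connected := by
  rw [SimpleGraph.connected_iff_exists_forall_reachable]
  obtain ⟨β, h1, h2⟩ := hf.sep
  have hab : (treeOf f a b).Adj (Sum.inl a) (Sum.inl b) := (treeOf_adj hf).2 (Or.inl rfl)
  have hββ : ∀ γ, (treeOf f a b).Reachable (Sum.inl a) (Sum.inr γ) := by
    intro γ
    by_cases h : γ = β
    · rw [h]; exact hf.reachable_root h1
    · have : γ = !β := by cases γ <;> cases β <;> simp_all
      rw [this]
      exact hab.reachable.trans (hf.reachable_root h2)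
  refine ⟨Sum.inl a, fun w => ?_⟩
  rcases w with v | γ
  · obtain ⟨γ, hγ⟩ := hf.reach v
    exact (hββ γ).trans (hf.reachable_root hγ).symm
  · exact hββ γ

lemma GoodMap.isTree (hf : GoodMap G a b f) : (treeOf f a b).IsTree := by
  rw [SimpleGraph.isTree_iff_connected_and_card]
  refine ⟨hf.connected, le_antisymm ?_ hf.connected.card_vert_le_card_edgeSet_add_one⟩
  have h1 : (treeOf f a b).edgeSet ⊆
      insert s(Sum.inl a, Sum.inl b) (Set.range fun v => s(Sum.inl v, f v)) := by
    rw [treeOf, SimpleGraph.edgeSet_fromEdgeSet]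
    exact Set.sdiff_subset
  have h2 := Set.ncard_le_ncard h1 (Set.toFinite _)
  have h3 := Set.ncard_insert_le s(Sum.inl a, Sum.inl b) (Set.range fun v => s(Sum.inl v, f v))
  have h4 : (Set.range fun v => s(Sum.inl v, f v)).ncard ≤ Nat.card I := by
    rw [← Set.image_univ, ← Set.ncard_univ]
    exact Set.ncard_image_le (Set.toFinite _)
  have h5 : Nat.card (I ⊕ Bool) = Nat.card I + 2 := by
    rw [Nat.card_sum]; simp
  rw [h5, Nat.card_coe_set_eq]
  omega

lemma GoodMap.reachesRoot_of_reachable (hf : GoodMap G a b f) {u w : I ⊕ Bool} {β : Bool}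
    (h : ((treeOf f a b).deleteEdges {s(Sum.inl a, Sum.inl b)}).Reachable u w)
    (hu : ReachesRoot f u β) : ReachesRoot f w β := by
  rw [SimpleGraph.reachable_iff_reflTransGen] at h
  induction h with
  | refl => exact hu
  | tail _ h ih =>
    rw [SimpleGraph.deleteEdges_adj, treeOf_adj hf] at h
    obtain ⟨h | ⟨v, h⟩, h'⟩ := h
    · exact absurd h h'
    · rw [Sym2.eq_iff] at h
      rcases h with ⟨rfl, rfl⟩ | ⟨rfl, rfl⟩
      · exact (reachesRoot_inl f v β).1 ih
      · exact (reachesRoot_inl f v β).2 ih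

lemma GoodMap.trunkTree (hf : GoodMap G a b f) (hab : G.Adj (Sum.inl a) (Sum.inl b)) :
    TrunkTree G a b (treeOf f a b) where
  le := by
    intro u w h
    rw [treeOf_adj hf] at h
    rcases h with h | ⟨v, h⟩
    · rw [← SimpleGraph.mem_edgeSet, h]; exact hab
    · rw [← SimpleGraph.mem_edgeSet, ← h]; exact hf.adj v
  tree := hf.isTree
  adj := (treeOf_adj hf).2 (Or.inl rfl)
  sep := fun h => by
    have := hf.reachesRoot_of_reachable h ((reachesRoot_inr f).2 rfl)
    rw [reachesRoot_inr] at this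
    exact absurd this (by simp)

lemma GoodMap.treeOf_injective (hf : GoodMap G a b f) (hg : GoodMap G a b g)
    (h : treeOf f a b = treeOf g a b) : f = g := by
  have key : ∀ k v β, (nxt g)^[k] (Sum.inl v) = Sum.inr β → f v = g v := by
    intro k
    induction k with
    | zero => intro v β h; simp at h
    | succ k ih =>
      intro v β hk
      have hadj : (treeOf f a b).Adj (Sum.inl v) (g v) := by
        rw [h, treeOf_adj hg]; exact Or.inr ⟨v, rfl⟩
      rw [treeOf_adj hf] at hadj
      rcases hadj with h1 | ⟨w, h1⟩
      · exact absurd h1 (hg.ne v)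
      · rw [Sym2.eq_iff] at h1
        rcases h1 with ⟨h1, h2⟩ | ⟨h1, h2⟩
        · rw [← h2, Sum.inl_injective h1]
        · have h3 : f w = g w := by
            refine ih w β ?_
            rw [Function.iterate_succ_apply] at hk
            have : nxt g (Sum.inl v) = g v := rfl
            rwa [this, ← h1] at hk
          rw [h3] at h2
          exact (not_two_cycle ⟨k + 1, hk⟩ h1.symm h2).elim
  funext v
  obtain ⟨β, k, hk⟩ := hg.reach v
  exact key k v β hk

lemma GoodMap.ncard_neighborSet (hf : GoodMap G a b f) :
    ((treeOf f a b).neighborSet (Sum.inl b)).ncard = #{v | f v = Sum.inl b} + 2 := by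
  have h1 : (treeOf f a b).neighborSet (Sum.inl b) =
      insert (Sum.inl a) (insert (f b) (Sum.inl '' {v | f v = Sum.inl b})) := by
    ext w
    rw [SimpleGraph.mem_neighborSet, treeOf_adj hf]
    simp only [Set.mem_insert_iff, Set.mem_image, Set.mem_ofPred_eq]
    constructor
    · rintro (h | ⟨v, h⟩)
      · rw [Sym2.eq_iff] at h
        rcases h with ⟨h2, h3⟩ | ⟨h2, h3⟩
        · exact absurd (Sum.inl_injective h2).symm hf.a_ne_b
        · exact Or.inl h3
      · rw [Sym2.eq_iff] at h
        rcases h with ⟨h2, h3⟩ | ⟨h2, h3⟩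
        · rw [← h3, Sum.inl_injective h2]; simp
        · exact Or.inr (Or.inr ⟨v, h3, h2⟩)
    · rintro (rfl | rfl | ⟨v, h, rfl⟩)
      · left; rw [Sym2.eq_swap]
      · right; exact ⟨b, rfl⟩
      · right; exact ⟨v, by rw [h, Sym2.eq_swap]⟩
  have h2 : f b ∉ Sum.inl '' {v | f v = Sum.inl b} := by
    rintro ⟨v, hv, hv'⟩
    obtain ⟨β, hβ⟩ := hf.reach b
    exact not_two_cycle hβ hv'.symm hv
  have h3 : (Sum.inl a : I ⊕ Bool) ∉ insert (f b) (Sum.inl '' {v | f v = Sum.inl b}) := by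
    rw [Set.mem_insert_iff]
    rintro (h | ⟨v, hv, hv'⟩)
    · exact hf.ne b (by rw [← h, Sym2.eq_swap])
    · rw [Sum.inl_injective hv'] at hv
      exact hf.ne a (by rw [hv])
  rw [h1, Set.ncard_insert_of_notMem h3 (Set.toFinite _),
    Set.ncard_insert_of_notMem h2 (Set.toFinite _), Set.ncard_image_of_injective _ Sum.inl_injective,
    ← Set.ncard_coe_finset]
  simp

lemma TrunkTree.exists_goodMap {T : SimpleGraph (I ⊕ Bool)} (hT : TrunkTree G a b T) :
    ∃ f, GoodMap G a b f ∧ treeOf f a b = T := by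
  classical
  set T' := T.deleteEdges {s(Sum.inl a, Sum.inl b)} with hT'
  have hTT' : ∀ u w, T.Adj u w → s(u, w) = s(Sum.inl a, Sum.inl b) ∨ T'.Adj u w := by
    intro u w h
    by_cases h1 : s(u, w) = s(Sum.inl a, Sum.inl b)
    · exact Or.inl h1
    · exact Or.inr (SimpleGraph.deleteEdges_adj.2 ⟨h, h1⟩)
  have hAB : ¬ T'.Reachable (Sum.inl a) (Sum.inl b) :=
    SimpleGraph.isBridge_iff.1 (SimpleGraph.isAcyclic_iff_forall_adj_isBridge.1 hT.tree.isAcyclic hT.adj)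
  have hor : ∀ u w, T.Reachable u w → (T'.Reachable u (Sum.inl a) ∨ T'.Reachable u (Sum.inl b)) →
      (T'.Reachable w (Sum.inl a) ∨ T'.Reachable w (Sum.inl b)) := by
    intro u w h hu
    rw [SimpleGraph.reachable_iff_reflTransGen] at h
    induction h with
    | refl => exact hu
    | tail _ h ih =>
      rcases hTT' _ _ h with h | h
      · rw [Sym2.eq_iff] at h
        rcases h with ⟨rfl, rfl⟩ | ⟨rfl, rfl⟩
        · exact Or.inr (SimpleGraph.Reachable.refl _)
        · exact Or.inl (SimpleGraph.Reachable.refl _)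
      · exact ih.imp (h.symm.reachable.trans) (h.symm.reachable.trans)
  have hab : ∀ w, T'.Reachable w (Sum.inl a) ∨ T'.Reachable w (Sum.inl b) := fun w =>
    hor _ _ (hT.tree.connected (Sum.inl a) w) (Or.inl (SimpleGraph.Reachable.refl _))
  obtain ⟨β, hβa, hβb⟩ : ∃ β, T'.Reachable (Sum.inr β) (Sum.inl a) ∧
      T'.Reachable (Sum.inr (!β)) (Sum.inl b) := by
    rcases hab (Sum.inr false) with h1 | h1 <;> rcases hab (Sum.inr true) with h2 | h2
    · exact absurd (h1.trans h2.symm) hT.sep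
    · exact ⟨false, h1, h2⟩
    · exact ⟨true, h2, h1⟩
    · exact absurd (h1.trans h2.symm) hT.sep
  have hroot : ∀ w, ∃ γ, T'.Reachable w (Sum.inr γ) := fun w =>
    (hab w).elim (fun h => ⟨_, h.trans hβa.symm⟩) (fun h => ⟨_, h.trans hβb.symm⟩)
  have hroot_unique : ∀ w γ δ, T'.Reachable w (Sum.inr γ) → T'.Reachable w (Sum.inr δ) → γ = δ := by
    intro w γ δ h1 h2
    have h3 := h1.symm.trans h2
    rcases γ with _ | _ <;> rcases δ with _ | _
    · rfl
    · exact absurd h3 hT.sep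
    · exact absurd h3.symm hT.sep
    · rfl
  have hstep : ∀ v : I, ∃ w, T'.Adj (Sum.inl v) w ∧ ∀ γ, T'.Reachable (Sum.inl v) (Sum.inr γ) →
      T'.dist w (Sum.inr γ) < T'.dist (Sum.inl v) (Sum.inr γ) := by
    intro v
    obtain ⟨γ, hγ⟩ := hroot (Sum.inl v)
    obtain ⟨p, hp⟩ := hγ.exists_walk_length_eq_dist
    cases p with
    | cons h q =>
      refine ⟨_, h, fun δ hδ => ?_⟩
      rw [hroot_unique _ _ _ hδ hγ, ← hp, SimpleGraph.Walk.length_cons]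
      exact Nat.lt_succ_of_le (SimpleGraph.dist_le q)
  choose f hf hfd using hstep
  have hreach : ∀ (k : ℕ) w γ, T'.Reachable w (Sum.inr γ) → T'.dist w (Sum.inr γ) ≤ k →
      ReachesRoot f w γ := by
    intro k
    induction k with
    | zero =>
      intro w γ h1 h2
      have := (h1.dist_eq_zero_iff).1 (by omega)
      rw [this, reachesRoot_inr]
    | succ k ih =>
      intro w γ h1 h2
      rcases w with v | δ
      · rw [reachesRoot_inl]
        exact ih _ _ ((hf v).symm.reachable.trans h1) (by have := hfd v γ h1; omega)
      · rw [reachesRoot_inr]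
        exact hroot_unique _ _ _ (SimpleGraph.Reachable.refl _) h1
  have hgood : GoodMap G a b f := by
    refine ⟨fun v => hT.le (SimpleGraph.deleteEdges_adj.1 (hf v)).1, fun v h => ?_, fun v => ?_, ?_⟩
    · exact (SimpleGraph.deleteEdges_adj.1 (hf v)).2 h
    · obtain ⟨γ, hγ⟩ := hroot (Sum.inl v)
      exact ⟨γ, hreach _ _ _ hγ le_rfl⟩
    · exact ⟨β, hreach _ _ _ hβa.symm le_rfl, hreach _ _ _ hβb.symm le_rfl⟩
  refine ⟨f, hgood, ?_⟩
  refine ((SimpleGraph.isTree_iff_minimal_connected.1 hT.tree).eq_of_ge hgood.connected ?_).symm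
  intro u w h
  rw [treeOf_adj hgood] at h
  rcases h with h | ⟨v, h⟩
  · rw [← SimpleGraph.mem_edgeSet, h]; exact hT.adj
  · rw [← SimpleGraph.mem_edgeSet, ← h]; exact (SimpleGraph.deleteEdges_adj.1 (hf v)).1

end TreeOfMap

end TrunkDegree

namespace TrunkDegree

open Finset

section GridTrees

/-- The embedding of the sites and the two roots into the vertex type of the grid graphs. -/
def toV {n : ℕ} : Site n ⊕ Bool → GridV := Sum.map Subtype.val id

lemma toV_injective {n : ℕ} : Function.Injective (toV : Site n ⊕ Bool → GridV) :=
  Sum.map_injective.2 ⟨Subtype.val_injective, Function.injective_id⟩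

lemma range_toV {n : ℕ} : Set.range (toV : Site n ⊕ Bool → GridV) = gridVerts n := by
  ext w
  simp only [gridVerts, Set.mem_range, Set.mem_union, Set.mem_ofPred_eq, Set.mem_insert_iff,
    Set.mem_singleton_iff, Lv, Rv, toV]
  constructor
  · rintro ⟨v | β, rfl⟩
    · have h := mem_boxPoints.1 v.2
      left
      refine ⟨v.1, rfl, ?_, ?_⟩ <;> rw [abs_le] <;> simp only [InBox] at h <;> omega
    · right
      cases β <;> simp
  · rintro (⟨p, rfl, h1, h2⟩ | rfl | rfl)
    · refine ⟨Sum.inl ⟨p, mem_boxPoints.2 ?_⟩, rfl⟩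
      rw [abs_le] at h1 h2
      exact ⟨h1.1, h1.2, h2.1, h2.2⟩
    · exact ⟨Sum.inr false, rfl⟩
    · exact ⟨Sum.inr true, rfl⟩

/-- The grid graph on sites and roots. -/
abbrev siteGraph (n : ℕ) : SimpleGraph (Site n ⊕ Bool) := (gridGraph n).comap toV

lemma exists_dir_of_sq {p q : ℤ × ℤ} (h : (p.1 - q.1) ^ 2 + (p.2 - q.2) ^ 2 = 1) :
    ∃ d, q = p + dir d := by
  obtain ⟨x, y⟩ := p
  obtain ⟨x', y'⟩ := q
  simp only at h
  have h1 : (x - x') ^ 2 ≤ 1 := by nlinarith [sq_nonneg (y - y')]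
  have h2 : (y - y') ^ 2 ≤ 1 := by nlinarith [sq_nonneg (x - x')]
  rw [sq_le_one_iff_abs_le_one, abs_le] at h1 h2
  have h3 : x - x' = -1 ∨ x - x' = 0 ∨ x - x' = 1 := by omega
  have h4 : y - y' = -1 ∨ y - y' = 0 ∨ y - y' = 1 := by omega
  rcases h3 with h3 | h3 | h3 <;> rcases h4 with h4 | h4 | h4 <;> rw [h3, h4] at h <;>
    norm_num at h
  · exact ⟨0, by simp [dir]; omega⟩
  · exact ⟨1, by simp [dir]; omega⟩
  · exact ⟨3, by simp [dir]; omega⟩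
  · exact ⟨2, by simp [dir]; omega⟩

lemma dir_sq (d : Fin 4) : (dir d).1 ^ 2 + (dir d).2 ^ 2 = 1 := by
  fin_cases d <;> simp [dir]

lemma siteGraph_adj {n : ℕ} {v : Site n} {w : Site n ⊕ Bool} :
    (siteGraph n).Adj (Sum.inl v) w ↔
      ∃ d, (-(n : ℤ) ≤ v.1.2 + (dir d).2 ∧ v.1.2 + (dir d).2 ≤ n) ∧ w = step v d := by
  have hv := mem_boxPoints.1 v.2
  simp only [InBox] at hv
  rcases w with w | β
  · have hw := mem_boxPoints.1 w.2
    simp only [InBox] at hw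
    have h1 : (siteGraph n).Adj (Sum.inl v) (Sum.inl w) ↔
        (v.1.1 - w.1.1) ^ 2 + (v.1.2 - w.1.2) ^ 2 = 1 := by
      simp only [siteGraph, SimpleGraph.comap_adj, toV, Sum.map_inl, gridGraph,
        SimpleGraph.fromRel_adj, gridRel, abs_le]
      constructor
      · rintro ⟨-, h | h⟩
        · exact h.2.2.2.2
        · have := h.2.2.2.2; linarith [this]
      · intro h
        refine ⟨?_, Or.inl ⟨⟨hv.1, hv.2.1⟩, hv.2.2, ⟨hw.1, hw.2.1⟩, hw.2.2, h⟩⟩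
        intro h'
        rw [Sum.inl_injective h'] at h
        simp at h
    rw [h1]
    constructor
    · intro h
      obtain ⟨d, hd⟩ := exists_dir_of_sq h
      refine ⟨d, ?_, ?_⟩
      · have : w.1.2 = v.1.2 + (dir d).2 := by rw [hd]; rfl
        omega
      · have h2 : v.1 + dir d ∈ boxPoints n := hd ▸ w.2
        rw [step, dif_pos h2]
        congr 1
        exact Subtype.ext hd
    · rintro ⟨d, -, hd⟩
      rw [step_eq_inl hd.symm, ← dir_sq d]
      simp only [Prod.fst_add, Prod.snd_add]
      ring
  · have h1 : (siteGraph n).Adj (Sum.inl v) (Sum.inr β) ↔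
        ((β = false ∧ v.1.1 = -(n : ℤ)) ∨ (β = true ∧ v.1.1 = (n : ℤ))) := by
      simp only [siteGraph, SimpleGraph.comap_adj, toV, Sum.map_inl, Sum.map_inr, gridGraph,
        SimpleGraph.fromRel_adj, gridRel, abs_le, false_or, id]
      constructor
      · exact fun h => h.2.2
      · exact fun h => ⟨Sum.inl_ne_inr, hv.2.2, h⟩
    rw [h1]
    constructor
    · rintro (⟨rfl, h⟩ | ⟨rfl, h⟩)
      · refine ⟨2, by simpa [dir] using hv.2.2, ?_⟩
        rw [step, dif_neg]
        · simp [dir]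
        · rw [mem_boxPoints]; simp [InBox, dir]; omega
      · refine ⟨0, by simpa [dir] using hv.2.2, ?_⟩
        rw [step, dif_neg]
        · simp [dir]
        · rw [mem_boxPoints]; simp [InBox, dir]; omega
    · rintro ⟨d, hd, h⟩
      unfold step at h
      split_ifs at h with h2
      rw [mem_boxPoints] at h2
      rw [Sum.inr_injective h]
      simp only [InBox, Prod.fst_add, Prod.snd_add] at *
      fin_cases d <;> simp [dir] at * <;> omega

lemma dir_injective : Function.Injective dir := by decide

lemma goodField_iff {n : ℕ} {a b : Site n} (ha : a.1 = (0, 0)) (hb : b.1 = (1, 0))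
    {F : Site n → Fin 4} : GoodField a b F → GoodMap (siteGraph n) a b (fun v => step v (F v)) := by
  rintro ⟨h1, h2, h3⟩
  refine ⟨fun v => siteGraph_adj.2 ⟨F v, (h1 v).1, rfl⟩, fun v h => ?_, h2, h3⟩
  rw [Sym2.eq_iff] at h
  rcases h with ⟨h4, h5⟩ | ⟨h4, h5⟩
  · have h6 := step_eq_inl h5
    rw [Sum.inl_injective h4, ha, hb] at h6
    refine (h1 v).2.1 ⟨by rw [Sum.inl_injective h4, ha], dir_injective ?_⟩
    rw [Sum.inl_injective h4, ← sub_eq_iff_eq_add'.2 h6]; simp [dir]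
  · have h6 := step_eq_inl h5
    rw [Sum.inl_injective h4, ha, hb] at h6
    refine (h1 v).2.2 ⟨by rw [Sum.inl_injective h4, hb], dir_injective ?_⟩
    rw [Sum.inl_injective h4, ← sub_eq_iff_eq_add'.2 h6]; simp [dir]

lemma exists_goodField {n : ℕ} {a b : Site n} (ha : a.1 = (0, 0)) (hb : b.1 = (1, 0))
    {f : Site n → Site n ⊕ Bool} (hf : GoodMap (siteGraph n) a b f) :
    ∃ F, GoodField a b F ∧ f = fun v => step v (F v) := by
  have h1 := fun v => siteGraph_adj.1 (hf.adj v)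
  choose F hF hF' using h1
  have hfF : f = fun v => step v (F v) := funext hF'
  refine ⟨F, ⟨fun v => ⟨hF v, ?_, ?_⟩, hfF ▸ hf.reach, hfF ▸ hf.sep⟩, hfF⟩
  · rintro ⟨h2, h3⟩
    obtain rfl : v = a := Subtype.ext (h2.trans ha.symm)
    refine hf.ne v ?_
    have h4 : v.1 + dir (F v) = b.1 := by rw [h2, h3, hb]; simp [dir]
    have h5 : step v (F v) = Sum.inl b := by
      rw [step, dif_pos (h4 ▸ b.2)]
      exact congrArg Sum.inl (Subtype.ext h4)
    rw [hF' v, h5]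
  · rintro ⟨h2, h3⟩
    obtain rfl : v = b := Subtype.ext (h2.trans hb.symm)
    refine hf.ne v ?_
    have h4 : v.1 + dir (F v) = a.1 := by rw [h2, h3, ha]; simp [dir]
    have h5 : step v (F v) = Sum.inl a := by
      rw [step, dif_pos (h4 ▸ a.2)]
      exact congrArg Sum.inl (Subtype.ext h4)
    rw [hF' v, h5, Sym2.eq_swap]

lemma step_injective {n : ℕ} {v : Site n} {d e : Fin 4} (hd : Allowed v d) (he : Allowed v e)
    (h : step v d = step v e) : d = e := by
  apply dir_injective
  rcases h1 : step v d with w | β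
  · have h2 := step_eq_inl h1
    have h3 := step_eq_inl (h ▸ h1)
    exact add_left_cancel (h2.symm.trans h3)
  · rw [(step_eq_inr hd h1).2, (step_eq_inr he (h ▸ h1)).2]

lemma inDegree_eq {n : ℕ} {b : Site n} (hb : b.1 = (1, 0)) (F : Site n → Fin 4) :
    inDegree F = #{v | step v (F v) = Sum.inl b} := by
  unfold inDegree
  congr 1
  ext v
  simp only [mem_filter, mem_univ, true_and]
  constructor
  · intro h
    rw [← hb] at h
    rw [step, dif_pos (h ▸ b.2)]
    congr 1
    exact Subtype.ext h
  · intro h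
    rw [← step_eq_inl h, hb]

/-- The graph on sites and roots defined by a subgraph of the grid graph. -/
def siteRestrict {n : ℕ} (S : (gridGraph n).Subgraph) : SimpleGraph (Site n ⊕ Bool) :=
  S.spanningCoe.comap toV

lemma exists_toV {n : ℕ} {S : (gridGraph n).Subgraph} (hS : S.verts = gridVerts n) {u w : GridV}
    (h : S.Adj u w) : ∃ x y : Site n ⊕ Bool, toV x = u ∧ toV y = w := by
  have h1 : u ∈ gridVerts n := hS ▸ h.fst_mem
  have h2 : w ∈ gridVerts n := hS ▸ h.snd_mem
  rw [← range_toV] at h1 h2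
  obtain ⟨x, hx⟩ := h1
  obtain ⟨y, hy⟩ := h2
  exact ⟨x, y, hx, hy⟩

lemma siteRestrict_injective {n : ℕ} {S S' : (gridGraph n).Subgraph} (hS : S.verts = gridVerts n)
    (hS' : S'.verts = gridVerts n) (h : siteRestrict S = siteRestrict S') : S = S' := by
  have key : ∀ x y : Site n ⊕ Bool, S.Adj (toV x) (toV y) ↔ S'.Adj (toV x) (toV y) := fun x y => by
    have : (siteRestrict S).Adj x y ↔ (siteRestrict S').Adj x y := by rw [h]
    exact this
  refine SimpleGraph.Subgraph.ext (hS.trans hS'.symm) ?_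
  funext u w
  apply propext
  constructor
  · intro h1
    obtain ⟨x, y, rfl, rfl⟩ := exists_toV hS h1
    exact (key x y).1 h1
  · intro h1
    obtain ⟨x, y, rfl, rfl⟩ := exists_toV hS' h1
    exact (key x y).2 h1

lemma siteRestrict_surjective {n : ℕ} {T : SimpleGraph (Site n ⊕ Bool)} (hT : T ≤ siteGraph n) :
    ∃ S : (gridGraph n).Subgraph, S.verts = gridVerts n ∧ siteRestrict S = T := by
  refine ⟨{ verts := gridVerts n
            Adj := fun u w => ∃ x y, toV x = u ∧ toV y = w ∧ T.Adj x y
            adj_sub := ?_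
            edge_vert := ?_
            symm := ?_ }, rfl, ?_⟩
  · rintro u w ⟨x, y, rfl, rfl, h⟩
    exact hT h
  · rintro u w ⟨x, y, rfl, rfl, h⟩
    rw [← range_toV]
    exact ⟨x, rfl⟩
  · refine ⟨?_⟩
    rintro u w ⟨x, y, rfl, rfl, h⟩
    exact ⟨y, x, rfl, rfl, h.symm⟩
  · ext x y
    change (∃ x' y', toV x' = toV x ∧ toV y' = toV y ∧ T.Adj x' y') ↔ _
    constructor
    · rintro ⟨x', y', hx, hy, h⟩
      rwa [toV_injective hx, toV_injective hy] at h
    · exact fun h => ⟨x, y, rfl, rfl, h⟩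

lemma siteRestrict_isTree {n : ℕ} {S : (gridGraph n).Subgraph} (hS : S.verts = gridVerts n) :
    S.coe.IsTree ↔ (siteRestrict S).IsTree := by
  have e : (siteRestrict S) ≃g S.coe := {
    toEquiv := (Equiv.ofInjective toV toV_injective).trans
      (Equiv.setCongr (range_toV.trans hS.symm))
    map_rel_iff' := Iff.rfl }
  exact (SimpleGraph.Iso.isTree_iff e).symm

lemma sym2_toV_eq {n : ℕ} {a b : Site n} (ha : a.1 = (0, 0)) (hb : b.1 = (1, 0)) {x y : Site n ⊕ Bool} :
    s(toV x, toV y) = hEdge 0 ↔ s(x, y) = s(Sum.inl a, Sum.inl b) := by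
  have : hEdge 0 = Sym2.map toV s(Sum.inl a, Sum.inl b) := by
    simp [hEdge, toV, ha, hb]
  rw [this, ← Sym2.map_mk, (Sym2.map.injective toV_injective).eq_iff]

lemma siteRestrict_trunk {n : ℕ} {a b : Site n} (ha : a.1 = (0, 0)) (hb : b.1 = (1, 0))
    {S : (gridGraph n).Subgraph} (hS : S.verts = gridVerts n) :
    TrunkContains n S (hEdge 0) ↔ (siteRestrict S).Adj (Sum.inl a) (Sum.inl b) ∧
      ¬ ((siteRestrict S).deleteEdges {s(Sum.inl a, Sum.inl b)}).Reachable
        (Sum.inr false) (Sum.inr true) := by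
  unfold TrunkContains
  have h1 : hEdge 0 = s(toV (Sum.inl a), toV (Sum.inl b)) := ((sym2_toV_eq ha hb).2 rfl).symm
  have hadj : ∀ x y, ((siteRestrict S).deleteEdges {s(Sum.inl a, Sum.inl b)}).Adj x y ↔
      (S.deleteEdges {hEdge 0}).spanningCoe.Adj (toV x) (toV y) := by
    intro x y
    rw [SimpleGraph.deleteEdges_adj, SimpleGraph.Subgraph.spanningCoe_adj,
      SimpleGraph.Subgraph.deleteEdges_adj, Set.mem_singleton_iff, Set.mem_singleton_iff,
      sym2_toV_eq ha hb]
    rfl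
  refine and_congr ?_ (not_congr ?_)
  · rw [h1]; rfl
  · simp only [SimpleGraph.reachable_iff_reflTransGen]
    constructor
    · intro h
      have key : ∀ w, Relation.ReflTransGen (S.deleteEdges {hEdge 0}).spanningCoe.Adj Lv w →
          ∃ y : Site n ⊕ Bool, toV y = w ∧ Relation.ReflTransGen
            ((siteRestrict S).deleteEdges {s(Sum.inl a, Sum.inl b)}).Adj (Sum.inr false) y := by
        intro w hw
        induction hw with
        | refl => exact ⟨Sum.inr false, rfl, Relation.ReflTransGen.refl⟩
        | tail _ h ih =>
          obtain ⟨x, rfl, hx⟩ := ih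
          have h2 : S.Adj _ _ := ((SimpleGraph.Subgraph.deleteEdges_adj _ _ _).1 h).1
          obtain ⟨_, y, -, rfl⟩ := exists_toV hS h2
          exact ⟨y, rfl, hx.tail ((hadj x y).2 h)⟩
      obtain ⟨y, hy, hy'⟩ := key Rv h
      have : y = Sum.inr true := toV_injective hy
      rwa [← this]
    · intro h
      exact Relation.ReflTransGen.lift (p := (S.deleteEdges {hEdge 0}).spanningCoe.Adj) toV
        (fun x y h => (hadj x y).1 h) _ _ h

lemma siteRestrict_ncard {n : ℕ} {b : Site n} (hb : b.1 = (1, 0))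
    {S : (gridGraph n).Subgraph} (hS : S.verts = gridVerts n) :
    (S.neighborSet (Sum.inl (1, 0))).ncard = ((siteRestrict S).neighborSet (Sum.inl b)).ncard := by
  rw [← Set.ncard_image_of_injective _ toV_injective]
  congr 1
  ext w
  have h1 : (Sum.inl (1, 0) : GridV) = toV (Sum.inl b) := by simp [toV, hb]
  rw [h1]
  constructor
  · intro h
    obtain ⟨-, y, -, rfl⟩ := exists_toV hS h
    exact ⟨y, h, rfl⟩
  · rintro ⟨y, hy, rfl⟩
    exact hy

open Classical in
/-- Spanning trees whose trunk contains the central edge are counted by good direction fields. -/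
lemma card_trees {n : ℕ} {a b : Site n} (ha : a.1 = (0, 0)) (hb : b.1 = (1, 0)) (P : ℕ → Prop) :
    Nat.card {S : (gridGraph n).Subgraph // IsSpanningTree n S ∧ TrunkContains n S (hEdge 0) ∧
      P (S.neighborSet (Sum.inl (1, 0))).ncard} =
    #{F : Site n → Fin 4 | GoodField a b F ∧ P (inDegree F + 2)} := by
  have hab : (siteGraph n).Adj (Sum.inl a) (Sum.inl b) := by
    rw [siteGraph_adj]
    refine ⟨0, by simp [dir, ha], ?_⟩
    have h4 : a.1 + dir 0 = b.1 := by rw [ha, hb]; simp [dir]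
    rw [step, dif_pos (h4 ▸ b.2)]
    congr 1
    exact Subtype.ext h4.symm
  have htrunk : ∀ S : (gridGraph n).Subgraph, S.verts = gridVerts n →
      (S.coe.IsTree ∧ TrunkContains n S (hEdge 0) ↔ TrunkTree (siteGraph n) a b (siteRestrict S)) := by
    intro S hS
    rw [siteRestrict_isTree hS, siteRestrict_trunk ha hb hS]
    exact ⟨fun h => ⟨fun x y hxy => S.adj_sub hxy, h.1, h.2.1, h.2.2⟩,
      fun h => ⟨h.tree, h.adj, h.sep⟩⟩
  have hex : ∀ F : {F : Site n → Fin 4 // GoodField a b F ∧ P (inDegree F + 2)},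
      ∃ S : {S : (gridGraph n).Subgraph // IsSpanningTree n S ∧ TrunkContains n S (hEdge 0) ∧
        P (S.neighborSet (Sum.inl (1, 0))).ncard},
        siteRestrict S.1 = treeOf (fun v => step v (F.1 v)) a b := by
    rintro ⟨F, hF, hP⟩
    have hgm := goodField_iff ha hb hF
    have htt := hgm.trunkTree hab
    obtain ⟨S, hS, hS'⟩ := siteRestrict_surjective htt.le
    have h1 := (htrunk S hS).2 (by rw [hS']; exact htt)
    refine ⟨⟨S, ⟨hS, h1.1⟩, h1.2, ?_⟩, hS'⟩
    rw [siteRestrict_ncard hb hS, hS', hgm.ncard_neighborSet, ← inDegree_eq hb]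
    exact hP
  choose Φ hΦ using hex
  have hbij : Function.Bijective Φ := by
    constructor
    · intro F F' h
      have h1 := (hΦ F).symm.trans (h ▸ hΦ F')
      have h2 := (goodField_iff ha hb F.2.1).treeOf_injective (goodField_iff ha hb F'.2.1) h1
      apply Subtype.ext
      funext v
      exact step_injective (F.2.1.1 v) (F'.2.1.1 v) (congrFun h2 v)
    · rintro ⟨S, hS1, hS2, hP⟩
      have htt := (htrunk S hS1.1).1 ⟨hS1.2, hS2⟩
      obtain ⟨f, hf, hf'⟩ := htt.exists_goodMap
      obtain ⟨F, hF, rfl⟩ := exists_goodField ha hb hf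
      refine ⟨⟨F, hF, ?_⟩, ?_⟩
      · rw [inDegree_eq hb, ← hf.ncard_neighborSet, hf', ← siteRestrict_ncard hb hS1.1]
        exact hP
      · apply Subtype.ext
        refine siteRestrict_injective (Φ _).2.1.1 hS1.1 ?_
        exact (hΦ _).trans hf'
  rw [← Nat.card_congr (Equiv.ofBijective Φ hbij), Nat.card_eq_fintype_card, Fintype.card_subtype]

end GridTrees

end TrunkDegree

namespace TrunkDegree

open Finset

section RankOnePerturbations

variable {n : ℕ}

lemma gridMatrix_mulVec_inl (a b : Site n) (t : ℝ) (u : Site n ⊕ Bool → ℝ) (v : Site n) :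
    (gridMatrix a b t).mulVec u (Sum.inl v) =
      ∑ d, stepWeight t v d * (u (Sum.inl v) - zipperSign v.1 d * u (step v d)) := by
  simp only [gridMatrix, Matrix.mulVec, dotProduct, Matrix.of_apply, Sum.elim_inl, sum_mul]
  rw [sum_comm]
  refine sum_congr rfl fun d _ => ?_
  simp only [mul_assoc, sub_mul, ← mul_sum, sum_sub_distrib]
  simp

lemma gridMatrix_mulVec_inr (a b : Site n) (t : ℝ) (u : Site n ⊕ Bool → ℝ) (β : Bool) :
    (gridMatrix a b t).mulVec u (Sum.inr β) = u (Sum.inl (bif β then b else a)) := by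
  simp [gridMatrix, Matrix.mulVec, dotProduct, Matrix.of_apply]

/-- The in-neighbours of `(1,0)`. -/
lemma stepWeight_sub (t : ℝ) (v : Site n) (d : Fin 4) :
    stepWeight t v d - stepWeight 1 v d =
      if (v.1 = (2, 0) ∧ d = 2) ∨ (v.1 = (1, 1) ∧ d = 3) ∨ (v.1 = (1, -1) ∧ d = 1)
        then (t - 1) * stepWeight 1 v d else 0 := by
  by_cases hall : Allowed v d
  · have h1 : v.1 + dir d = (1, 0) ↔
        (v.1 = (2, 0) ∧ d = 2) ∨ (v.1 = (1, 1) ∧ d = 3) ∨ (v.1 = (1, -1) ∧ d = 1) := by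
      have h2 := hall.2.1
      generalize v.1 = p at *
      obtain ⟨x, y⟩ := p
      fin_cases d <;> simp [dir] at h2 ⊢ <;> omega
    by_cases h : v.1 + dir d = (1, 0)
    · rw [if_pos (h1.1 h)]
      simp [stepWeight, hall, h]
    · rw [if_neg (fun h' => h (h1.2 h'))]
      simp [stepWeight, hall, h]
  · simp [stepWeight, hall]

lemma det_gridMatrix_factor {a b : Site n} (hb : b.1 = (1, 0)) {E N S : Site n}
    (hE : E.1 = (2, 0)) (hN : N.1 = (1, 1)) (hS : S.1 = (1, -1)) {uE uP uM : Site n ⊕ Bool → ℝ}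
    (hEsol : (gridMatrix a b 1).mulVec uE = Pi.single (Sum.inl E) 1)
    (hPsol : (gridMatrix a b 1).mulVec uP = Pi.single (Sum.inl N) 1 + Pi.single (Sum.inl S) 1)
    (hMsol : (gridMatrix a b 1).mulVec uM = Pi.single (Sum.inl N) 1 - Pi.single (Sum.inl S) 1)
    (hEb : uE (Sum.inl E) + 2 * uE (Sum.inl N) = 0) (hPb : uP (Sum.inl E) + 2 * uP (Sum.inl N) = 0)
    (hES : uE (Sum.inl S) = uE (Sum.inl N)) (hPS : uP (Sum.inl S) = uP (Sum.inl N))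
    (hME : uM (Sum.inl E) = 0) (hMS : uM (Sum.inl S) = - uM (Sum.inl N)) (t : ℝ) :
    (gridMatrix a b t).det = (gridMatrix a b 1).det *
      ((1 + (t - 1) * uM (Sum.inl N)) *
        (1 + (t - 1) * (uE (Sum.inl E) + uP (Sum.inl N)))) := by
  have hEb0 : uE (Sum.inl b) = 0 := by
    have := congrFun hEsol (Sum.inr true)
    rw [gridMatrix_mulVec_inr] at this
    simpa using this
  have hPb0 : uP (Sum.inl b) = 0 := by
    have := congrFun hPsol (Sum.inr true)
    rw [gridMatrix_mulVec_inr] at this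
    simpa using this
  have hMb0 : uM (Sum.inl b) = 0 := by
    have := congrFun hMsol (Sum.inr true)
    rw [gridMatrix_mulVec_inr] at this
    simpa using this
  let c : Fin 3 → Site n := ![E, N, S]
  let W : Matrix (Site n ⊕ Bool) (Fin 3) ℝ := Matrix.of fun x j =>
    ![uE x, (uP x + uM x) / 2, (uP x - uM x) / 2] j
  let V : Matrix (Fin 3) (Site n ⊕ Bool) ℝ := Matrix.of fun j x =>
    (if x = Sum.inl (c j) then 1 else 0) - (if x = Sum.inl b then 1 else 0)
  have hW : ∀ j, (gridMatrix a b 1).mulVec (fun x => W x j) = Pi.single (Sum.inl (c j)) 1 := by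
    intro j
    fin_cases j
    · exact hEsol
    · have : (fun x => W x 1) = (1 / 2 : ℝ) • (uP + uM) := by
        ext x; simp [W]; ring
      change (gridMatrix a b 1).mulVec (fun x => W x 1) = Pi.single (Sum.inl N) 1
      rw [this, Matrix.mulVec_smul, Matrix.mulVec_add, hPsol, hMsol]
      ext x; simp; ring
    · have : (fun x => W x 2) = (1 / 2 : ℝ) • (uP - uM) := by
        ext x; simp [W]; ring
      change (gridMatrix a b 1).mulVec (fun x => W x 2) = Pi.single (Sum.inl S) 1
      rw [this, Matrix.mulVec_smul, Matrix.mulVec_sub, hPsol, hMsol]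
      ext x; simp; ring
  have hfac : gridMatrix a b t = gridMatrix a b 1 * (1 + W * ((t - 1) • V)) := by
    rw [mul_add, mul_one, ← Matrix.mul_assoc]
    ext u w
    rw [Matrix.add_apply, ← sub_eq_iff_eq_add', Matrix.mul_apply]
    have h1 : ∀ j, (gridMatrix a b 1 * W) u j = if u = Sum.inl (c j) then 1 else 0 := by
      intro j
      have := congrFun (hW j) u
      rw [Pi.single_apply] at this
      exact this
    simp only [h1, Matrix.smul_apply, smul_eq_mul, ite_mul, one_mul, zero_mul]
    rcases u with v | β
    · simp only [gridMatrix, Matrix.of_apply, Sum.elim_inl]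
      rw [← sum_sub_distrib]
      simp only [← sub_mul, stepWeight_sub, ite_mul, zero_mul]
      have hstep : ∀ v : Site n, ∀ d, v.1 + dir d = (1, 0) → step v d = Sum.inl b := by
        intro v d h
        rw [← hb] at h
        rw [step, dif_pos (h ▸ b.2)]
        exact congrArg Sum.inl (Subtype.ext h)
      have hbb := mem_boxPoints.1 b.2
      rw [hb] at hbb
      simp only [InBox] at hbb
      have hv : ∀ (v' : Site n), v = v' ↔ v.1 = v'.1 := fun v' => Subtype.ext_iff
      rw [Fin.sum_univ_three]
      simp only [c, V, Sum.inl.injEq, hv, Matrix.of_apply, Matrix.cons_val_zero,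
        Matrix.cons_val_one, Matrix.cons_val, hE, hN, hS]
      by_cases hvE : v.1 = (2, 0)
      · obtain rfl : v = E := Subtype.ext (hvE.trans hE.symm)
        have h2 := hstep v 2 (by rw [hE]; rfl)
        have h3 : Allowed v 2 := by simp [Allowed, hE, dir]
        simp [hE, h2, zipperSign, stepWeight, h3]
        exact Or.inl (by congr)
      by_cases hvN : v.1 = (1, 1)
      · obtain rfl : v = N := Subtype.ext (hvN.trans hN.symm)
        have h2 := hstep v 3 (by rw [hN]; rfl)
        have h3 : Allowed v 3 := by simp [Allowed, hN, dir]
        simp [hN, h2, zipperSign, stepWeight, h3]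
        exact Or.inl (by congr)
      by_cases hvS : v.1 = (1, -1)
      · obtain rfl : v = S := Subtype.ext (hvS.trans hS.symm)
        have h2 := hstep v 1 (by rw [hS]; rfl)
        have h3 : Allowed v 1 := by simp [Allowed, hS, dir]
        simp [hS, h2, zipperSign, stepWeight, h3]
        exact Or.inl (by congr)
      simp [hvE, hvN, hvS]
    · simp [gridMatrix]
  rw [hfac, Matrix.det_mul, Matrix.det_one_add_mul_comm]
  congr 1
  have hVW : ∀ i j, (V * W) i j = W (Sum.inl (c i)) j - W (Sum.inl b) j := by
    intro i j
    simp only [Matrix.mul_apply, V, Matrix.of_apply, sub_mul, sum_sub_distrib]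
    simp
  rw [Matrix.smul_mul, Matrix.det_fin_three]
  simp only [Matrix.add_apply, Matrix.smul_apply, smul_eq_mul, hVW]
  simp [c, W, hEb0, hPb0, hMb0, hME, hMS, hES, hPS]
  rw [eq_neg_of_add_eq_zero_left hEb, eq_neg_of_add_eq_zero_left hPb]
  ring

/-- The field pointing away from the central edge. -/
lemma exists_goodField_outward (hn : 1 ≤ n) {a b : Site n} (ha : a.1 = (0, 0)) (hb : b.1 = (1, 0)) :
    ∃ F : Site n → Fin 4, GoodField a b F := by
  let F : Site n → Fin 4 := fun v => if v.1.1 ≤ 0 then 2 else 0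
  have hF : ∀ v, Allowed v (F v) := by
    intro v
    have hv := mem_boxPoints.1 v.2
    simp only [InBox] at hv
    by_cases h : v.1.1 ≤ 0
    · simp [F, h, Allowed, dir, hv]
      intro h'; rw [h'] at h; norm_num at h
    · simp [F, h, Allowed, dir, hv]
      intro h'; rw [h'] at h; norm_num at h
  have hL : ∀ (k : ℕ) (v : Site n), v.1.1 ≤ 0 → v.1.1 + n < k →
      ReachesRoot (fun v => step v (F v)) (Sum.inl v) false := by
    intro k
    induction k with
    | zero =>
      intro v _ h
      have hv := mem_boxPoints.1 v.2
      simp only [InBox] at hv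
      push_cast at h
      omega
    | succ k ih =>
      intro v hv h
      rw [reachesRoot_inl]
      rcases hs : step v (F v) with w | β
      · have h1 := step_eq_inl hs
        have h2 : w.1.1 = v.1.1 - 1 := by rw [h1]; simp [F, hv, dir]; ring
        exact ih w (by omega) (by push_cast at h; omega)
      · have h1 := (step_eq_inr (hF v) hs).2
        rw [reachesRoot_inr]
        simp only [F, hv, if_true] at h1
        cases β
        · rfl
        · simp [dir] at h1
  have hR : ∀ (k : ℕ) (v : Site n), 0 < v.1.1 → (n : ℤ) - v.1.1 < k →
      ReachesRoot (fun v => step v (F v)) (Sum.inl v) true := by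
    intro k
    induction k with
    | zero =>
      intro v _ h
      have hv := mem_boxPoints.1 v.2
      simp only [InBox] at hv
      push_cast at h
      omega
    | succ k ih =>
      intro v hv h
      rw [reachesRoot_inl]
      rcases hs : step v (F v) with w | β
      · have h1 := step_eq_inl hs
        have h2 : w.1.1 = v.1.1 + 1 := by rw [h1]; simp [F, not_le.2 hv, dir]
        exact ih w (by omega) (by push_cast at h; omega)
      · have h1 := (step_eq_inr (hF v) hs).2
        rw [reachesRoot_inr]
        simp only [F, not_le.2 hv, if_false] at h1
        cases β
        · simp [dir] at h1
        · rfl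
  refine ⟨F, hF, fun v => ?_, false, ?_, ?_⟩
  · by_cases h : v.1.1 ≤ 0
    · exact ⟨false, hL (v.1.1 + n + 1).toNat v h (by omega)⟩
    · refine ⟨true, hR (2 * n + 1) v (by omega) ?_⟩
      push_cast; omega
  · exact hL (n + 1) a (by rw [ha]) (by rw [ha]; push_cast; omega)
  · exact hR (n + 1) b (by rw [hb]; norm_num) (by rw [hb]; push_cast; omega)

open Classical in
/-- The proportions of trees, in terms of the eigenvalues `p` and `q` of the perturbation. -/
lemma card_ratio (hn : 1 ≤ n) {a b : Site n} (ha : a.1 = (0, 0)) (hb : b.1 = (1, 0)) {p q : ℝ}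
    (hdet : ∀ t, (gridMatrix a b t).det =
      (gridMatrix a b 1).det * ((1 + (t - 1) * p) * (1 + (t - 1) * q))) (k : ℕ) (hk : k ≤ 2) :
    (Nat.card {S : (gridGraph n).Subgraph // IsSpanningTree n S ∧ TrunkContains n S (hEdge 0) ∧
      (S.neighborSet (Sum.inl (1, 0))).ncard = k + 2} : ℝ) /
    (Nat.card {S : (gridGraph n).Subgraph // IsSpanningTree n S ∧ TrunkContains n S (hEdge 0)} : ℝ)
    = if k = 0 then (1 - p) * (1 - q) else if k = 1 then p * (1 - q) + q * (1 - p) else p * q := by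
  have h1 := card_trees ha hb (fun d => d = k + 2)
  have h2 := card_trees ha hb (fun _ => True)
  simp only [and_true, add_left_inj] at h1 h2
  rw [h1, h2]
  have hD : (gridMatrix a b 1).det = (#{F : Site n → Fin 4 | GoodField a b F} : ℝ) := by
    rw [det_gridMatrix hn ha hb]; simp
  have hpos : (#{F : Site n → Fin 4 | GoodField a b F} : ℝ) ≠ 0 := by
    obtain ⟨F, hF⟩ := exists_goodField_outward hn ha hb
    have : 0 < #{F : Site n → Fin 4 | GoodField a b F} :=
      card_pos.2 ⟨F, by simpa using hF⟩
    exact_mod_cast this.ne'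
  rw [hD] at hdet
  set D : ℝ := (#{F : Site n → Fin 4 | GoodField a b F} : ℝ) with hDdef
  have hpoly : (∑ F with GoodField a b F, (Polynomial.X : Polynomial ℝ) ^ inDegree F) =
      Polynomial.C (D * ((1 - p) * (1 - q))) +
      Polynomial.C (D * (p * (1 - q) + q * (1 - p))) * Polynomial.X +
      Polynomial.C (D * (p * q)) * Polynomial.X ^ 2 := by
    apply Polynomial.funext
    intro t
    have := (det_gridMatrix hn ha hb t).symm.trans (hdet t)
    simp only [Polynomial.eval_finsetSum, Polynomial.eval_pow, Polynomial.eval_X,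
      Polynomial.eval_add, Polynomial.eval_mul, Polynomial.eval_C]
    rw [this]
    ring
  have hcoeff := congrArg (fun P => Polynomial.coeff P k) hpoly
  simp only [Polynomial.finsetSum_coeff, Polynomial.coeff_X_pow] at hcoeff
  rw [sum_ite, sum_const_zero, add_zero, sum_const, nsmul_one, filter_filter] at hcoeff
  have hsym : #{F : Site n → Fin 4 | GoodField a b F ∧ inDegree F = k} =
      #{F : Site n → Fin 4 | GoodField a b F ∧ k = inDegree F} := by
    simp only [eq_comm]
  have hquad : ∀ A₀ A₁ A₂ : ℝ, (Polynomial.C A₀ + Polynomial.C A₁ * Polynomial.X +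
      Polynomial.C A₂ * Polynomial.X ^ 2).coeff k =
        if k = 0 then A₀ else if k = 1 then A₁ else A₂ := by
    intro A₀ A₁ A₂
    simp only [Polynomial.coeff_add, Polynomial.coeff_C_mul, Polynomial.coeff_C,
      Polynomial.coeff_X_pow, Polynomial.coeff_X]
    interval_cases k <;> simp
  rw [hsym, hcoeff, div_eq_iff hpos, hquad]
  split_ifs <;> ring

end RankOnePerturbations

end TrunkDegree

namespace TrunkDegree

open Finset

section DirichletProblem

/-- The (positive) discrete Laplacian on `ℤ × ℤ`. -/
def Lap (u : ℤ → ℤ → ℝ) (x y : ℤ) : ℝ :=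
  4 * u x y - u (x + 1) y - u (x - 1) y - u x (y + 1) - u x (y - 1)

/-- Minimum principle on a finite set of lattice points. -/
lemma nonneg_of_lap_nonneg (S : Finset (ℤ × ℤ)) (u : ℤ → ℤ → ℝ)
    (hlap : ∀ x y, (x, y) ∈ S → u x y < 0 → 0 ≤ Lap u x y)
    (hnbr : ∀ x y, (x, y) ∈ S → u x y < 0 → ∀ x' y',
      ((x' = x + 1 ∨ x' = x - 1) ∧ y' = y) ∨ (x' = x ∧ (y' = y + 1 ∨ y' = y - 1)) →
      0 ≤ u x' y' ∨ ∃ w ∈ S, u w.1 w.2 ≤ u x' y')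
    (hleft : ∀ x y, (x, y) ∈ S → u x y < 0 → (x - 1, y) ∈ S ∨ 0 ≤ u (x - 1) y) :
    ∀ x y, (x, y) ∈ S → 0 ≤ u x y := by
  intro x₀ y₀ h₀
  by_contra hneg
  push Not at hneg
  obtain ⟨p, hp, hpmin⟩ := S.exists_min_image (fun w => u w.1 w.2) ⟨_, h₀⟩
  obtain ⟨q, hq, hqmin⟩ := (S.filter fun w => u w.1 w.2 = u p.1 p.2).exists_min_image
    (fun w => w.1) ⟨p, by simp [hp]⟩
  rw [mem_filter] at hq
  obtain ⟨x, y⟩ := q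
  obtain ⟨hqS, hqp⟩ := hq
  simp only at hqp
  have hneg' : u x y < 0 := by
    have := hpmin _ h₀
    simp only at this
    linarith
  have hbd : ∀ x' y', ((x' = x + 1 ∨ x' = x - 1) ∧ y' = y) ∨
      (x' = x ∧ (y' = y + 1 ∨ y' = y - 1)) → u x y ≤ u x' y' := by
    intro x' y' h
    rcases hnbr x y hqS hneg' x' y' h with h1 | ⟨w, hw, h1⟩
    · linarith
    · have := hpmin w hw
      linarith
  have hl := hlap x y hqS hneg'
  have h1 := hbd (x + 1) y (by simp)
  have h2 := hbd (x - 1) y (by simp)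
  have h3 := hbd x (y + 1) (by simp)
  have h4 := hbd x (y - 1) (by simp)
  unfold Lap at hl
  rcases hleft x y hqS hneg' with h5 | h5
  · have := hqmin (x - 1, y) (by rw [mem_filter]; exact ⟨h5, by simp only; linarith⟩)
    simp only at this
    omega
  · linarith

/-- The closest ordinate in `[-h, h]`. -/
def clamp (h : ℕ) (y : ℤ) : ℤ := max (-h) (min h y)

lemma clamp_of_abs_le {h : ℕ} {y : ℤ} (hy : |y| ≤ h) : clamp h y = y := by
  rw [abs_le] at hy
  unfold clamp
  omega

lemma abs_clamp_le (h : ℕ) (y : ℤ) : |clamp h y| ≤ h := by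
  rw [abs_le]
  unfold clamp
  omega

lemma clamp_neg (h : ℕ) (y : ℤ) : clamp h (-y) = - clamp h y := by
  unfold clamp
  omega

/-- Comparison on a box with reflecting top and bottom. -/
lemma clamped_nonneg {l r : ℤ} {h : ℕ} {u : ℤ → ℤ → ℝ} (hc : ∀ x y, u x y = u x (clamp h y))
    (hbox : ∀ x y : ℤ, -l ≤ x → x ≤ r → |y| ≤ h → 0 ≤ u x y ∨ 0 ≤ Lap u x y)
    (hleft : ∀ y : ℤ, |y| ≤ h → 0 ≤ u (-l - 1) y) (hright : ∀ y : ℤ, |y| ≤ h → 0 ≤ u (r + 1) y) :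
    ∀ x y, -l ≤ x → x ≤ r → 0 ≤ u x y := by
  have key : ∀ x y, (x, y) ∈ Icc (-l) r ×ˢ Icc (-(h : ℤ)) h → 0 ≤ u x y := by
    have hmem : ∀ x y : ℤ, (x, y) ∈ Icc (-l) r ×ˢ Icc (-(h : ℤ)) h ↔
        (-l ≤ x ∧ x ≤ r) ∧ |y| ≤ h := by
      intro x y
      rw [mem_product, mem_Icc, mem_Icc, abs_le]
    apply nonneg_of_lap_nonneg
    · intro x y hxy hneg
      rw [hmem] at hxy
      rcases hbox x y hxy.1.1 hxy.1.2 hxy.2 with h1 | h1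
      · linarith
      · exact h1
    · intro x y hxy hneg x' y' hnb
      rw [hmem] at hxy
      by_cases h1 : x' = -l - 1
      · left
        rw [hc, h1]
        exact hleft _ (abs_clamp_le _ _)
      by_cases h2 : x' = r + 1
      · left
        rw [hc, h2]
        exact hright _ (abs_clamp_le _ _)
      · right
        refine ⟨(x', clamp h y'), ?_, (hc x' y').symm.le⟩
        rw [hmem]
        refine ⟨by omega, abs_clamp_le _ _⟩
    · intro x y hxy hneg
      rw [hmem] at hxy ⊢
      by_cases h1 : x - 1 = -l - 1
      · right
        rw [h1]
        exact hleft y hxy.2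
      · left
        exact ⟨by omega, hxy.2⟩
  intro x y h1 h2
  rw [hc]
  refine key _ _ ?_
  have := abs_clamp_le h y
  rw [abs_le] at this
  rw [mem_product, mem_Icc, mem_Icc]
  exact ⟨⟨h1, h2⟩, this⟩

lemma lap_add (u v : ℤ → ℤ → ℝ) (x y : ℤ) :
    Lap (fun x y => u x y + v x y) x y = Lap u x y + Lap v x y := by
  unfold Lap; ring

lemma lap_sub (u v : ℤ → ℤ → ℝ) (x y : ℤ) :
    Lap (fun x y => u x y - v x y) x y = Lap u x y - Lap v x y := by
  unfold Lap; ring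

lemma lap_const_mul (c : ℝ) (u : ℤ → ℤ → ℝ) (x y : ℤ) :
    Lap (fun x y => c * u x y) x y = c * Lap u x y := by
  unfold Lap; ring

lemma lap_neg (u : ℤ → ℤ → ℝ) (x y : ℤ) :
    Lap (fun x y => - u x y) x y = - Lap u x y := by
  unfold Lap; ring

lemma lap_shift (u : ℤ → ℤ → ℝ) (k x y : ℤ) :
    Lap (fun x y => u (x + k) y) x y = Lap u (x + k) y := by
  simp only [Lap]
  rw [show x + 1 + k = x + k + 1 by ring, show x - 1 + k = x + k - 1 by ring]

/-- `u` solves the Dirichlet problem with data `g` on the columns outside `[-l, r]` and on the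
slit `{x ≥ s, y = 0}`, with reflecting top and bottom at height `±h`. -/
structure IsBoxSol (l r : ℤ) (h : ℕ) (s : ℤ) (g u : ℤ → ℤ → ℝ) : Prop where
  clamped : ∀ x y, u x y = u x (clamp h y)
  boundary : ∀ x y : ℤ, |y| ≤ h → (x < -l ∨ r < x ∨ (y = 0 ∧ s ≤ x)) → u x y = g x y
  harmonic : ∀ x y : ℤ, -l ≤ x → x ≤ r → |y| ≤ h → ¬ (y = 0 ∧ s ≤ x) → Lap u x y = 0

lemma exists_isBoxSol (l r : ℤ) (h : ℕ) (s : ℤ) (g : ℤ → ℤ → ℝ) :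
    ∃ u, IsBoxSol l r h s g u := by
  classical
  let S : Finset (ℤ × ℤ) :=
    (Icc (-l) r ×ˢ Icc (-(h : ℤ)) h).filter fun p => ¬ (p.2 = 0 ∧ s ≤ p.1)
  have hS : ∀ x y, (x, y) ∈ S ↔ ((-l ≤ x ∧ x ≤ r) ∧ |y| ≤ h) ∧ ¬ (y = 0 ∧ s ≤ x) := by
    intro x y
    simp only [S, mem_filter, mem_product, mem_Icc, abs_le]
  let ext : (S → ℝ) → ℤ → ℤ → ℝ := fun φ x y =>
    if hxy : (x, clamp h y) ∈ S then φ ⟨_, hxy⟩ else 0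
  have hclamp : ∀ y, clamp h (clamp h y) = clamp h y := fun y => clamp_of_abs_le (abs_clamp_le h y)
  let Φ : (S → ℝ) →ₗ[ℝ] (S → ℝ) :=
    { toFun := fun φ w => Lap (ext φ) w.1.1 w.1.2
      map_add' := by
        intro φ ψ
        ext w
        have : ext (φ + ψ) = fun x y => ext φ x y + ext ψ x y := by
          funext x y
          simp only [ext]
          split_ifs <;> simp
        simp only [this, lap_add, Pi.add_apply]
      map_smul' := by
        intro c φ
        ext w
        have : ext (c • φ) = fun x y => c * ext φ x y := by
          funext x y
          simp only [ext]
          split_ifs <;> simp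
        simp only [this, lap_const_mul, Pi.smul_apply, smul_eq_mul, RingHom.id_apply] }
  have hpos : ∀ φ, Φ φ = 0 → ∀ w, 0 ≤ φ w := by
    intro φ hφ w
    have hmem := (hS _ _).1 w.2
    have h0 : ∀ x y, (x, clamp h y) ∉ S → ext φ x y = 0 := fun x y h => by simp [ext, h]
    have := clamped_nonneg (l := l) (r := r) (h := h) (u := ext φ)
      (by intro x y; simp only [ext, hclamp])
      (by
        intro x y h1 h2 h3
        by_cases hxy : (x, y) ∈ S
        · right
          exact (congrFun hφ ⟨_, hxy⟩).symm.le
        · left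
          rw [h0]
          rwa [clamp_of_abs_le h3])
      (fun y hy => by rw [h0]; rw [hS]; omega)
      (fun y hy => by rw [h0]; rw [hS]; omega) w.1.1 w.1.2 hmem.1.1.1 hmem.1.1.2
    simpa only [ext, clamp_of_abs_le hmem.1.2, w.2, dif_pos] using this
  have hinj : Function.Injective Φ := by
    rw [← LinearMap.ker_eq_bot, LinearMap.ker_eq_bot']
    intro φ hφ
    ext w
    have h1 := hpos φ hφ w
    have h2 := hpos (-φ) (by rw [map_neg, hφ, neg_zero]) w
    simp only [Pi.neg_apply, Pi.zero_apply] at h2 ⊢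
    linarith
  let g' : ℤ → ℤ → ℝ := fun x y => if (x, clamp h y) ∈ S then 0 else g x (clamp h y)
  obtain ⟨φ, hφ⟩ := LinearMap.surjective_of_injective hinj (fun w => - Lap g' w.1.1 w.1.2)
  refine ⟨fun x y => ext φ x y + g' x y, ?_, ?_, ?_⟩
  · intro x y
    simp only [ext, g', hclamp]
  · intro x y hy hxy
    have : (x, y) ∉ S := by rw [hS]; omega
    simp [ext, g', clamp_of_abs_le hy, this]
  · intro x y h1 h2 h3 h4
    have hxy : (x, y) ∈ S := (hS _ _).2 ⟨⟨⟨h1, h2⟩, h3⟩, h4⟩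
    have := congrFun hφ ⟨_, hxy⟩
    rw [lap_add]
    change Lap (ext φ) x y = - Lap g' x y at this
    linarith

/-- Comparison of a solution with a subsolution. -/
lemma IsBoxSol.nonneg {l r : ℤ} {h : ℕ} {s : ℤ} {g u : ℤ → ℤ → ℝ} (hu : IsBoxSol l r h s g u)
    (hg : ∀ x y, 0 ≤ g x y) (x y : ℤ) : 0 ≤ u x y := by
  by_cases hx : -l ≤ x ∧ x ≤ r
  · refine clamped_nonneg hu.clamped ?_ ?_ ?_ x y hx.1 hx.2
    · intro x y h1 h2 h3
      by_cases h4 : y = 0 ∧ s ≤ x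
      · left
        rw [hu.boundary x y h3 (by tauto)]
        exact hg x y
      · right
        exact (hu.harmonic x y h1 h2 h3 h4).ge
    · intro y hy
      rw [hu.boundary _ y hy (by omega)]
      exact hg _ _
    · intro y hy
      rw [hu.boundary _ y hy (by omega)]
      exact hg _ _
  · rw [hu.clamped, hu.boundary _ _ (abs_clamp_le h y) (by omega)]
    exact hg _ _

lemma IsBoxSol.sub {l r : ℤ} {h : ℕ} {s : ℤ} {g g' u u' : ℤ → ℤ → ℝ}
    (hu : IsBoxSol l r h s g u) (hu' : IsBoxSol l r h s g' u') :
    IsBoxSol l r h s (fun x y => g x y - g' x y) (fun x y => u x y - u' x y) where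
  clamped x y := by rw [hu.clamped, hu'.clamped]
  boundary x y h1 h2 := by rw [hu.boundary x y h1 h2, hu'.boundary x y h1 h2]
  harmonic x y h1 h2 h3 h4 := by
    rw [lap_sub, hu.harmonic x y h1 h2 h3 h4, hu'.harmonic x y h1 h2 h3 h4, sub_zero]

lemma IsBoxSol.le_of_le {l r : ℤ} {h : ℕ} {s : ℤ} {g g' u u' : ℤ → ℤ → ℝ}
    (hu : IsBoxSol l r h s g u) (hu' : IsBoxSol l r h s g' u') (hg : ∀ x y, g x y ≤ g' x y)
    (x y : ℤ) : u x y ≤ u' x y :=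
  sub_nonneg.1 ((hu'.sub hu).nonneg (fun x y => sub_nonneg.2 (hg x y)) x y)

lemma isBoxSol_one (l r : ℤ) (h : ℕ) (s : ℤ) :
    IsBoxSol l r h s (fun _ _ => 1) (fun _ _ => 1) where
  clamped _ _ := rfl
  boundary _ _ _ _ := rfl
  harmonic _ _ _ _ _ _ := by unfold Lap; ring

lemma IsBoxSol.even {l r : ℤ} {h : ℕ} {s : ℤ} {g u : ℤ → ℤ → ℝ}
    (hu : IsBoxSol l r h s g u) (hg : ∀ x y, g x (-y) = g x y) (x y : ℤ) : u x (-y) = u x y := by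
  have hu' : IsBoxSol l r h s g (fun x y => u x (-y)) :=
    { clamped := fun x y => by rw [hu.clamped, clamp_neg]
      boundary := fun x y h1 h2 => by
        rw [hu.boundary x (-y) (by rwa [abs_neg]) (by rwa [neg_eq_zero]), hg]
      harmonic := fun x y h1 h2 h3 h4 => by
        have := hu.harmonic x (-y) h1 h2 (by rwa [abs_neg]) (by rwa [neg_eq_zero])
        simp only [Lap] at this ⊢
        rw [show -(y + 1) = -y - 1 by ring, show -(y - 1) = -y + 1 by ring]
        linarith }
  exact le_antisymm (hu'.le_of_le hu (fun _ _ => le_rfl) x y)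
    (hu.le_of_le hu' (fun _ _ => le_rfl) x y)

/-- The probability of hitting the slit `{x ≥ 0, y = 0}` at its tip before the sides. -/
noncomputable def tipHit (l r : ℤ) (h : ℕ) : ℤ → ℤ → ℝ :=
  Classical.choose (exists_isBoxSol l r h 0 fun x y => if x = 0 ∧ y = 0 then 1 else 0)

/-- The probability of hitting the left side before the slit `{x ≥ 1, y = 0}`. -/
noncomputable def leftHit (l r : ℤ) (h : ℕ) : ℤ → ℤ → ℝ :=
  Classical.choose (exists_isBoxSol l r h 1 fun x _ => if x < -l then 1 else 0)

lemma tipHit_spec (l r : ℤ) (h : ℕ) :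
    IsBoxSol l r h 0 (fun x y => if x = 0 ∧ y = 0 then 1 else 0) (tipHit l r h) :=
  Classical.choose_spec
    (exists_isBoxSol l r h 0 fun x y => if x = 0 ∧ y = 0 then 1 else 0)

lemma leftHit_spec (l r : ℤ) (h : ℕ) :
    IsBoxSol l r h 1 (fun x _ => if x < -l then 1 else 0) (leftHit l r h) :=
  Classical.choose_spec (exists_isBoxSol l r h 1 fun x _ => if x < -l then 1 else 0)

lemma tipHit_nonneg (l r : ℤ) (h : ℕ) (x y : ℤ) : 0 ≤ tipHit l r h x y :=
  (tipHit_spec l r h).nonneg (fun x y => by positivity) x y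

lemma tipHit_le_one (l r : ℤ) (h : ℕ) (x y : ℤ) : tipHit l r h x y ≤ 1 :=
  (tipHit_spec l r h).le_of_le (isBoxSol_one l r h 0) (fun x y => by split_ifs <;> norm_num) x y

lemma leftHit_nonneg (l r : ℤ) (h : ℕ) (x y : ℤ) : 0 ≤ leftHit l r h x y :=
  (leftHit_spec l r h).nonneg (fun x y => by positivity) x y

lemma leftHit_le_one (l r : ℤ) (h : ℕ) (x y : ℤ) : leftHit l r h x y ≤ 1 :=
  (leftHit_spec l r h).le_of_le (isBoxSol_one l r h 1) (fun x y => by split_ifs <;> norm_num) x y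

lemma tipHit_neg (l r : ℤ) (h : ℕ) (x y : ℤ) : tipHit l r h x (-y) = tipHit l r h x y :=
  (tipHit_spec l r h).even (fun x y => by simp) x y

lemma leftHit_neg (l r : ℤ) (h : ℕ) (x y : ℤ) : leftHit l r h x (-y) = leftHit l r h x y :=
  (leftHit_spec l r h).even (fun x y => by simp) x y

lemma tipHit_tip {l r : ℤ} {h : ℕ} : tipHit l r h 0 0 = 1 := by
  rw [(tipHit_spec l r h).boundary 0 0 (by simp) (by simp)]; simp

lemma tipHit_slit {l r : ℤ} {h : ℕ} {x : ℤ} (hx : 1 ≤ x) : tipHit l r h x 0 = 0 := by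
  rw [(tipHit_spec l r h).boundary x 0 (by simp) (by omega)]; simp; omega

lemma leftHit_slit {l r : ℤ} (hl : 0 ≤ l) {h : ℕ} {x : ℤ} (hx : 1 ≤ x) :
    leftHit l r h x 0 = 0 := by
  rw [(leftHit_spec l r h).boundary x 0 (by simp) (by omega)]; simp; omega

lemma leftHit_lower {l r : ℤ} (hl : 0 ≤ l) (hr : 0 ≤ r) (h : ℕ) :
    1 / ((l : ℝ) + 2) ≤ leftHit l r h 0 0 := by
  have hl' : (0 : ℝ) < (l : ℝ) + 2 := by
    have : (0 : ℝ) ≤ l := by exact_mod_cast hl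
    linarith
  have hsp := leftHit_spec l r h
  have hmax : ∀ x : ℤ, 0 ≤ max (0 : ℝ) (1 - x) := fun x => le_max_left _ _
  have key := clamped_nonneg (l := l) (r := r) (h := h)
    (u := fun x y => leftHit l r h x y - ((l : ℝ) + 2)⁻¹ * max 0 (1 - (x : ℝ)))
    (fun x y => by rw [hsp.clamped])
    (by
      intro x y h1 h2 h3
      by_cases h4 : y = 0 ∧ 1 ≤ x
      · left
        rw [h4.1, leftHit_slit hl h4.2, max_eq_left]
        · simp
        · have : (1 : ℝ) ≤ x := by exact_mod_cast h4.2
          linarith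
      · right
        rw [lap_sub, hsp.harmonic x y h1 h2 h3 h4,
          lap_const_mul _ (fun x _ => max 0 (1 - (x : ℝ)))]
        have : Lap (fun x _ => max 0 (1 - (x : ℝ))) x y ≤ 0 := by
          unfold Lap
          push_cast
          rcases le_total (1 - (x : ℝ)) 0 with h5 | h5
          · rw [max_eq_left h5]
            have := le_max_left 0 (1 - ((x : ℝ) + 1))
            have := le_max_left 0 (1 - ((x : ℝ) - 1))
            linarith
          · rw [max_eq_right h5]
            have := le_max_right 0 (1 - ((x : ℝ) + 1))
            have := le_max_right 0 (1 - ((x : ℝ) - 1))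
            linarith
        have h6 : 0 ≤ ((l : ℝ) + 2)⁻¹ := by positivity
        nlinarith)
    (by
      intro y hy
      rw [hsp.boundary _ y hy (by omega), if_pos (by omega), max_eq_right]
      · push_cast
        rw [show 1 - (-(l : ℝ) - 1) = l + 2 by ring, inv_mul_cancel₀ hl'.ne']
        simp
      · push_cast
        linarith)
    (by
      intro y hy
      rw [hsp.boundary _ y hy (by omega), if_neg (by omega), max_eq_left]
      · simp
      · push_cast
        have : (0 : ℝ) ≤ r := by exact_mod_cast hr
        linarith) 0 0 (by omega) hr
  simp only [Int.cast_zero, sub_zero, zero_le_one, sup_of_le_right, mul_one, sub_nonneg] at key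
  rwa [one_div]

end DirichletProblem

end TrunkDegree

namespace TrunkDegree

open Finset

section Barrier

/-- The exponential of a positive superharmonic function vanishing on the slit. -/
noncomputable def barrier (x y : ℤ) : ℝ :=
  if y = 0 ∧ 1 ≤ x then 1
  else if x = 3 ∧ (y = 1 ∨ y = -1) then 18
  else 32 * (((x : ℝ) - 3) ^ 2 + (y : ℝ) ^ 2 - 1)

lemma one_le_barrier (x y : ℤ) : 1 ≤ barrier x y := by
  unfold barrier
  split_ifs with h1 h2
  · exact le_rfl
  · norm_num
  · have : (2 : ℤ) ≤ (x - 3) ^ 2 + y ^ 2 := by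
      rcases eq_or_ne y 0 with h | h
      · have : x ≤ 0 := by by_contra h'; exact h1 ⟨h, by omega⟩
        nlinarith
      · have hy : 1 ≤ y ^ 2 := by have := sq_pos_of_ne_zero h; omega
        rcases eq_or_ne x 3 with h3 | h3
        · have : y ≠ 1 ∧ y ≠ -1 := by tauto
          rcases lt_or_gt_of_ne h with h4 | h4
          · have : y ≤ -2 := by omega
            nlinarith
          · have : 2 ≤ y := by omega
            nlinarith
        · have : 1 ≤ (x - 3) ^ 2 := by
            have := sq_pos_of_ne_zero (sub_ne_zero.2 h3)
            omega
          omega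
    have : (2 : ℝ) ≤ ((x : ℝ) - 3) ^ 2 + (y : ℝ) ^ 2 := by exact_mod_cast this
    linarith

lemma barrier_le (x y : ℤ) (h : (2 : ℤ) ≤ (x - 3) ^ 2 + y ^ 2) :
    barrier x y ≤ 32 * (((x : ℝ) - 3) ^ 2 + (y : ℝ) ^ 2 - 1) := by
  have h' : (2 : ℝ) ≤ ((x : ℝ) - 3) ^ 2 + (y : ℝ) ^ 2 := by exact_mod_cast h
  unfold barrier
  split_ifs with h1 h2
  · linarith
  · obtain ⟨rfl, rfl | rfl⟩ := h2 <;> norm_num at h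
  · exact le_rfl

lemma barrier_mul_le (x y : ℤ) (hxy : ¬ (y = 0 ∧ 1 ≤ x)) :
    barrier (x + 1) y * barrier (x - 1) y * (barrier x (y + 1) * barrier x (y - 1)) ≤
      barrier x y ^ 4 := by
  by_cases hs : (y = 1 ∨ y = -1) ∧ (x = 2 ∨ x = 3 ∨ x = 4)
  · obtain ⟨rfl | rfl, rfl | rfl | rfl⟩ := hs <;> norm_num [barrier]
  by_cases hs' : (y = 2 ∨ y = -2) ∧ x = 3
  · obtain ⟨rfl | rfl, rfl⟩ := hs' <;> norm_num [barrier]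
  have hfar : ∀ x' y' : ℤ, ¬ ((y' = 0 ∧ 2 ≤ x' ∧ x' ≤ 4) ∨ (x' = 3 ∧ (y' = 1 ∨ y' = -1))) →
      2 ≤ (x' - 3) ^ 2 + y' ^ 2 := by
    intro x' y' h
    by_cases h1 : x' ≤ 1
    · nlinarith [sq_nonneg y']
    by_cases h2 : 5 ≤ x'
    · nlinarith [sq_nonneg y']
    by_cases h3 : 2 ≤ y'
    · nlinarith [sq_nonneg (x' - 3)]
    by_cases h4 : y' ≤ -2
    · nlinarith [sq_nonneg (x' - 3)]
    have h5 : x' = 2 ∨ x' = 3 ∨ x' = 4 := by omega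
    have h6 : y' = -1 ∨ y' = 0 ∨ y' = 1 := by omega
    rcases h5 with rfl | rfl | rfl <;> rcases h6 with rfl | rfl | rfl <;> simp at h ⊢
  have h1 := barrier_le _ _ (hfar (x + 1) y (by omega))
  have h2 := barrier_le _ _ (hfar (x - 1) y (by omega))
  have h3 := barrier_le _ _ (hfar x (y + 1) (by omega))
  have h4 := barrier_le _ _ (hfar x (y - 1) (by omega))
  have h0 : barrier x y = 32 * (((x : ℝ) - 3) ^ 2 + (y : ℝ) ^ 2 - 1) := by
    unfold barrier
    rw [if_neg hxy, if_neg (by omega)]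
  have hge : (2 : ℝ) ≤ ((x : ℝ) - 3) ^ 2 + (y : ℝ) ^ 2 := by
    exact_mod_cast hfar x y (by omega)
  have p1 := one_le_barrier (x + 1) y
  have p2 := one_le_barrier (x - 1) y
  have p3 := one_le_barrier x (y + 1)
  have p4 := one_le_barrier x (y - 1)
  rw [h0]
  push_cast at h1 h2 h3 h4
  set X : ℝ := (x : ℝ) - 3
  have e1 : (x : ℝ) + 1 - 3 = X + 1 := by ring
  have e2 : (x : ℝ) - 1 - 3 = X - 1 := by ring
  rw [e1] at h1
  rw [e2] at h2
  set Y : ℝ := (y : ℝ)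
  calc barrier (x + 1) y * barrier (x - 1) y * (barrier x (y + 1) * barrier x (y - 1))
      ≤ (32 * ((X + 1) ^ 2 + Y ^ 2 - 1)) * (32 * ((X - 1) ^ 2 + Y ^ 2 - 1)) *
        ((32 * (X ^ 2 + (Y + 1) ^ 2 - 1)) * (32 * (X ^ 2 + (Y - 1) ^ 2 - 1))) := by
        have q1 := p1.trans h1
        have q3 := p3.trans h3
        exact mul_le_mul
          (mul_le_mul h1 h2 (by linarith) (by linarith))
          (mul_le_mul h3 h4 (by linarith) (by linarith))
          (mul_nonneg (by linarith) (by linarith))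
          (mul_nonneg (by linarith) (by linarith [p2.trans h2]))
    _ ≤ (32 * (X ^ 2 + Y ^ 2 - 1)) ^ 4 := by
        set s := X ^ 2 + Y ^ 2 with hs
        have : (32 * ((X + 1) ^ 2 + Y ^ 2 - 1)) * (32 * ((X - 1) ^ 2 + Y ^ 2 - 1)) *
            ((32 * (X ^ 2 + (Y + 1) ^ 2 - 1)) * (32 * (X ^ 2 + (Y - 1) ^ 2 - 1))) =
            32 ^ 4 * (s ^ 4 - 4 * s ^ 3 + 16 * (X ^ 2 * Y ^ 2)) := by
          rw [hs]; ring
        rw [this, mul_pow]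
        have h5 : 4 * (X ^ 2 * Y ^ 2) ≤ s ^ 2 := by nlinarith [sq_nonneg (X ^ 2 - Y ^ 2)]
        have h6 : (s - 1) ^ 4 = s ^ 4 - 4 * s ^ 3 + 6 * s ^ 2 - 4 * s + 1 := by ring
        rw [h6]
        have : 0 ≤ 2 * s ^ 2 - 4 * s := by nlinarith
        linarith

lemma lap_log_barrier_nonneg (x y : ℤ) (hxy : ¬ (y = 0 ∧ 1 ≤ x)) :
    0 ≤ Lap (fun x y => Real.log (barrier x y)) x y := by
  have hpos' : ∀ x y, 0 < barrier x y := fun x y => zero_lt_one.trans_le (one_le_barrier x y)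
  have hpos : ∀ x y, barrier x y ≠ 0 := fun x y => (hpos' x y).ne'
  have := Real.log_le_log (mul_pos (mul_pos (hpos' _ _) (hpos' _ _))
    (mul_pos (hpos' _ _) (hpos' _ _))) (barrier_mul_le x y hxy)
  rw [Real.log_mul (mul_ne_zero (hpos _ _) (hpos _ _)) (mul_ne_zero (hpos _ _) (hpos _ _)),
    Real.log_mul (hpos _ _) (hpos _ _), Real.log_mul (hpos _ _) (hpos _ _), Real.log_pow] at this
  simp only [Lap]
  push_cast at this
  linarith

lemma le_barrier_of_boundary {m x y : ℤ} (hm : 6 ≤ m) (h : |x| = m ∨ |y| = m)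
    (hxy : ¬ (y = 0 ∧ 1 ≤ x)) : (m : ℝ) ≤ barrier x y := by
  have h0 : barrier x y = 32 * (((x : ℝ) - 3) ^ 2 + (y : ℝ) ^ 2 - 1) := by
    unfold barrier
    rw [if_neg hxy, if_neg (by
      rintro ⟨rfl, rfl | rfl⟩ <;> simp at h <;> omega)]
  rw [h0]
  have h1 : m ≤ 32 * ((x - 3) ^ 2 + y ^ 2 - 1) := by
    rcases h with h | h
    · rcases abs_cases x with ⟨h2, _⟩ | ⟨h2, _⟩ <;> rw [h2] at h <;>
        nlinarith [sq_nonneg y]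
    · have : y ^ 2 = m ^ 2 := by rw [← h, sq_abs]
      nlinarith [sq_nonneg (x - 3)]
  exact_mod_cast h1

/-- Away from its boundary a large square forgets bounded functions that vanish on the slit and
are harmonic elsewhere. -/
lemma le_of_slit {m : ℤ} (hm : 6 ≤ m) {u : ℤ → ℤ → ℝ} {M : ℝ} (hM : 0 ≤ M)
    (hslit : ∀ x, 1 ≤ x → u x 0 = 0)
    (hharm : ∀ x y : ℤ, |x| < m → |y| < m → u x y = 0 ∨ Lap u x y = 0)
    (hbd : ∀ x y : ℤ, |x| ≤ m → |y| ≤ m → (|x| = m ∨ |y| = m) → u x y ≤ M)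
    {x y : ℤ} (hx : |x| < m) (hy : |y| < m) :
    u x y ≤ M / Real.log m * Real.log (barrier x y) := by
  have hm' : (6 : ℝ) ≤ m := by exact_mod_cast hm
  have hlog : 0 < Real.log m := Real.log_pos (by linarith)
  have hB : ∀ x y, 0 ≤ Real.log (barrier x y) := fun x y => Real.log_nonneg (one_le_barrier x y)
  have hc : 0 ≤ M / Real.log m := by positivity
  let S : Finset (ℤ × ℤ) := Ioo (-m) m ×ˢ Ioo (-m) m
  have hS : ∀ x y, (x, y) ∈ S ↔ |x| < m ∧ |y| < m := by
    intro x y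
    simp only [S, mem_product, mem_Ioo, abs_lt]
  have hbd' : ∀ x y : ℤ, |x| ≤ m → |y| ≤ m → (x, y) ∉ S →
      0 ≤ M / Real.log m * Real.log (barrier x y) - u x y := by
    intro x y h1 h2 h3
    rw [hS] at h3
    have h4 : |x| = m ∨ |y| = m := by omega
    by_cases h5 : y = 0 ∧ 1 ≤ x
    · rw [h5.1, hslit x h5.2]
      have := mul_nonneg hc (hB x 0)
      linarith
    · have h6 := hbd x y h1 h2 h4
      have h7 := Real.log_le_log (by linarith) (le_barrier_of_boundary hm h4 h5)
      have h8 := mul_le_mul_of_nonneg_left h7 hc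
      rw [div_mul_cancel₀ _ hlog.ne'] at h8
      linarith
  have key := nonneg_of_lap_nonneg S
    (fun x y => M / Real.log m * Real.log (barrier x y) - u x y)
    (by
      intro x y hxy hneg
      rw [hS] at hxy
      have h0 := mul_nonneg hc (hB x y)
      have h1 : ¬ (y = 0 ∧ 1 ≤ x) := by
        rintro ⟨rfl, h⟩
        rw [hslit x h] at hneg
        linarith
      rcases hharm x y hxy.1 hxy.2 with h2 | h2
      · rw [h2] at hneg
        linarith
      · rw [lap_sub, h2, lap_const_mul _ fun x y => Real.log (barrier x y)]
        have := mul_nonneg hc (lap_log_barrier_nonneg x y h1)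
        linarith)
    (by
      intro x y hxy _ x' y' hnb
      by_cases h : (x', y') ∈ S
      · exact Or.inr ⟨_, h, le_rfl⟩
      · left
        rw [hS, abs_lt, abs_lt] at hxy
        exact hbd' x' y' (by rw [abs_le]; omega) (by rw [abs_le]; omega) h)
    (by
      intro x y hxy _
      by_cases h : (x - 1, y) ∈ S
      · exact Or.inl h
      · right
        rw [hS, abs_lt, abs_lt] at hxy
        exact hbd' _ _ (by rw [abs_le]; omega) (by rw [abs_le]; omega) h)
    x y ((hS x y).2 ⟨hx, hy⟩)
  linarith

lemma abs_le_of_slit {m : ℤ} (hm : 6 ≤ m) {u : ℤ → ℤ → ℝ} {M : ℝ} (hM : 0 ≤ M)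
    (hslit : ∀ x, 1 ≤ x → u x 0 = 0)
    (hharm : ∀ x y : ℤ, |x| < m → |y| < m → u x y = 0 ∨ Lap u x y = 0)
    (hbd : ∀ x y : ℤ, |x| ≤ m → |y| ≤ m → (|x| = m ∨ |y| = m) → |u x y| ≤ M)
    {x y : ℤ} (hx : |x| < m) (hy : |y| < m) :
    |u x y| ≤ M / Real.log m * Real.log (barrier x y) := by
  refine abs_le'.2 ⟨le_of_slit hm hM hslit hharm
    (fun x y h1 h2 h3 => (le_abs_self _).trans (hbd x y h1 h2 h3)) hx hy, ?_⟩
  exact le_of_slit (u := fun x y => - u x y) hm hM (fun x h => by rw [hslit x h, neg_zero])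
    (fun x y h1 h2 => by
      rw [lap_neg]
      rcases hharm x y h1 h2 with h | h <;> simp [h])
    (fun x y h1 h2 h3 => (neg_le_abs _).trans (hbd x y h1 h2 h3)) hx hy

/-- Gradient bound by reflection. -/
lemma sub_le_of_reflection {f : ℤ → ℤ → ℝ} {x₀ y₀ k : ℤ} (hk : 1 ≤ k) (hf0 : ∀ x y, 0 ≤ f x y)
    (hf1 : ∀ x y, f x y ≤ 1)
    (h : ∀ x y : ℤ, x₀ ≤ x → x < x₀ + k → |y - y₀| < k → f x y = f (2 * x₀ - 1 - x) y ∨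
      (Lap f x y = 0 ∧ Lap f (2 * x₀ - 1 - x) y = 0)) :
    f x₀ y₀ - f (x₀ - 1) y₀ ≤ 2 / k := by
  have hk' : (1 : ℝ) ≤ k := by exact_mod_cast hk
  have hk0 : (0 : ℝ) < k := by linarith
  let Ψ : ℤ → ℤ → ℝ := fun x y => 3 / (k : ℝ) * ((x : ℝ) - x₀ + 1 / 2) +
    1 / (k : ℝ) ^ 2 * (((y : ℝ) - y₀) ^ 2 + 1 / 4 - ((x : ℝ) - x₀ + 1 / 2) ^ 2)
  let w : ℤ → ℤ → ℝ := fun x y => Ψ x y - (f x y - f (2 * x₀ - 1 - x) y)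
  have hΨ : ∀ x y : ℤ, x₀ ≤ x → x ≤ x₀ + k → 0 ≤ Ψ x y := by
    intro x y h1 h2
    have h1' : (x₀ : ℝ) ≤ x := by exact_mod_cast h1
    have h2' : (x : ℝ) ≤ x₀ + k := by exact_mod_cast h2
    set X : ℝ := (x : ℝ) - x₀ + 1 / 2 with hX
    have hX0 : 0 ≤ X := by linarith
    have hX1 : X ≤ 2 * k := by linarith
    have : Ψ x y = (1 / (k : ℝ) ^ 2) * (X * (3 * k - X) + (((y : ℝ) - y₀) ^ 2 + 1 / 4)) := by
      simp only [Ψ]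
      field_simp
      ring
    rw [this]
    have : 0 ≤ X * (3 * k - X) := mul_nonneg hX0 (by linarith)
    positivity
  have hΨx : ∀ y : ℤ, 1 ≤ Ψ (x₀ + k) y := by
    intro y
    have : Ψ (x₀ + k) y - 1 =
        (1 / (k : ℝ) ^ 2) * ((k : ℝ) ^ 2 + k / 2 + ((y : ℝ) - y₀) ^ 2) := by
      simp only [Ψ]
      push_cast
      field_simp
      ring
    have h2 : 0 ≤ (1 / (k : ℝ) ^ 2) * ((k : ℝ) ^ 2 + k / 2 + ((y : ℝ) - y₀) ^ 2) := by positivity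
    linarith
  have hΨy : ∀ x y : ℤ, x₀ ≤ x → x ≤ x₀ + k → |y - y₀| = k → 1 ≤ Ψ x y := by
    intro x y h1 h2 h3
    have h1' : (x₀ : ℝ) ≤ x := by exact_mod_cast h1
    have h2' : (x : ℝ) ≤ x₀ + k := by exact_mod_cast h2
    have h3' : ((y : ℝ) - y₀) ^ 2 = (k : ℝ) ^ 2 := by
      have : (y - y₀) ^ 2 = k ^ 2 := by rw [← h3, sq_abs]
      exact_mod_cast this
    set X : ℝ := (x : ℝ) - x₀ + 1 / 2 with hX
    have hX0 : 0 ≤ X := by linarith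
    have hX1 : X ≤ 2 * k := by linarith
    have : Ψ x y - 1 = (1 / (k : ℝ) ^ 2) * (X * (3 * k - X) + 1 / 4) := by
      simp only [Ψ, h3']
      field_simp
      ring
    have h4 : 0 ≤ X * (3 * k - X) := mul_nonneg hX0 (by linarith)
    have h5 : 0 ≤ (1 / (k : ℝ) ^ 2) * (X * (3 * k - X) + 1 / 4) := by positivity
    linarith
  let S : Finset (ℤ × ℤ) := Ico x₀ (x₀ + k) ×ˢ Ioo (y₀ - k) (y₀ + k)
  have hS : ∀ x y, (x, y) ∈ S ↔ (x₀ ≤ x ∧ x < x₀ + k) ∧ |y - y₀| < k := by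
    intro x y
    simp only [S, mem_product, mem_Ioo, mem_Ico, abs_lt]
    omega
  have hD : ∀ x y, f x y - f (2 * x₀ - 1 - x) y ≤ 1 := by
    intro x y
    have := hf1 x y
    have := hf0 (2 * x₀ - 1 - x) y
    linarith
  have hleft : ∀ y, w x₀ y < 0 → 0 ≤ w (x₀ - 1) y := by
    intro y hy
    have h1 : 0 ≤ Ψ x₀ y + Ψ (x₀ - 1) y := by
      have : Ψ x₀ y + Ψ (x₀ - 1) y = 2 * (1 / (k : ℝ) ^ 2) * ((y : ℝ) - y₀) ^ 2 := by
        simp only [Ψ]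
        push_cast
        ring
      rw [this]
      positivity
    simp only [w] at hy ⊢
    rw [show 2 * x₀ - 1 - (x₀ - 1) = x₀ by ring]
    rw [show 2 * x₀ - 1 - x₀ = x₀ - 1 by ring] at hy
    linarith
  have key := nonneg_of_lap_nonneg S w
    (by
      intro x y hxy hneg
      rw [hS] at hxy
      rcases h x y hxy.1.1 hxy.1.2 hxy.2 with h1 | ⟨h1, h2⟩
      · simp only [w] at hneg
        have := hΨ x y hxy.1.1 hxy.1.2.le
        rw [h1] at hneg
        linarith
      · have h3 : Lap Ψ x y = 0 := by
          simp only [Lap, Ψ]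
          push_cast
          ring
        simp only [Lap, w] at h1 h2 h3 ⊢
        rw [show 2 * x₀ - 1 - (x + 1) = 2 * x₀ - 1 - x - 1 by ring,
          show 2 * x₀ - 1 - (x - 1) = 2 * x₀ - 1 - x + 1 by ring]
        linarith)
    (by
      intro x y hxy hneg x' y' hnb
      by_cases hmem : (x', y') ∈ S
      · exact Or.inr ⟨_, hmem, le_rfl⟩
      left
      rw [hS] at hxy hmem
      obtain ⟨h1, h2⟩ := hxy
      by_cases hx' : x' = x₀ - 1
      · obtain ⟨rfl, rfl⟩ : x = x₀ ∧ y' = y := by omega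
        rw [hx']
        exact hleft y' hneg
      by_cases hx'' : x' = x₀ + k
      · rw [hx'']
        have := hΨx y'
        have := hD (x₀ + k) y'
        simp only [w]
        linarith
      · have h3 : |y' - y₀| = k := by
          rw [abs_lt] at h2 hmem
          rw [abs_eq (by omega)]
          omega
        have := hΨy x' y' (by omega) (by omega) h3
        have := hD x' y'
        simp only [w]
        linarith)
    (by
      intro x y hxy hneg
      rw [hS] at hxy ⊢
      by_cases hx' : x = x₀
      · right
        rw [hx'] at hneg ⊢
        exact hleft y hneg
      · left
        exact ⟨by omega, hxy.2⟩)
    x₀ y₀ ((hS _ _).2 ⟨⟨le_rfl, by omega⟩, by simp; omega⟩)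
  have h1 : Ψ x₀ y₀ ≤ 2 / k := by
    have : Ψ x₀ y₀ = (3 / 2) / k := by
      simp only [Ψ]
      field_simp
      ring
    rw [this]
    gcongr
    norm_num
  simp only [w] at key
  rw [show 2 * x₀ - 1 - x₀ = x₀ - 1 by ring] at key
  linarith

lemma abs_sub_le_of_reflection {f : ℤ → ℤ → ℝ} {x₀ y₀ k : ℤ} (hk : 1 ≤ k)
    (hf0 : ∀ x y, 0 ≤ f x y) (hf1 : ∀ x y, f x y ≤ 1)
    (h : ∀ x y : ℤ, x₀ ≤ x → x < x₀ + k → |y - y₀| < k → f x y = f (2 * x₀ - 1 - x) y ∨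
      (Lap f x y = 0 ∧ Lap f (2 * x₀ - 1 - x) y = 0)) :
    |f (x₀ - 1) y₀ - f x₀ y₀| ≤ 2 / k := by
  refine abs_le'.2 ⟨?_, ?_⟩
  · have := sub_le_of_reflection (f := fun x y => 1 - f x y) (x₀ := x₀) (y₀ := y₀) hk
      (fun x y => by linarith [hf1 x y]) (fun x y => by linarith [hf0 x y])
      (fun x y h1 h2 h3 => by
        rcases h x y h1 h2 h3 with h4 | ⟨h4, h5⟩
        · left; rw [h4]
        · right
          simp only [Lap] at h4 h5 ⊢
          constructor <;> linarith)
    linarith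
  · have := sub_le_of_reflection hk hf0 hf1 h
    linarith

end Barrier

end TrunkDegree

namespace TrunkDegree

open Finset Complex

section SquareRootSymbol

/-- The smaller root of `κ² - 6κ + 1`. -/
noncomputable def kap : ℝ := 3 - 2 * √2

lemma kap_bounds : 0 < kap ∧ kap < 1 / 5 := by
  have h1 : √2 * √2 = 2 := Real.mul_self_sqrt (by norm_num)
  have h2 := Real.sqrt_nonneg 2
  unfold kap
  constructor <;> nlinarith

/-- The square root `√((1 - z)(1 - κz))` on the half plane `Re z < 1`. -/
noncomputable def sig (z : ℂ) : ℂ := (1 - z) ^ (2⁻¹ : ℂ) * (1 - kap * z) ^ (2⁻¹ : ℂ)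

lemma sig_sq (z : ℂ) : sig z ^ 2 = (1 - z) * (1 - kap * z) := by
  unfold sig
  rw [mul_pow, cpow_ofNat_inv_pow, cpow_ofNat_inv_pow]

lemma norm_sig_sq (z : ℂ) : ‖sig z‖ ^ 2 = ‖1 - z‖ * ‖1 - kap * z‖ := by
  rw [← norm_pow, sig_sq, norm_mul]

lemma one_sub_kap_mul_re {z : ℂ} (hz : z.re < 1) : 0 < (1 - kap * z).re := by
  obtain ⟨h1, h2⟩ := kap_bounds
  rw [sub_re, one_re, re_ofReal_mul]
  nlinarith

lemma abs_im_cpow_lt {w : ℂ} (hw : 0 < w.re) :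
    |(w ^ (2⁻¹ : ℂ)).im| < (w ^ (2⁻¹ : ℂ)).re := by
  rw [abs_cpow_inv_two_im, cpow_inv_two_re]
  have h := re_le_norm w
  exact Real.sqrt_lt_sqrt (by linarith) (by linarith)

lemma sig_re_pos {z : ℂ} (hz : z.re < 1) : 0 < (sig z).re := by
  have h1 := abs_im_cpow_lt (w := 1 - z) (by simpa using hz)
  have h2 := abs_im_cpow_lt (one_sub_kap_mul_re hz)
  unfold sig
  rw [mul_re]
  set a := (1 - z) ^ (2⁻¹ : ℂ)
  set b := (1 - kap * z) ^ (2⁻¹ : ℂ)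
  rw [abs_lt] at h1 h2
  rcases le_total 0 a.im with h | h <;> rcases le_total 0 b.im with h' | h' <;> nlinarith

lemma sig_ne_zero {z : ℂ} (hz : z.re < 1) : sig z ≠ 0 := by
  intro h
  have := sig_re_pos hz
  rw [h] at this
  simp at this

lemma one_le_norm_one_add_sig {z : ℂ} (hz : z.re < 1) : 1 ≤ ‖1 + sig z‖ := by
  have h1 := sig_re_pos hz
  have h2 := re_le_norm (1 + sig z)
  rw [add_re, one_re] at h2
  linarith

lemma one_add_sig_ne_zero {z : ℂ} (hz : z.re < 1) : 1 + sig z ≠ 0 := by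
  rw [← norm_pos_iff]
  linarith [one_le_norm_one_add_sig hz]

lemma sig_zero : sig 0 = 1 := by simp [sig]

lemma differentiableAt_sig {z : ℂ} (hz : z.re < 1) : DifferentiableAt ℂ sig z := by
  unfold sig
  refine DifferentiableAt.mul (DifferentiableAt.cpow_const (by fun_prop) ?_)
    (DifferentiableAt.cpow_const (by fun_prop) ?_)
  · exact Or.inl (by simpa using hz)
  · exact Or.inl (one_sub_kap_mul_re hz)

lemma norm_sig_le {z : ℂ} (hz : ‖z‖ ≤ 1) : ‖sig z‖ ≤ 2 := by
  obtain ⟨hk1, hk2⟩ := kap_bounds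
  have h1 : ‖1 - z‖ ≤ 2 := by
    have := norm_sub_le 1 z
    rw [norm_one] at this
    linarith
  have h2 : ‖1 - kap * z‖ ≤ 2 := by
    have := norm_sub_le 1 (kap * z)
    rw [norm_one, norm_mul, norm_real, Real.norm_of_nonneg hk1.le] at this
    nlinarith [norm_nonneg z]
  have h3 := norm_sig_sq z
  nlinarith [norm_nonneg (sig z), norm_nonneg (1 - z), norm_nonneg (1 - kap * z)]

/-- An integrable majorant of the singularity at `z = 1`. -/
noncomputable def majorant (θ : ℝ) : ℝ :=
  2 * (3 * (θ ^ (-(1 / 2) : ℝ) + (2 * Real.pi - θ) ^ (-(1 / 2) : ℝ))) + 2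

lemma intervalIntegrable_majorant :
    IntervalIntegrable majorant MeasureTheory.volume 0 (2 * Real.pi) := by
  have h1 : IntervalIntegrable (fun θ : ℝ => θ ^ (-(1 / 2) : ℝ)) MeasureTheory.volume
      0 (2 * Real.pi) := intervalIntegral.intervalIntegrable_rpow' (by norm_num)
  have h2 : IntervalIntegrable (fun θ : ℝ => (2 * Real.pi - θ) ^ (-(1 / 2) : ℝ))
      MeasureTheory.volume 0 (2 * Real.pi) := by
    have := (h1.comp_sub_left (2 * Real.pi)).symm
    simpa using this
  exact (((h1.add h2).const_mul 3).const_mul 2).add intervalIntegrable_const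

lemma norm_one_sub_circleMap {r θ : ℝ} (hr : 1 / 2 ≤ r) :
    Real.sin (θ / 2) ≤ ‖1 - circleMap 0 r θ‖ := by
  have h1 : ‖1 - circleMap 0 r θ‖ ^ 2 = (1 - r) ^ 2 + 4 * r * Real.sin (θ / 2) ^ 2 := by
    have h2 : Real.cos θ = 1 - 2 * Real.sin (θ / 2) ^ 2 := by
      have := Real.cos_two_mul (θ / 2)
      rw [mul_div_cancel₀ _ (by norm_num : (2 : ℝ) ≠ 0)] at this
      rw [this, Real.cos_sq']
      ring
    have h3 := Real.sin_sq_add_cos_sq θ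
    rw [Complex.sq_norm, normSq_apply]
    have hre : (1 - circleMap 0 r θ).re = 1 - r * Real.cos θ := by
      simp [circleMap, exp_re]
    have him : (1 - circleMap 0 r θ).im = - (r * Real.sin θ) := by
      simp [circleMap, exp_im]
    rw [hre, him]
    rw [h2] at h3 ⊢
    linear_combination r ^ 2 * h3
  refine abs_le_of_sq_le_sq' ?_ (norm_nonneg _) |>.2
  rw [h1]
  nlinarith [sq_nonneg (1 - r), sq_nonneg (Real.sin (θ / 2))]

lemma norm_inv_sig_le {r θ : ℝ} (hr : 1 / 2 ≤ r) (hr1 : r ≤ 1) (hθ : 0 < θ)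
    (hθ' : θ < 2 * Real.pi) :
    2 * ‖(sig (circleMap 0 r θ))⁻¹‖ + 2 ≤ majorant θ := by
  obtain ⟨hk1, hk2⟩ := kap_bounds
  have hpi := Real.pi_pos
  have hpi4 := Real.pi_lt_d2
  have hkey : ∀ t : ℝ, 0 < t → t / Real.pi ≤ Real.sin (θ / 2) →
      ‖(sig (circleMap 0 r θ))⁻¹‖ ≤ 3 * t ^ (-(1 / 2) : ℝ) := by
    intro t ht hts
    have h1 := norm_one_sub_circleMap (θ := θ) hr
    have h2 : 4 / 5 ≤ ‖1 - kap * circleMap 0 r θ‖ := by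
      have := norm_sub_norm_le 1 (kap * circleMap 0 r θ)
      rw [norm_one, norm_mul, norm_real, Real.norm_of_nonneg hk1.le, norm_circleMap_zero,
        abs_of_nonneg (by linarith)] at this
      nlinarith
    have h3 := norm_sig_sq (circleMap 0 r θ)
    have h4 : t / Real.pi * (4 / 5) ≤ ‖sig (circleMap 0 r θ)‖ ^ 2 := by
      rw [h3]
      exact mul_le_mul (hts.trans h1) h2 (by norm_num) (norm_nonneg _)
    have h5 : t ≤ (3 * ‖sig (circleMap 0 r θ)‖) ^ 2 := by
      have h6 : t ≤ t / Real.pi * (4 / 5) * 9 := by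
        rw [div_mul_eq_mul_div, div_mul_eq_mul_div, le_div_iff₀ hpi]
        nlinarith
      nlinarith
    have h6 : √t ≤ 3 * ‖sig (circleMap 0 r θ)‖ := Real.sqrt_le_left (by positivity) |>.2 h5
    have hst : 0 < √t := Real.sqrt_pos.2 ht
    rw [Real.rpow_neg ht.le, ← Real.sqrt_eq_rpow, norm_inv, ← div_eq_mul_inv, inv_eq_one_div,
      div_le_div_iff₀ (by linarith) hst]
    linarith
  have hp1 : 0 ≤ θ ^ (-(1 / 2) : ℝ) := Real.rpow_nonneg hθ.le _
  have hp2 : 0 ≤ (2 * Real.pi - θ) ^ (-(1 / 2) : ℝ) := Real.rpow_nonneg (by linarith) _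
  unfold majorant
  rcases le_total θ Real.pi with h | h
  · have := hkey θ hθ (by
      have := Real.mul_le_sin (x := θ / 2) (by linarith) (by linarith)
      calc θ / Real.pi = 2 / Real.pi * (θ / 2) := by ring
        _ ≤ _ := this)
    linarith
  · have := hkey (2 * Real.pi - θ) (by linarith) (by
      have := Real.mul_le_sin (x := Real.pi - θ / 2) (by linarith) (by linarith)
      rw [Real.sin_pi_sub] at this
      calc (2 * Real.pi - θ) / Real.pi = 2 / Real.pi * (Real.pi - θ / 2) := by ring
        _ ≤ _ := this)
    linarith

lemma circleMap_re_lt {r θ : ℝ} (hr : 0 ≤ r) (hr1 : r ≤ 1) (hθ : 0 < θ)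
    (hθ' : θ < 2 * Real.pi) : (circleMap 0 r θ).re < 1 := by
  have h1 : (circleMap 0 r θ).re = r * Real.cos θ := by simp [circleMap, exp_re]
  have h2 : Real.cos θ < 1 := by
    refine lt_of_le_of_ne (Real.cos_le_one θ) fun h => ?_
    rw [Real.cos_eq_one_iff_of_lt_of_lt (by linarith) hθ'] at h
    linarith
  rw [h1]
  rcases hr.eq_or_lt with h | h
  · rw [← h]; norm_num
  · nlinarith

lemma ae_mem_Ioo : ∀ᵐ θ : ℝ, θ ∈ Set.uIoc 0 (2 * Real.pi) → θ ∈ Set.Ioo 0 (2 * Real.pi) := by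
  have h : ∀ᵐ θ : ℝ, θ ≠ 2 * Real.pi := by
    rw [MeasureTheory.ae_iff]
    simp
  filter_upwards [h] with θ h1 h2
  rw [Set.uIoc_of_le (by positivity)] at h2
  exact ⟨h2.1, lt_of_le_of_ne h2.2 h1⟩

/-- The mean value property up to the boundary, with a singularity at `1`. -/
lemma integral_circleMap_one {G : ℂ → ℂ} (hG : ∀ z, z.re < 1 → DifferentiableAt ℂ G z)
    (hb : ∀ z, ‖z‖ ≤ 1 → z.re < 1 → ‖G z‖ ≤ 2 * ‖(sig z)⁻¹‖ + 2) :
    ∫ θ in (0 : ℝ)..2 * Real.pi, G (circleMap 0 1 θ) = 2 * Real.pi * G 0 := by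
  have hlt : ∀ᶠ r : ℝ in nhdsWithin 1 (Set.Iio 1), 1 / 2 ≤ r ∧ r < 1 := by
    filter_upwards [Ioo_mem_nhdsLT (show (1 / 2 : ℝ) < 1 by norm_num)] with r hr
    exact ⟨hr.1.le, hr.2⟩
  have hre : ∀ r : ℝ, 0 ≤ r → r < 1 → ∀ θ, (circleMap 0 r θ).re < 1 := by
    intro r h0 h1 θ
    have := re_le_norm (circleMap 0 r θ)
    rw [norm_circleMap_zero, abs_of_nonneg h0] at this
    linarith
  have hlim := intervalIntegral.tendsto_integral_filter_of_dominated_convergence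
    (μ := MeasureTheory.volume) (a := 0) (b := 2 * Real.pi)
    (F := fun (r : ℝ) (θ : ℝ) => G (circleMap 0 r θ)) (f := fun θ => G (circleMap 0 1 θ))
    (l := nhdsWithin (1 : ℝ) (Set.Iio 1)) majorant
    (by
      filter_upwards [hlt] with r hr
      refine Continuous.aestronglyMeasurable ?_
      rw [continuous_iff_continuousAt]
      intro θ
      exact (hG _ (hre r (by linarith [hr.1]) hr.2 θ)).continuousAt.comp
        (continuous_circleMap 0 r).continuousAt)
    (by
      filter_upwards [hlt] with r hr
      filter_upwards [ae_mem_Ioo] with θ h1 h2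
      have h3 := h1 h2
      refine (hb _ ?_ (hre r (by linarith [hr.1]) hr.2 θ)).trans
        (norm_inv_sig_le hr.1 hr.2.le h3.1 h3.2)
      rw [norm_circleMap_zero, abs_of_nonneg (by linarith [hr.1])]
      exact hr.2.le)
    intervalIntegrable_majorant
    (by
      filter_upwards [ae_mem_Ioo] with θ h1 h2
      have h3 := h1 h2
      have h4 : Continuous fun r : ℝ => circleMap 0 r θ := by
        unfold circleMap
        fun_prop
      have h5 : Filter.Tendsto (fun r : ℝ => G (circleMap 0 r θ)) (nhds 1)
          (nhds (G (circleMap 0 1 θ))) :=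
        (hG _ (circleMap_re_lt zero_le_one le_rfl h3.1 h3.2)).continuousAt.tendsto.comp
          (h4.tendsto 1)
      exact h5.mono_left nhdsWithin_le_nhds)
  refine tendsto_nhds_unique hlim (tendsto_const_nhds.congr' ?_)
  filter_upwards [hlt] with r hr
  have hsub : ∀ z ∈ Metric.closedBall (0 : ℂ) |r|, DifferentiableAt ℂ G z := by
    intro z hz
    rw [mem_closedBall_zero_iff, abs_of_nonneg (by linarith [hr.1])] at hz
    exact hG z (by linarith [re_le_norm z])
  have := circleAverage_of_differentiable_on_off_countable (f := G) (c := 0) (R := r)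
    Set.countable_empty
    (fun z hz => (hsub z hz).continuousAt.continuousWithinAt)
    (fun z hz => hsub z (Metric.ball_subset_closedBall hz.1))
  rw [Real.circleAverage, inv_smul_eq_iff₀ (by positivity)] at this
  rw [this, real_smul]
  push_cast
  ring

lemma integral_inv_sig_mul_pow (k : ℕ) :
    ∫ θ in (0 : ℝ)..2 * Real.pi, (sig (circleMap 0 1 θ))⁻¹ * circleMap 0 1 θ ^ k =
      if k = 0 then 2 * (Real.pi : ℂ) else 0 := by
  rw [integral_circleMap_one (G := fun z => (sig z)⁻¹ * z ^ k)]
  · split_ifs with h <;> simp [h, sig_zero]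
  · intro z hz
    exact ((differentiableAt_sig hz).inv (sig_ne_zero hz)).mul (by fun_prop)
  · intro z hz hz1
    rw [norm_mul, norm_pow]
    have := pow_le_one₀ (n := k) (norm_nonneg z) hz
    nlinarith [norm_nonneg ((sig z)⁻¹)]

lemma integral_sig_mul_pow (k : ℕ) :
    ∫ θ in (0 : ℝ)..2 * Real.pi, sig (circleMap 0 1 θ) * circleMap 0 1 θ ^ k =
      if k = 0 then 2 * (Real.pi : ℂ) else 0 := by
  rw [integral_circleMap_one (G := fun z => sig z * z ^ k)]
  · split_ifs with h <;> simp [h, sig_zero]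
  · intro z hz
    exact (differentiableAt_sig hz).mul (by fun_prop)
  · intro z hz hz1
    rw [norm_mul, norm_pow]
    have := pow_le_one₀ (n := k) (norm_nonneg z) hz
    nlinarith [norm_nonneg ((sig z)⁻¹), norm_sig_le hz, norm_nonneg (sig z)]

lemma norm_one_add_kap_sub_le {z : ℂ} (hz : ‖z‖ ≤ 1) : ‖1 + (kap : ℂ) - kap * z‖ ≤ 2 := by
  obtain ⟨hk1, hk2⟩ := kap_bounds
  have h1 := norm_sub_le (1 + (kap : ℂ)) (kap * z)
  have h2 := norm_add_le (1 : ℂ) kap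
  rw [norm_mul, norm_real, Real.norm_of_nonneg hk1.le] at h1
  rw [norm_one, norm_real, Real.norm_of_nonneg hk1.le] at h2
  nlinarith [norm_nonneg z]

lemma integral_sig_quotient :
    ∫ θ in (0 : ℝ)..2 * Real.pi,
      (1 + (kap : ℂ) - kap * circleMap 0 1 θ) / (1 + sig (circleMap 0 1 θ)) =
      Real.pi * (1 + kap) := by
  rw [integral_circleMap_one (G := fun z => (1 + (kap : ℂ) - kap * z) / (1 + sig z))]
  · simp only [mul_zero, sub_zero, sig_zero]
    ring
  · intro z hz
    exact DifferentiableAt.div (by fun_prop) ((differentiableAt_sig hz).const_add 1)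
      (one_add_sig_ne_zero hz)
  · intro z hz hz1
    rw [norm_div]
    have h1 := one_le_norm_one_add_sig hz1
    have := div_le_self (norm_nonneg (1 + (kap : ℂ) - kap * z)) h1
    linarith [norm_nonneg ((sig z)⁻¹), norm_one_add_kap_sub_le hz]

lemma integral_inv_sig_quotient :
    ∫ θ in (0 : ℝ)..2 * Real.pi,
      (1 + (kap : ℂ) - kap * circleMap 0 1 θ) / (1 + sig (circleMap 0 1 θ)) *
        (sig (circleMap 0 1 θ))⁻¹ =
      Real.pi * (1 + kap) := by
  rw [integral_circleMap_one (G := fun z => (1 + (kap : ℂ) - kap * z) / (1 + sig z) * (sig z)⁻¹)]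
  · simp only [mul_zero, sub_zero, sig_zero]
    ring
  · intro z hz
    exact (DifferentiableAt.div (by fun_prop) ((differentiableAt_sig hz).const_add 1)
      (one_add_sig_ne_zero hz)).mul ((differentiableAt_sig hz).inv (sig_ne_zero hz))
  · intro z hz hz1
    rw [norm_mul, norm_div]
    have h1 := one_le_norm_one_add_sig hz1
    have h2 := div_le_self (norm_nonneg (1 + (kap : ℂ) - kap * z)) h1
    nlinarith [norm_nonneg ((sig z)⁻¹), norm_one_add_kap_sub_le hz]

lemma sig_mul_inv {z : ℂ} (hz : z.re < 1) (hz0 : z ≠ 0) :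
    sig z * z⁻¹ = z⁻¹ - (1 + (kap : ℂ) - kap * z) / (1 + sig z) := by
  have h1 := sig_sq z
  have h2 := one_add_sig_ne_zero hz
  field_simp
  linear_combination h1

lemma inv_sig_mul_inv {z : ℂ} (hz : z.re < 1) (hz0 : z ≠ 0) :
    (sig z)⁻¹ * z⁻¹ = z⁻¹ + (1 + (kap : ℂ) - kap * z) / (1 + sig z) * (sig z)⁻¹ := by
  have h1 := sig_sq z
  have h2 := one_add_sig_ne_zero hz
  have h3 := sig_ne_zero hz
  field_simp
  linear_combination -h1

end SquareRootSymbol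

end TrunkDegree

namespace TrunkDegree

open Finset Complex

section SlitHarmonicFunction

lemma intervalIntegrable_inv_sig :
    IntervalIntegrable (fun θ : ℝ => (sig (circleMap 0 1 θ))⁻¹) MeasureTheory.volume
      0 (2 * Real.pi) := by
  have hmeas : Measurable fun θ : ℝ => (sig (circleMap 0 1 θ))⁻¹ := by
    unfold sig circleMap
    fun_prop
  refine intervalIntegrable_majorant.mono_fun hmeas.aestronglyMeasurable ?_
  refine (MeasureTheory.ae_restrict_iff' measurableSet_uIoc).2 ?_
  filter_upwards [ae_mem_Ioo] with θ h1 h2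
  have h3 := h1 h2
  have h4 := norm_inv_sig_le (r := 1) (by norm_num) le_rfl h3.1 h3.2
  rw [Real.norm_eq_abs]
  linarith [le_abs_self (majorant θ), norm_nonneg ((sig (circleMap 0 1 θ))⁻¹)]

/-- The transverse decay rate at frequency `θ`. -/
noncomputable def decay (θ : ℝ) : ℝ :=
  2 - Real.cos θ - (√2 + 1) / 2 * ‖sig (circleMap 0 1 θ)‖ ^ 2

lemma norm_sub_circleMap_sq (c θ : ℝ) :
    ‖1 - c * circleMap 0 1 θ‖ ^ 2 = 1 + c ^ 2 - 2 * c * Real.cos θ := by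
  have h3 := Real.sin_sq_add_cos_sq θ
  rw [Complex.sq_norm, normSq_apply]
  have hre : (1 - c * circleMap 0 1 θ).re = 1 - c * Real.cos θ := by
    simp [circleMap, exp_re]
  have him : (1 - c * circleMap 0 1 θ).im = - (c * Real.sin θ) := by
    simp [circleMap, exp_im]
  rw [hre, him]
  linear_combination c ^ 2 * h3

lemma decay_gap_sq (θ : ℝ) :
    ((√2 + 1) / 2 * ‖sig (circleMap 0 1 θ)‖ ^ 2) ^ 2 =
      (1 - Real.cos θ) * (3 - Real.cos θ) := by
  have h1 := norm_sub_circleMap_sq 1 θ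
  have h2 := norm_sub_circleMap_sq kap θ
  have hs : √2 ^ 2 = 2 := Real.sq_sqrt (by norm_num)
  rw [ofReal_one, one_mul] at h1
  rw [norm_sig_sq, mul_pow, mul_pow, h1, h2]
  have h3 : ((√2 + 1) / 2) ^ 2 * kap = 1 / 4 := by
    unfold kap
    linear_combination (-√2 / 2 - 1 / 4) * hs
  have h4 : 1 + kap ^ 2 = 6 * kap := by
    unfold kap
    linear_combination 4 * hs
  rw [h4]
  linear_combination (2 - 2 * Real.cos θ) * (6 - 2 * Real.cos θ) * h3

lemma decay_nonneg (θ : ℝ) : 0 ≤ decay θ := by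
  have h := decay_gap_sq θ
  have hc := Real.cos_le_one θ
  unfold decay
  rw [sub_nonneg]
  exact abs_le_of_sq_le_sq' (by nlinarith) (by linarith) |>.2

lemma decay_le_one (θ : ℝ) : decay θ ≤ 1 := by
  have h := decay_gap_sq θ
  have hc := Real.cos_le_one θ
  have hs := Real.sqrt_nonneg 2
  unfold decay
  have : 1 - Real.cos θ ≤ (√2 + 1) / 2 * ‖sig (circleMap 0 1 θ)‖ ^ 2 :=
    abs_le_of_sq_le_sq' (by nlinarith) (by positivity) |>.2
  linarith

lemma decay_sq_add_one (θ : ℝ) : decay θ ^ 2 + 1 = (4 - 2 * Real.cos θ) * decay θ := by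
  have h := decay_gap_sq θ
  unfold decay
  linear_combination h

lemma continuous_decay : Continuous decay := by
  have : decay = fun θ => 2 - Real.cos θ - (√2 + 1) / 2 *
      (‖1 - circleMap 0 1 θ‖ * ‖1 - kap * circleMap 0 1 θ‖) := by
    funext θ
    rw [← norm_sig_sq, decay]
  rw [this]
  have := continuous_circleMap 0 1
  fun_prop

/-- The bounded multiplier of the Fourier representation at the lattice point `(x, y)`. -/
noncomputable def mode (x y : ℤ) (θ : ℝ) : ℂ :=
  (decay θ : ℂ) ^ y.natAbs * circleMap 0 1 θ ^ x

lemma continuous_mode (x y : ℤ) : Continuous (mode x y) := by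
  unfold mode
  have h1 := continuous_circleMap 0 1
  have h2 := continuous_ofReal.comp continuous_decay
  refine (h2.pow _).mul (h1.zpow₀ x fun θ => Or.inl (circleMap_ne_center one_ne_zero))

lemma norm_mode_le (x y : ℤ) (θ : ℝ) : ‖mode x y θ‖ ≤ 1 := by
  unfold mode
  rw [norm_mul, norm_pow, norm_zpow, norm_circleMap_zero, abs_one, one_zpow, mul_one,
    norm_real, Real.norm_of_nonneg (decay_nonneg θ)]
  exact pow_le_one₀ (decay_nonneg θ) (decay_le_one θ)

lemma intervalIntegrable_mode (x y : ℤ) :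
    IntervalIntegrable (fun θ : ℝ => (sig (circleMap 0 1 θ))⁻¹ * mode x y θ)
      MeasureTheory.volume 0 (2 * Real.pi) :=
  intervalIntegrable_inv_sig.mul_continuousOn (continuous_mode x y).continuousOn

/-- The bounded lattice function which is `1` at the origin, vanishes on the rest of the half
line `{(x, 0) : 0 ≤ x}`, and is harmonic off this half line. -/
noncomputable def slitHarm (x y : ℤ) : ℝ :=
  (2 * Real.pi)⁻¹ * (∫ θ in (0 : ℝ)..2 * Real.pi, (sig (circleMap 0 1 θ))⁻¹ * mode x y θ).re

lemma slitHarm_bounded : ∃ C : ℝ, 0 ≤ C ∧ ∀ x y, |slitHarm x y| ≤ C := by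
  refine ⟨(2 * Real.pi)⁻¹ * |∫ θ in (0 : ℝ)..2 * Real.pi, ‖(sig (circleMap 0 1 θ))⁻¹‖|,
    by positivity, fun x y => ?_⟩
  unfold slitHarm
  rw [abs_mul, abs_of_pos (by positivity : 0 < (2 * Real.pi)⁻¹)]
  refine mul_le_mul_of_nonneg_left ((abs_re_le_norm _).trans ?_) (by positivity)
  refine intervalIntegral.norm_integral_le_abs_of_norm_le
    (Filter.Eventually.of_forall fun θ => ?_) intervalIntegrable_inv_sig.norm
  rw [norm_mul]
  exact mul_le_of_le_one_right (norm_nonneg _) (norm_mode_le x y θ)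

lemma slitHarm_neg (x y : ℤ) : slitHarm x (-y) = slitHarm x y := by
  simp [slitHarm, mode]

lemma slitHarm_axis (k : ℕ) : slitHarm k 0 = if k = 0 then 1 else 0 := by
  have h := integral_inv_sig_mul_pow k
  have hpi := Real.pi_ne_zero
  simp only [slitHarm, mode, Int.natAbs_zero, pow_zero, one_mul, zpow_natCast, h]
  split_ifs
  · norm_cast
    field_simp
  · simp

lemma slitHarm_zero : slitHarm 0 0 = 1 := by
  simpa using slitHarm_axis 0

lemma slitHarm_slit {x : ℤ} (hx : 1 ≤ x) : slitHarm x 0 = 0 := by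
  lift x to ℕ using by omega
  rw [slitHarm_axis, if_neg (by omega)]

lemma integral_circleMap_inv :
    ∫ θ in (0 : ℝ)..2 * Real.pi, (circleMap 0 1 θ)⁻¹ = 0 := by
  have h : ∀ θ : ℝ, (circleMap 0 1 θ)⁻¹ = exp (-I * θ) := by
    intro θ
    simp only [circleMap, ofReal_one, one_mul, zero_add]
    rw [← exp_neg]
    ring_nf
  simp only [h]
  rw [integral_exp_mul_complex (by simp)]
  have : -I * ((2 * Real.pi : ℝ) : ℂ) = -(2 * Real.pi * I) := by
    push_cast
    ring
  rw [this, exp_neg, exp_two_pi_mul_I]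
  simp

lemma intervalIntegrable_circleMap_inv :
    IntervalIntegrable (fun θ : ℝ => (circleMap 0 1 θ)⁻¹) MeasureTheory.volume
      0 (2 * Real.pi) :=
  ((continuous_circleMap 0 1).inv₀ fun _ => circleMap_ne_center one_ne_zero).intervalIntegrable
    _ _

lemma slitHarm_neg_one : slitHarm (-1) 0 = 2 - √2 := by
  have hpi := Real.pi_ne_zero
  have h : ∫ θ in (0 : ℝ)..2 * Real.pi, (sig (circleMap 0 1 θ))⁻¹ * mode (-1) 0 θ =
      Real.pi * (1 + kap) := by
    have hsub := intervalIntegral.integral_sub (intervalIntegrable_mode (-1) 0)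
      intervalIntegrable_circleMap_inv
    rw [integral_circleMap_inv, sub_zero] at hsub
    rw [← hsub, ← integral_inv_sig_quotient]
    refine intervalIntegral.integral_congr_ae ?_
    filter_upwards [ae_mem_Ioo] with θ h1 h2
    have h3 := h1 h2
    have := inv_sig_mul_inv (circleMap_re_lt zero_le_one le_rfl h3.1 h3.2)
      (circleMap_ne_center (c := 0) one_ne_zero)
    simp only [mode, Int.natAbs_zero, pow_zero, one_mul, zpow_neg_one]
    linear_combination this
  rw [slitHarm, h]
  norm_cast
  unfold kap
  field_simp
  ring

lemma circleMap_add_inv (θ : ℝ) :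
    circleMap 0 1 θ + (circleMap 0 1 θ)⁻¹ = 2 * (Real.cos θ : ℂ) := by
  rw [ofReal_cos, Complex.cos, circleMap, ofReal_one, one_mul, zero_add, neg_mul, exp_neg]
  ring

lemma lap_slitHarm (x y : ℤ) :
    Lap slitHarm x y = (2 * Real.pi)⁻¹ * (∫ θ in (0 : ℝ)..2 * Real.pi,
      (sig (circleMap 0 1 θ))⁻¹ * circleMap 0 1 θ ^ x *
        ((4 - 2 * Real.cos θ) * (decay θ) ^ y.natAbs - (decay θ) ^ (y + 1).natAbs -
          (decay θ) ^ (y - 1).natAbs : ℝ)).re := by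
  simp only [Lap, slitHarm]
  have : ∀ θ : ℝ, (sig (circleMap 0 1 θ))⁻¹ * circleMap 0 1 θ ^ x *
        (((4 - 2 * Real.cos θ) * (decay θ) ^ y.natAbs - (decay θ) ^ (y + 1).natAbs -
          (decay θ) ^ (y - 1).natAbs : ℝ) : ℂ) =
      ((4 : ℝ) : ℂ) * ((sig (circleMap 0 1 θ))⁻¹ * mode x y θ) -
        (sig (circleMap 0 1 θ))⁻¹ * mode (x + 1) y θ -
        (sig (circleMap 0 1 θ))⁻¹ * mode (x - 1) y θ -
        (sig (circleMap 0 1 θ))⁻¹ * mode x (y + 1) θ -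
        (sig (circleMap 0 1 θ))⁻¹ * mode x (y - 1) θ := by
    intro θ
    have h0 : circleMap 0 1 θ ≠ 0 := circleMap_ne_center one_ne_zero
    have h1 := circleMap_add_inv θ
    push_cast at h1
    simp only [mode]
    rw [zpow_add₀ h0, zpow_sub₀ h0, zpow_one, div_eq_mul_inv]
    push_cast
    linear_combination ((sig (circleMap 0 1 θ))⁻¹ * circleMap 0 1 θ ^ x *
      (decay θ : ℂ) ^ y.natAbs) * h1
  have i := intervalIntegrable_mode
  simp only [this]
  rw [intervalIntegral.integral_sub (((((i x y).const_mul ((4 : ℝ) : ℂ)).sub (i (x + 1) y)).sub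
      (i (x - 1) y)).sub (i x (y + 1))) (i x (y - 1)),
    intervalIntegral.integral_sub ((((i x y).const_mul ((4 : ℝ) : ℂ)).sub (i (x + 1) y)).sub
      (i (x - 1) y)) (i x (y + 1)),
    intervalIntegral.integral_sub (((i x y).const_mul ((4 : ℝ) : ℂ)).sub (i (x + 1) y)) (i (x - 1) y),
    intervalIntegral.integral_sub ((i x y).const_mul ((4 : ℝ) : ℂ)) (i (x + 1) y),
    intervalIntegral.integral_const_mul]
  simp only [sub_re, re_ofReal_mul]
  ring

lemma lap_slitHarm_of_ne_zero (x : ℤ) {y : ℤ} (hy : y ≠ 0) : Lap slitHarm x y = 0 := by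
  rw [lap_slitHarm]
  have : ∀ θ : ℝ, (4 - 2 * Real.cos θ) * (decay θ) ^ y.natAbs - (decay θ) ^ (y + 1).natAbs -
      (decay θ) ^ (y - 1).natAbs = 0 := by
    intro θ
    have h := decay_sq_add_one θ
    rcases lt_or_gt_of_ne hy with h0 | h0
    · obtain ⟨k, hk⟩ : ∃ k : ℕ, y = -(k + 1) := ⟨(-y - 1).toNat, by omega⟩
      rw [show y.natAbs = k + 1 by omega, show (y + 1).natAbs = k by omega,
        show (y - 1).natAbs = k + 2 by omega]
      linear_combination -(decay θ) ^ k * h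
    · obtain ⟨k, hk⟩ : ∃ k : ℕ, y = k + 1 := ⟨(y - 1).toNat, by omega⟩
      rw [show y.natAbs = k + 1 by omega, show (y + 1).natAbs = k + 2 by omega,
        show (y - 1).natAbs = k by omega]
      linear_combination -(decay θ) ^ k * h
  simp [this]

lemma lap_slitHarm_axis (x : ℤ) :
    Lap slitHarm x 0 = (2 * Real.pi)⁻¹ * ((√2 + 1) * (∫ θ in (0 : ℝ)..2 * Real.pi,
      sig (circleMap 0 1 θ) * circleMap 0 1 θ ^ (-x)).re) := by
  have h : ∫ θ in (0 : ℝ)..2 * Real.pi, (sig (circleMap 0 1 θ))⁻¹ * circleMap 0 1 θ ^ x *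
        ((4 - 2 * Real.cos θ) * (decay θ) ^ (0 : ℤ).natAbs - (decay θ) ^ (0 + 1 : ℤ).natAbs -
          (decay θ) ^ (0 - 1 : ℤ).natAbs : ℝ) =
      ∫ θ in (0 : ℝ)..2 * Real.pi, ((√2 + 1 : ℝ) : ℂ) * (starRingEnd ℂ)
        (sig (circleMap 0 1 θ) * circleMap 0 1 θ ^ (-x)) := by
    refine intervalIntegral.integral_congr_ae ?_
    filter_upwards [ae_mem_Ioo] with θ h1 h2
    have h3 := h1 h2
    have hs := sig_ne_zero (circleMap_re_lt zero_le_one le_rfl h3.1 h3.2)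
    have hc : (starRingEnd ℂ) (circleMap 0 1 θ) = (circleMap 0 1 θ)⁻¹ := by
      rw [inv_def, normSq_eq_norm_sq, norm_circleMap_zero]
      simp
    have hn : (4 - 2 * Real.cos θ) * (decay θ) ^ (0 : ℤ).natAbs -
        (decay θ) ^ (0 + 1 : ℤ).natAbs - (decay θ) ^ (0 - 1 : ℤ).natAbs =
        (√2 + 1) * ‖sig (circleMap 0 1 θ)‖ ^ 2 := by
      simp [decay]
      ring
    rw [hn, map_mul, map_zpow₀, hc, inv_zpow', neg_neg, ofReal_mul, ofReal_pow, ← mul_conj']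
    field_simp
  rw [lap_slitHarm, h, intervalIntegral.integral_const_mul, re_ofReal_mul,
    intervalIntegral.intervalIntegral_conj, conj_re]

lemma lap_slitHarm_of_neg {x : ℤ} (hx : x ≤ 0) :
    Lap slitHarm x 0 = if x = 0 then √2 + 1 else 0 := by
  have hpi := Real.pi_ne_zero
  obtain ⟨k, rfl⟩ : ∃ k : ℕ, x = -k := ⟨(-x).toNat, by omega⟩
  rw [lap_slitHarm_axis]
  simp only [neg_neg, zpow_natCast, integral_sig_mul_pow, neg_eq_zero, Nat.cast_eq_zero]
  split_ifs
  · norm_cast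
    field_simp
  · simp

lemma lap_slitHarm_one : Lap slitHarm 1 0 = -√2 := by
  have hpi := Real.pi_ne_zero
  have hsig : IntervalIntegrable (fun θ : ℝ => sig (circleMap 0 1 θ) * (circleMap 0 1 θ)⁻¹)
      MeasureTheory.volume 0 (2 * Real.pi) := by
    have h0 : IntervalIntegrable (fun _ : ℝ => (2 : ℝ)) MeasureTheory.volume 0 (2 * Real.pi) :=
      intervalIntegrable_const
    have hmeas : Measurable fun θ : ℝ => sig (circleMap 0 1 θ) * (circleMap 0 1 θ)⁻¹ := by
      unfold sig circleMap
      fun_prop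
    refine h0.mono_fun hmeas.aestronglyMeasurable (Filter.Eventually.of_forall fun θ => ?_)
    have h1 := norm_sig_le (z := circleMap 0 1 θ) (by simp)
    simpa using h1
  have h : ∫ θ in (0 : ℝ)..2 * Real.pi, sig (circleMap 0 1 θ) * circleMap 0 1 θ ^ (-1 : ℤ) =
      -(Real.pi * (1 + kap)) := by
    have hsub := intervalIntegral.integral_sub hsig intervalIntegrable_circleMap_inv
    rw [integral_circleMap_inv, sub_zero] at hsub
    simp only [zpow_neg_one]
    rw [← hsub, ← integral_sig_quotient, ← intervalIntegral.integral_neg]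
    refine intervalIntegral.integral_congr_ae ?_
    filter_upwards [ae_mem_Ioo] with θ h1 h2
    have h3 := h1 h2
    have := sig_mul_inv (circleMap_re_lt zero_le_one le_rfl h3.1 h3.2)
      (circleMap_ne_center (c := 0) one_ne_zero)
    linear_combination this
  have hs : √2 ^ 2 = 2 := Real.sq_sqrt (by norm_num)
  rw [lap_slitHarm_axis, h]
  norm_cast
  unfold kap
  field_simp
  linear_combination 2 * hs

lemma lap_slitHarm_eq_zero {x y : ℤ} (h : ¬(y = 0 ∧ 0 ≤ x)) : Lap slitHarm x y = 0 := by
  by_cases hy : y = 0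
  · subst hy
    rw [lap_slitHarm_of_neg (by omega), if_neg (by omega)]
  · exact lap_slitHarm_of_ne_zero x hy

lemma slitHarm_zero_one : slitHarm 0 1 = 1 / 2 := by
  have h := lap_slitHarm_of_neg le_rfl
  have h1 := slitHarm_neg 0 1
  simp only [Lap, if_pos, zero_add, zero_sub] at h
  rw [slitHarm_zero, slitHarm_neg_one, slitHarm_slit le_rfl, h1] at h
  linarith

lemma slitHarm_one_one : slitHarm 1 1 = (√2 - 1) / 2 := by
  have h := lap_slitHarm_one
  have h1 := slitHarm_neg 1 1
  simp only [Lap, zero_add, zero_sub, sub_self] at h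
  rw [slitHarm_zero, slitHarm_slit (by norm_num), slitHarm_slit (by norm_num), h1] at h
  linarith

end SlitHarmonicFunction

end TrunkDegree

namespace TrunkDegree

open Finset

section Limits

lemma exists_abs_tipHit_sub_le : ∃ C : ℝ, ∀ (l r : ℤ) (h : ℕ) (m : ℤ), 6 ≤ m → m ≤ l → m ≤ r →
    m ≤ h → ∀ x y : ℤ, |x| < m → |y| < m →
    |tipHit l r h x y - slitHarm x y| ≤ C / Real.log m * Real.log (barrier x y) := by
  obtain ⟨C, hC0, hC⟩ := slitHarm_bounded
  refine ⟨1 + C, fun l r h m hm hl hr hh x y hx hy => ?_⟩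
  have hspec := tipHit_spec l r h
  refine abs_le_of_slit (u := fun x y => tipHit l r h x y - slitHarm x y) hm (by linarith)
    ?_ ?_ ?_ hx hy
  · intro x hx
    simp only [tipHit_slit hx, slitHarm_slit hx, sub_self]
  · intro x y hx hy
    rw [abs_lt] at hx hy
    by_cases hs : y = 0 ∧ 0 ≤ x
    · left
      obtain ⟨rfl, h0⟩ := hs
      rcases h0.eq_or_lt with rfl | h1
      · rw [tipHit_tip, slitHarm_zero, sub_self]
      · rw [tipHit_slit (by omega), slitHarm_slit (by omega), sub_self]
    · right
      rw [lap_sub, hspec.harmonic x y (by omega) (by omega) (abs_le.2 ⟨by omega, by omega⟩) hs,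
        lap_slitHarm_eq_zero hs, sub_zero]
  · intro x y _ _ _
    refine (abs_sub _ _).trans (add_le_add ?_ (hC x y))
    rw [abs_of_nonneg (tipHit_nonneg ..)]
    exact tipHit_le_one ..

lemma exists_abs_leftHit_sub_le : ∃ C : ℝ, ∀ (l r : ℤ) (h : ℕ) (m : ℤ), 6 ≤ m → 2 * m ≤ l →
    2 * m ≤ r → 2 * m ≤ h → l + 2 ≤ 4 * (m - 1) → ∀ x y : ℤ, |x| < m → |y| < m →
    |(leftHit l r h (x - 1) y - leftHit l r h x y) / leftHit l r h 0 0 - slitHarm (x - 1) y| ≤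
      C / Real.log m * Real.log (barrier x y) := by
  obtain ⟨C, hC0, hC⟩ := slitHarm_bounded
  refine ⟨8 + C, fun l r h m hm hl hr hh hlm x y hx hy => ?_⟩
  have hspec := leftHit_spec l r h
  set f := leftHit l r h
  have hf0 : 1 / ((l : ℝ) + 2) ≤ f 0 0 := leftHit_lower (by omega) (by omega) h
  have hl' : (0 : ℝ) < l := by exact_mod_cast (by omega : 0 < l)
  have hm' : (6 : ℝ) ≤ m := by exact_mod_cast hm
  have hpos : 0 < f 0 0 := lt_of_lt_of_le (by positivity) hf0
  have hslit : ∀ x, 1 ≤ x → f x 0 = 0 := fun x hx => leftHit_slit (by omega) hx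
  have hbound : 2 / ((m - 1 : ℤ) : ℝ) ≤ 8 * f 0 0 := by
    have h1 : (l : ℝ) + 2 ≤ 4 * (m - 1) := by exact_mod_cast hlm
    push_cast
    have h2 : (1 : ℝ) ≤ f 0 0 * (l + 2) := by
      rw [div_le_iff₀ (by linarith)] at hf0
      exact hf0
    rw [div_le_iff₀ (by linarith)]
    nlinarith
  have key := abs_le_of_slit (m := m) (M := (8 + C) * f 0 0)
    (u := fun x y => f (x - 1) y - f x y - f 0 0 * slitHarm (x - 1) y) hm (by positivity)
    ?_ ?_ ?_ hx hy
  · have : (f (x - 1) y - f x y) / f 0 0 - slitHarm (x - 1) y =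
        (f (x - 1) y - f x y - f 0 0 * slitHarm (x - 1) y) / f 0 0 := by
      field_simp
    rw [this, abs_div, abs_of_pos hpos, div_le_iff₀ hpos]
    refine key.trans (le_of_eq ?_)
    ring
  · intro x hx
    simp only [hslit x hx, sub_zero]
    rcases hx.eq_or_lt with rfl | h1
    · rw [sub_self, slitHarm_zero, mul_one, sub_self]
    · rw [hslit _ (by omega), slitHarm_slit (by omega), mul_zero, sub_zero]
  · intro x y hx hy
    rw [abs_lt] at hx hy
    by_cases hs : y = 0 ∧ 1 ≤ x
    · left
      obtain ⟨rfl, h1⟩ := hs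
      simp only [hslit x h1, sub_zero]
      rcases h1.eq_or_lt with rfl | h1
      · rw [sub_self, slitHarm_zero, mul_one, sub_self]
      · rw [hslit _ (by omega), slitHarm_slit (by omega), mul_zero, sub_zero]
    · right
      have hy' : |y| ≤ h := abs_le.2 ⟨by omega, by omega⟩
      have e1 := lap_shift f (-1) x y
      have e2 := lap_shift slitHarm (-1) x y
      simp only [← sub_eq_add_neg] at e1 e2
      rw [hspec.harmonic (x - 1) y (by omega) (by omega) hy' (by omega)] at e1
      rw [lap_slitHarm_eq_zero (by omega)] at e2
      have e3 := hspec.harmonic x y (by omega) (by omega) hy' hs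
      simp only [Lap] at e1 e2 e3 ⊢
      linear_combination e1 - e3 - f 0 0 * e2
  · intro x y hx hy hxy
    have h1 : |f (x - 1) y - f x y| ≤ 2 / ((m - 1 : ℤ) : ℝ) := by
      refine abs_sub_le_of_reflection (by omega) (leftHit_nonneg l r h) (leftHit_le_one l r h) ?_
      intro x' y' hx1 hx2 hy1
      rw [abs_lt] at hy1
      rw [abs_le] at hx hy
      by_cases hs : y' = 0 ∧ 1 ≤ 2 * x - 1 - x'
      · left
        rw [hs.1, hslit _ hs.2, hslit _ (by omega)]
      · right
        have hy' : |y'| ≤ h := abs_le.2 ⟨by omega, by omega⟩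
        have : ¬(y' = 0 ∧ 1 ≤ x') := by
          rcases abs_choice x with e | e <;> rcases abs_choice y with e' | e' <;>
            rw [e, e'] at hxy <;> omega
        exact ⟨hspec.harmonic _ _ (by omega) (by omega) hy' this,
          hspec.harmonic _ _ (by omega) (by omega) hy' hs⟩
    have h2 := hC (x - 1) y
    calc |f (x - 1) y - f x y - f 0 0 * slitHarm (x - 1) y|
        ≤ |f (x - 1) y - f x y| + |f 0 0 * slitHarm (x - 1) y| := abs_sub _ _
      _ ≤ 8 * f 0 0 + f 0 0 * C := by
          rw [abs_mul, abs_of_pos hpos]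
          exact add_le_add (h1.trans hbound) (mul_le_mul_of_nonneg_left h2 hpos.le)
      _ = (8 + C) * f 0 0 := by ring

lemma tendsto_of_abs_sub_le_log {u : ℕ → ℝ} {m : ℕ → ℤ} {a C B : ℝ}
    (hm : Filter.Tendsto m Filter.atTop Filter.atTop)
    (h : ∀ᶠ n in Filter.atTop, |u n - a| ≤ C / Real.log (m n) * B) :
    Filter.Tendsto u Filter.atTop (nhds a) := by
  have hlog : Filter.Tendsto (fun n => Real.log (m n)) Filter.atTop Filter.atTop :=
    Real.tendsto_log_atTop.comp (tendsto_intCast_atTop_atTop.comp hm)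
  have h0 := (Filter.Tendsto.const_div_atTop hlog C).mul_const B
  rw [zero_mul] at h0
  rw [tendsto_iff_dist_tendsto_zero]
  refine squeeze_zero' (Filter.Eventually.of_forall fun _ => dist_nonneg) ?_ h0
  simpa only [Real.dist_eq] using h

lemma tendsto_half_sub_abs (δ : ℤ) :
    Filter.Tendsto (fun n : ℕ => (n : ℤ) / 2 - |δ|) Filter.atTop Filter.atTop := by
  rw [Filter.tendsto_atTop]
  intro b
  filter_upwards [Filter.eventually_ge_atTop (2 * (|b| + |δ| + 1)).toNat] with n hn
  have := le_abs_self b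
  have := abs_nonneg δ
  omega

lemma tipHit_tendsto (δ x y : ℤ) :
    Filter.Tendsto (fun n : ℕ => tipHit (n + δ) (n - δ) n x y) Filter.atTop
      (nhds (slitHarm x y)) := by
  obtain ⟨C, hC⟩ := exists_abs_tipHit_sub_le
  refine tendsto_of_abs_sub_le_log (tendsto_half_sub_abs δ) (C := C)
    (B := Real.log (barrier x y)) ?_
  filter_upwards [Filter.eventually_ge_atTop (20 + 20 * (|δ| + |x| + |y|)).toNat] with n hn
  have := abs_nonneg δ
  have := le_abs_self δ
  have := neg_abs_le δ
  have := abs_nonneg x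
  have := abs_nonneg y
  apply hC <;> omega

lemma leftHit_diff_tendsto (δ x y : ℤ) :
    Filter.Tendsto (fun n : ℕ => (leftHit (n + δ) (n - δ) n (x - 1) y -
      leftHit (n + δ) (n - δ) n x y) / leftHit (n + δ) (n - δ) n 0 0) Filter.atTop
      (nhds (slitHarm (x - 1) y)) := by
  obtain ⟨C, hC⟩ := exists_abs_leftHit_sub_le
  refine tendsto_of_abs_sub_le_log (tendsto_half_sub_abs δ) (C := C)
    (B := Real.log (barrier x y)) ?_
  filter_upwards [Filter.eventually_ge_atTop (20 + 20 * (|δ| + |x| + |y|)).toNat] with n hn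
  have := abs_nonneg δ
  have := le_abs_self δ
  have := neg_abs_le δ
  have := abs_nonneg x
  have := abs_nonneg y
  apply hC <;> omega

lemma leftHit_tip_pos {l r : ℤ} (hl : 0 ≤ l) (hr : 0 ≤ r) (h : ℕ) : 0 < leftHit l r h 0 0 := by
  have : (0 : ℝ) ≤ l := by exact_mod_cast hl
  exact lt_of_lt_of_le (by positivity) (leftHit_lower hl hr h)

lemma leftHit_west_tendsto (δ : ℤ) :
    Filter.Tendsto (fun n : ℕ => leftHit (n + δ) (n - δ) n (-1) 0 /
      leftHit (n + δ) (n - δ) n 0 0) Filter.atTop (nhds (3 - √2)) := by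
  have h := (leftHit_diff_tendsto δ 0 0).add_const 1
  rw [zero_sub, slitHarm_neg_one, show 2 - √2 + 1 = 3 - √2 by ring] at h
  refine h.congr' ?_
  filter_upwards [Filter.eventually_ge_atTop (|δ|).toNat] with n hn
  have := le_abs_self δ
  have := neg_abs_le δ
  have hpos := leftHit_tip_pos (l := n + δ) (r := n - δ) (by omega) (by omega) n
  field_simp
  ring

lemma leftHit_north_tendsto (δ : ℤ) :
    Filter.Tendsto (fun n : ℕ => leftHit (n + δ) (n - δ) n 0 1 /
      leftHit (n + δ) (n - δ) n 0 0) Filter.atTop (nhds ((1 + √2) / 2)) := by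
  have h := ((leftHit_west_tendsto δ).const_sub 4).div_const 2
  rw [show (4 - (3 - √2)) / 2 = (1 + √2) / 2 by ring] at h
  refine h.congr' ?_
  filter_upwards [Filter.eventually_ge_atTop (|δ|).toNat] with n hn
  have := le_abs_self δ
  have := neg_abs_le δ
  have hpos := leftHit_tip_pos (l := n + δ) (r := n - δ) (by omega) (by omega) n
  have h1 := (leftHit_spec (n + δ) (n - δ) n).harmonic 0 0 (by omega) (by omega)
    (by simp) (by omega)
  have h2 := leftHit_neg (n + δ) (n - δ) n 0 1
  have h3 := leftHit_slit (l := n + δ) (r := n - δ) (h := n) (by omega) (le_refl 1)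
  simp only [Lap, zero_add, zero_sub] at h1
  rw [h2, h3] at h1
  field_simp
  linarith

lemma leftHit_corner_tendsto (δ : ℤ) :
    Filter.Tendsto (fun n : ℕ => leftHit (n + δ) (n - δ) n 1 1 /
      leftHit (n + δ) (n - δ) n 0 0) Filter.atTop (nhds (√2 / 2)) := by
  have h := (leftHit_north_tendsto δ).sub (leftHit_diff_tendsto δ 1 1)
  rw [sub_self, slitHarm_zero_one, show (1 + √2) / 2 - 1 / 2 = √2 / 2 by ring] at h
  refine h.congr fun n => ?_
  ring

end Limits

end TrunkDegree

namespace TrunkDegree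

open Finset

section Sectors

/-- The identity, or the reflection exchanging the columns `0` and `1`. -/
def foldCol (s : Bool) (x : ℤ) : ℤ := bif s then 1 - x else x

/-- The sign on the slit double cover. -/
noncomputable def sheet (k y : ℤ) : ℝ := if 1 ≤ k ∧ y < 0 then -1 else 1

/-- The extension to the double cover which is even across the half line `x ≤ 0` and odd across
the half line `1 ≤ x`, in the coordinate `foldCol s x`. -/
noncomputable def sector (s : Bool) (w : ℤ → ℤ → ℝ) (x y : ℤ) : ℝ :=
  sheet (foldCol s x) y * w (foldCol s x) y

/-- The function on the sites and the roots induced by a lattice function. -/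
noncomputable def siteLift (n : ℕ) (W : ℤ → ℤ → ℝ) : Site n ⊕ Bool → ℝ :=
  Sum.elim (fun v => W v.1.1 v.1.2) fun β => W ((bif β then 1 else -1) * ((n : ℤ) + 1)) 0

lemma siteLift_step {n : ℕ} {W : ℤ → ℤ → ℝ}
    (hcol : ∀ (β : Bool) (y : ℤ), |y| ≤ n → W ((bif β then 1 else -1) * ((n : ℤ) + 1)) y =
      W ((bif β then 1 else -1) * ((n : ℤ) + 1)) 0) {v : Site n} {d : Fin 4} (hall : Allowed v d) :
    siteLift n W (step v d) = W (v.1.1 + (dir d).1) (v.1.2 + (dir d).2) := by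
  rcases h : step v d with w | β
  · simp [siteLift, step_eq_inl h]
  · obtain ⟨h1, h2⟩ := step_eq_inr hall h
    rw [Prod.fst_add] at h1
    rw [h1]
    exact (hcol β _ (abs_le.2 hall.1)).symm

lemma mulVec_siteLift {n : ℕ} {W : ℤ → ℤ → ℝ}
    (hcol : ∀ (β : Bool) (y : ℤ), |y| ≤ n → W ((bif β then 1 else -1) * ((n : ℤ) + 1)) y =
      W ((bif β then 1 else -1) * ((n : ℤ) + 1)) 0) (a b v : Site n) :
    (gridMatrix a b 1).mulVec (siteLift n W) (Sum.inl v) =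
      ∑ d, if Allowed v d then W v.1.1 v.1.2 - zipperSign v.1 d *
        W (v.1.1 + (dir d).1) (v.1.2 + (dir d).2) else 0 := by
  rw [gridMatrix_mulVec_inl]
  refine sum_congr rfl fun d _ => ?_
  unfold stepWeight
  split_ifs with h1
  · rw [siteLift_step hcol h1, one_mul]
    rfl
  · rw [siteLift_step hcol h1, one_mul]
    rfl
  · rw [zero_mul]

/-- The lattice functions inducing solutions of the linear system: even, reflected at the top and
the bottom, constant on the left, and zero on the right and on the slit. -/
structure IsSlitFun (n : ℕ) (s : Bool) (w : ℤ → ℤ → ℝ) : Prop where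
  clamped : ∀ x y, w x y = w x (clamp n y)
  even : ∀ x y, w x (-y) = w x y
  slit : ∀ x, 0 ≤ x → w x 0 = 0
  right : ∀ y : ℤ, |y| ≤ n → w (bif s then n + 2 else n + 1) y = 0
  left : ∀ y : ℤ, |y| ≤ n → w (bif s then -n else -n - 1) y = w (bif s then -n else -n - 1) 0

lemma IsSlitFun.sector_column {n : ℕ} (hn : 1 ≤ n) {s : Bool} {w : ℤ → ℤ → ℝ}
    (hw : IsSlitFun n s w) (β : Bool) (y : ℤ) (hy : |y| ≤ n) :
    sector s w ((bif β then 1 else -1) * ((n : ℤ) + 1)) y =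
      sector s w ((bif β then 1 else -1) * ((n : ℤ) + 1)) 0 := by
  have h1 := hw.right y hy
  have h2 := hw.right 0 (by simp)
  have h3 := hw.left y hy
  have e1 : (1 : ℤ) - (n + 1) = -n := by ring
  have e2 : (1 : ℤ) - -(n + 1) = n + 2 := by ring
  have e3 : -((n : ℤ) + 1) = -n - 1 := by ring
  cases s <;> cases β <;>
    simp only [sector, foldCol, cond_true, cond_false, one_mul, neg_one_mul, e1, e2] at h1 h2 h3 ⊢
  · rw [e3, h3, sheet, sheet, if_neg (by omega), if_neg (by omega)]
  · rw [h1, h2, mul_zero, mul_zero]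
  · rw [h1, h2, mul_zero, mul_zero]
  · rw [h3, sheet, sheet, if_neg (by omega), if_neg (by omega)]

lemma IsSlitFun.mulVec_of_slit {n : ℕ} (hn : 1 ≤ n) {s : Bool} {w : ℤ → ℤ → ℝ}
    (hw : IsSlitFun n s w) (a b : Site n) {v : Site n} (hv : v.1.2 = 0)
    (hx : 1 ≤ foldCol s v.1.1) :
    (gridMatrix a b 1).mulVec (siteLift n (sector s w)) (Sum.inl v) = 0 := by
  rw [mulVec_siteLift (hw.sector_column hn)]
  obtain ⟨⟨x, y⟩, hp⟩ := v
  obtain rfl : y = 0 := hv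
  have h0 : ∀ x', 0 ≤ foldCol s x' → sector s w x' 0 = 0 := by
    intro x' h
    rw [sector, hw.slit _ h, mul_zero]
  have hodd : sector s w x (-1) = - sector s w x 1 := by
    have := hw.even (foldCol s x) 1
    dsimp only at hx
    rw [sector, sector, this, sheet, sheet, if_pos (by omega), if_neg (by omega)]
    simp
  have hcol : 0 ≤ foldCol s x ∧ 0 ≤ foldCol s (x + 1) ∧ 0 ≤ foldCol s (x - 1) := by
    cases s <;> simp only [foldCol, cond_true, cond_false] at hx ⊢ <;> omega
  have e1 : (x : ℤ) + -1 = x - 1 := rfl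
  simp [Fin.sum_univ_four, dir, Allowed, zipperSign, e1, h0 _ hcol.1, h0 _ hcol.2.1,
    h0 _ hcol.2.2, hodd, hn]

lemma zipperSign_mul_sector {s : Bool} {w : ℤ → ℤ → ℝ} (hslit : ∀ x, 0 ≤ x → w x 0 = 0)
    {x y : ℤ} (hxy : ¬ (y = 0 ∧ 1 ≤ foldCol s x)) (d : Fin 4) :
    zipperSign (x, y) d * sector s w (x + (dir d).1) (y + (dir d).2) =
      sheet (foldCol s x) y *
        w (foldCol s (x + (dir d).1)) (y + (dir d).2) := by
  by_cases hs : y + (dir d).2 = 0 ∧ 0 ≤ foldCol s (x + (dir d).1)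
  · rw [sector, hs.1, hslit _ hs.2]
    simp
  rw [sector, ← mul_assoc]
  congr 1
  cases s <;> fin_cases d <;>
    simp only [zipperSign, dir, foldCol, cond_true, cond_false] at hxy hs ⊢ <;>
    simp [sheet] at hxy hs ⊢ <;> split_ifs <;> first | omega | norm_num

lemma IsSlitFun.mulVec_of_not_slit {n : ℕ} (hn : 1 ≤ n) {s : Bool} {w : ℤ → ℤ → ℝ}
    (hw : IsSlitFun n s w) (a b : Site n) {v : Site n}
    (hv : ¬ (v.1.2 = 0 ∧ 1 ≤ foldCol s v.1.1)) :
    (gridMatrix a b 1).mulVec (siteLift n (sector s w)) (Sum.inl v) =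
      sheet (foldCol s v.1.1) v.1.2 * Lap w (foldCol s v.1.1) v.1.2 := by
  have hb := mem_boxPoints.1 v.2
  rw [mulVec_siteLift (hw.sector_column hn)]
  have hstay : ∀ d, ¬ Allowed v d → w (foldCol s v.1.1) v.1.2 =
      w (foldCol s (v.1.1 + (dir d).1)) (v.1.2 + (dir d).2) := by
    intro d hall
    unfold Allowed at hall
    obtain ⟨⟨x, y⟩, hp⟩ := v
    obtain ⟨-, -, hy1, hy2⟩ := hb
    by_cases hout : -(n : ℤ) ≤ y + (dir d).2 ∧ y + (dir d).2 ≤ n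
    · have h0 : w 0 0 = 0 := hw.slit 0 le_rfl
      have h1 : w 1 0 = 0 := hw.slit 1 zero_le_one
      by_cases hv : (x, y) = (0, 0) ∧ d = 0
      · obtain ⟨hp, rfl⟩ := hv
        obtain ⟨rfl, rfl⟩ := Prod.ext_iff.1 hp
        cases s <;> simp [foldCol, dir, h0, h1]
      · have hv' : (x, y) = (1, 0) ∧ d = 2 := by tauto
        obtain ⟨hp, rfl⟩ := hv'
        obtain ⟨rfl, rfl⟩ := Prod.ext_iff.1 hp
        cases s <;> simp [foldCol, dir, h0, h1]
    · rw [hw.clamped, hw.clamped _ (y + _)]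
      fin_cases d <;> simp [dir] at hout hy1 hy2 ⊢
      · omega
      · congr 1
        unfold clamp
        omega
      · omega
      · congr 1
        unfold clamp
        omega
  have h1 : ∀ d, (if Allowed v d then sector s w v.1.1 v.1.2 - zipperSign v.1 d *
        sector s w (v.1.1 + (dir d).1) (v.1.2 + (dir d).2) else 0) =
      sheet (foldCol s v.1.1) v.1.2 *
        (w (foldCol s v.1.1) v.1.2 - w (foldCol s (v.1.1 + (dir d).1)) (v.1.2 + (dir d).2)) := by
    intro d
    split_ifs with hall
    · rw [zipperSign_mul_sector hw.slit hv, sector, mul_sub]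
    · rw [hstay d hall, sub_self, mul_zero]
  rw [sum_congr rfl fun d _ => h1 d, ← mul_sum]
  congr 1
  obtain ⟨⟨x, y⟩, hp⟩ := v
  cases s
  · simp [Fin.sum_univ_four, dir, foldCol, Lap]
    ring_nf
  · simp [Fin.sum_univ_four, dir, foldCol, Lap]
    ring_nf

end Sectors

end TrunkDegree

namespace TrunkDegree

open Finset

section Solutions

/-- The tip hitting probability of the shifted box of size `n`. -/
noncomputable def tip (δ : ℤ) (n : ℕ) : ℤ → ℤ → ℝ := tipHit (n + δ) (n - δ) n

/-- The left side hitting probability of the shifted box of size `n`. -/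
noncomputable def lef (δ : ℤ) (n : ℕ) : ℤ → ℤ → ℝ := leftHit (n + δ) (n - δ) n

/-- The tip hitting probability with its value at the tip replaced by `0`. -/
noncomputable def punct (δ : ℤ) (n : ℕ) (x y : ℤ) : ℝ := if x = 0 ∧ y = 0 then 0 else tip δ n x y

lemma tip_neg (δ : ℤ) (n : ℕ) (x y : ℤ) : tip δ n x (-y) = tip δ n x y := tipHit_neg ..

lemma lef_neg (δ : ℤ) (n : ℕ) (x y : ℤ) : lef δ n x (-y) = lef δ n x y := leftHit_neg ..

lemma punct_neg (δ : ℤ) (n : ℕ) (x y : ℤ) : punct δ n x (-y) = punct δ n x y := by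
  simp [punct, tip_neg]

lemma tip_clamp (δ : ℤ) (n : ℕ) (x y : ℤ) : tip δ n x y = tip δ n x (clamp n y) :=
  (tipHit_spec ..).clamped x y

lemma lef_clamp (δ : ℤ) (n : ℕ) (x y : ℤ) : lef δ n x y = lef δ n x (clamp n y) :=
  (leftHit_spec ..).clamped x y

lemma punct_clamp (δ : ℤ) {n : ℕ} (hn : 1 ≤ n) (x y : ℤ) :
    punct δ n x y = punct δ n x (clamp n y) := by
  have : clamp n y = 0 ↔ y = 0 := by
    unfold clamp
    omega
  simp [punct, ← tip_clamp, this]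

lemma tip_slit (δ : ℤ) (n : ℕ) {x : ℤ} (hx : 1 ≤ x) : tip δ n x 0 = 0 := tipHit_slit hx

lemma tip_tip (δ : ℤ) (n : ℕ) : tip δ n 0 0 = 1 := tipHit_tip

lemma punct_slit (δ : ℤ) (n : ℕ) {x : ℤ} (hx : 0 ≤ x) : punct δ n x 0 = 0 := by
  unfold punct
  split_ifs with h
  · rfl
  · exact tip_slit δ n (by omega)

lemma lef_slit {δ : ℤ} {n : ℕ} (hδ : -δ ≤ n) {x : ℤ} (hx : 1 ≤ x) : lef δ n x 0 = 0 :=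
  leftHit_slit (by omega) hx

lemma tip_outside {δ : ℤ} {n : ℕ} {x y : ℤ} (hx : x ≠ 0) (hy : |y| ≤ n)
    (hout : x < -(n + δ) ∨ n - δ < x) : tip δ n x y = 0 := by
  rw [tip, (tipHit_spec ..).boundary x y hy (by tauto), if_neg (by tauto)]

lemma punct_outside {δ : ℤ} {n : ℕ} {x y : ℤ} (hx : x ≠ 0) (hy : |y| ≤ n)
    (hout : x < -(n + δ) ∨ n - δ < x) : punct δ n x y = 0 := by
  rw [punct, if_neg (by tauto), tip_outside hx hy hout]

lemma lef_left {δ : ℤ} {n : ℕ} {x y : ℤ} (hy : |y| ≤ n) (hout : x < -(n + δ)) :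
    lef δ n x y = 1 := by
  rw [lef, (leftHit_spec ..).boundary x y hy (by tauto), if_pos hout]

lemma lef_right {δ : ℤ} {n : ℕ} {x y : ℤ} (hy : |y| ≤ n) (hout : n - δ < x)
    (hx : -(n + δ) ≤ x) : lef δ n x y = 0 := by
  rw [lef, (leftHit_spec ..).boundary x y hy (by tauto), if_neg (by omega)]

lemma lap_tip {δ : ℤ} {n : ℕ} {x y : ℤ} (hx1 : -(n + δ) ≤ x) (hx2 : x ≤ n - δ) (hy : |y| ≤ n)
    (hs : ¬ (y = 0 ∧ 0 ≤ x)) : Lap (tip δ n) x y = 0 :=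
  (tipHit_spec ..).harmonic x y hx1 hx2 hy hs

lemma lap_lef {δ : ℤ} {n : ℕ} {x y : ℤ} (hx1 : -(n + δ) ≤ x) (hx2 : x ≤ n - δ) (hy : |y| ≤ n)
    (hs : ¬ (y = 0 ∧ 1 ≤ x)) : Lap (lef δ n) x y = 0 :=
  (leftHit_spec ..).harmonic x y hx1 hx2 hy hs

lemma lap_punct {δ : ℤ} {n : ℕ} {x y : ℤ} (hx1 : -(n + δ) ≤ x) (hx2 : x ≤ n - δ) (hy : |y| ≤ n)
    (hs : ¬ (y = 0 ∧ 0 ≤ x)) : Lap (punct δ n) x y =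
      if (x = -1 ∧ y = 0) ∨ (x = 0 ∧ (y = 1 ∨ y = -1)) then 1 else 0 := by
  have h := lap_tip hx1 hx2 hy hs
  have key : ∀ x y, punct δ n x y = tip δ n x y - if x = 0 ∧ y = 0 then 1 else 0 := by
    intro x y
    unfold punct
    split_ifs with h
    · rw [h.1, h.2, tip_tip, sub_self]
    · rw [sub_zero]
  simp only [Lap, key] at h ⊢
  rw [if_neg (by omega : ¬ (x = 0 ∧ y = 0)), if_neg (by omega : ¬ (x - 1 = 0 ∧ y = 0))]
  split_ifs <;> first | omega | linarith

/-- The reciprocal of the Laplacian of `tip δ n` at the tip. -/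
noncomputable def tipInv (δ : ℤ) (n : ℕ) : ℝ := (Lap (tip δ n) 0 0)⁻¹

/-- The multiple of `lef 0 n` in `oddSol n`. -/
noncomputable def oddCoeff (n : ℕ) : ℝ := (tip 1 n (-1) 0 - tipInv 0 n) / lef 0 n 0 0

/-- The solution which is odd under the reflection in the horizontal axis near `(1,0)`. -/
noncomputable def oddSol (n : ℕ) (x y : ℤ) : ℝ :=
  punct 1 n (x - 1) y - tipInv 0 n * tip 0 n x y - oddCoeff n * lef 0 n x y

/-- The combination of values at the east, north and south neighbours of `(1,0)`. -/
noncomputable def fluxSum (u : ℤ → ℤ → ℝ) : ℝ := u 0 0 + 2 * u 1 1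

/-- The multiple of `lef (-2) n` in `eastSol n`. -/
noncomputable def eastCoeff (n : ℕ) : ℝ :=
  tipInv (-2) n * fluxSum (tip (-2) n) / fluxSum (lef (-2) n)

/-- The even solution with source at `(2,0)`, in reflected coordinates. -/
noncomputable def eastSol (n : ℕ) (x y : ℤ) : ℝ :=
  tipInv (-2) n * tip (-2) n (x + 1) y - eastCoeff n * lef (-2) n (x + 1) y

/-- The multiple of `lef (-2) n` in `evenSol n`. -/
noncomputable def evenCoeff (n : ℕ) : ℝ :=
  (tip (-1) n (-1) 0 + 2 * tip (-1) n 0 1 - tipInv (-2) n * fluxSum (tip (-2) n)) /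
    fluxSum (lef (-2) n)

/-- The even solution with sources at `(1,1)` and `(1,-1)`, in reflected coordinates. -/
noncomputable def evenSol (n : ℕ) (x y : ℤ) : ℝ :=
  punct (-1) n x y - tipInv (-2) n * tip (-2) n (x + 1) y - evenCoeff n * lef (-2) n (x + 1) y

lemma lef_tip_pos {δ : ℤ} {n : ℕ} (h1 : -δ ≤ n) (h2 : δ ≤ n) : 0 < lef δ n 0 0 :=
  leftHit_tip_pos (by omega) (by omega) n

lemma fluxSum_lef_pos {δ : ℤ} {n : ℕ} (h1 : -δ ≤ n) (h2 : δ ≤ n) :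
    0 < fluxSum (lef δ n) := by
  have h3 := lef_tip_pos h1 h2
  have h4 : 0 ≤ lef δ n 1 1 := leftHit_nonneg ..
  unfold fluxSum
  linarith

lemma oddSol_zero {n : ℕ} : oddSol n 0 0 = 0 := by
  have h := lef_tip_pos (δ := 0) (n := n) (by omega) (by omega)
  unfold oddSol oddCoeff
  rw [tip_tip, div_mul_cancel₀ _ h.ne', punct, if_neg (by omega), zero_sub]
  ring

lemma isSlitFun_oddSol {n : ℕ} (hn : 2 ≤ n) : IsSlitFun n false (oddSol n) where
  clamped x y := by
    unfold oddSol
    rw [punct_clamp _ (by omega), tip_clamp, lef_clamp]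
  even x y := by
    unfold oddSol
    rw [punct_neg, tip_neg, lef_neg]
  slit x hx := by
    rcases hx.eq_or_lt with rfl | h
    · exact oddSol_zero
    · unfold oddSol
      rw [punct_slit _ _ (by omega), tip_slit _ _ (by omega), lef_slit (by omega) (by omega)]
      ring
  right y hy := by
    simp only [cond_false]
    unfold oddSol
    rw [punct_outside (by omega) hy (by omega), tip_outside (by omega) hy (by omega),
      lef_right hy (by omega) (by omega)]
    ring
  left y hy := by
    have h0 : |(0 : ℤ)| ≤ n := by simp
    simp only [cond_false]
    unfold oddSol
    rw [punct_outside (by omega) hy (by omega), tip_outside (by omega) hy (by omega),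
      lef_left hy (by omega), punct_outside (by omega) h0 (by omega),
      tip_outside (by omega) h0 (by omega), lef_left h0 (by omega)]

lemma isSlitFun_eastSol {n : ℕ} (hn : 2 ≤ n) : IsSlitFun n true (eastSol n) where
  clamped x y := by
    unfold eastSol
    rw [tip_clamp, lef_clamp]
  even x y := by
    unfold eastSol
    rw [tip_neg, lef_neg]
  slit x hx := by
    unfold eastSol
    rw [tip_slit _ _ (by omega), lef_slit (by omega) (by omega)]
    ring
  right y hy := by
    simp only [cond_true]
    unfold eastSol
    rw [tip_outside (by omega) hy (by omega), lef_right hy (by omega) (by omega)]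
    ring
  left y hy := by
    have h0 : |(0 : ℤ)| ≤ n := by simp
    simp only [cond_true]
    unfold eastSol
    rw [tip_outside (by omega) hy (by omega), lef_left hy (by omega),
      tip_outside (by omega) h0 (by omega), lef_left h0 (by omega)]

lemma isSlitFun_evenSol {n : ℕ} (hn : 2 ≤ n) : IsSlitFun n true (evenSol n) where
  clamped x y := by
    unfold evenSol
    rw [punct_clamp _ (by omega), tip_clamp, lef_clamp]
  even x y := by
    unfold evenSol
    rw [punct_neg, tip_neg, lef_neg]
  slit x hx := by
    unfold evenSol
    rw [punct_slit _ _ (by omega), tip_slit _ _ (by omega), lef_slit (by omega) (by omega)]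
    ring
  right y hy := by
    simp only [cond_true]
    unfold evenSol
    rw [punct_outside (by omega) hy (by omega), tip_outside (by omega) hy (by omega),
      lef_right hy (by omega) (by omega)]
    ring
  left y hy := by
    have h0 : |(0 : ℤ)| ≤ n := by simp
    simp only [cond_true]
    unfold evenSol
    rw [punct_outside (by omega) hy (by omega), tip_outside (by omega) hy (by omega),
      lef_left hy (by omega), punct_outside (by omega) h0 (by omega),
      tip_outside (by omega) h0 (by omega), lef_left h0 (by omega)]

lemma lap_shift_left (u : ℤ → ℤ → ℝ) (x y : ℤ) :
    Lap (fun x y => u (x - 1) y) x y = Lap u (x - 1) y := by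
  simpa only [← sub_eq_add_neg] using lap_shift u (-1) x y

lemma lap_oddSol {n : ℕ} (h0 : Lap (tip 0 n) 0 0 ≠ 0) {x y : ℤ}
    (hx1 : -(n : ℤ) ≤ x) (hx2 : x ≤ n) (hy : |y| ≤ n) (hs : ¬ (y = 0 ∧ 1 ≤ x)) :
    Lap (oddSol n) x y = if x = 1 ∧ (y = 1 ∨ y = -1) then 1 else 0 := by
  have e1 := lap_shift_left (punct 1 n) x y
  rw [lap_punct (by omega) (by omega) hy (by omega)] at e1
  have e2 := lap_lef (δ := 0) (by omega) (by omega) hy hs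
  by_cases hxy : x = 0 ∧ y = 0
  · obtain ⟨rfl, rfl⟩ := hxy
    have e3 : tipInv 0 n * Lap (tip 0 n) 0 0 = 1 := inv_mul_cancel₀ h0
    simp only [Lap, oddSol] at e1 e2 e3 ⊢
    norm_num at e1 e2 e3 ⊢
    linear_combination e1 - e3 - oddCoeff n * e2
  · have e3 := lap_tip (δ := 0) (n := n) (x := x) (y := y) (by omega) (by omega) hy (by omega)
    have e4 : (if (x - 1 = -1 ∧ y = 0) ∨ (x - 1 = 0 ∧ (y = 1 ∨ y = -1)) then 1 else 0 : ℝ) =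
        if x = 1 ∧ (y = 1 ∨ y = -1) then 1 else 0 := by
      split_ifs <;> first | omega | rfl
    rw [← e4, ← e1]
    simp only [Lap, oddSol] at e2 e3 ⊢
    linear_combination -tipInv 0 n * e3 - oddCoeff n * e2

lemma fluxSum_eastSol {n : ℕ} (hn : 2 ≤ n) : eastSol n (-1) 0 + 2 * eastSol n 0 1 = 0 := by
  have h := fluxSum_lef_pos (δ := -2) (n := n) (by omega) (by omega)
  have h1 : eastCoeff n * fluxSum (lef (-2) n) = tipInv (-2) n * fluxSum (tip (-2) n) :=
    div_mul_cancel₀ _ h.ne'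
  unfold fluxSum at h1
  unfold eastSol
  norm_num
  linear_combination -h1

lemma fluxSum_evenSol {n : ℕ} (hn : 2 ≤ n) : evenSol n (-1) 0 + 2 * evenSol n 0 1 = 0 := by
  have h := fluxSum_lef_pos (δ := -2) (n := n) (by omega) (by omega)
  have h1 : evenCoeff n * fluxSum (lef (-2) n) =
      tip (-1) n (-1) 0 + 2 * tip (-1) n 0 1 - tipInv (-2) n * fluxSum (tip (-2) n) :=
    div_mul_cancel₀ _ h.ne'
  unfold fluxSum at h1
  unfold evenSol punct
  norm_num
  linear_combination -h1

lemma IsSlitFun.lap_zero {n : ℕ} {s : Bool} {w : ℤ → ℤ → ℝ} (hw : IsSlitFun n s w)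
    (h : w (-1) 0 + 2 * w 0 1 = 0) : Lap w 0 0 = 0 := by
  have h1 := hw.even 0 1
  simp only [Lap, zero_add, zero_sub]
  rw [hw.slit 0 le_rfl, hw.slit 1 zero_le_one, h1]
  linear_combination -h

lemma lap_eastSol {n : ℕ} (hn : 2 ≤ n) (h0 : Lap (tip (-2) n) 0 0 ≠ 0) {x y : ℤ}
    (hx1 : 1 - (n : ℤ) ≤ x) (hx2 : x ≤ n + 1) (hy : |y| ≤ n) (hs : ¬ (y = 0 ∧ 1 ≤ x)) :
    Lap (eastSol n) x y = if x = -1 ∧ y = 0 then 1 else 0 := by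
  by_cases hxy : x = 0 ∧ y = 0
  · rw [hxy.1, hxy.2, (isSlitFun_eastSol hn).lap_zero (fluxSum_eastSol hn), if_neg (by omega)]
  have e1 := lap_shift (tip (-2) n) 1 x y
  have e2 := lap_shift (lef (-2) n) 1 x y
  rw [lap_lef (by omega) (by omega) hy (by omega)] at e2
  by_cases hxy' : x = -1 ∧ y = 0
  · obtain ⟨rfl, rfl⟩ := hxy'
    have e3 : tipInv (-2) n * Lap (tip (-2) n) (-1 + 1) 0 = 1 := inv_mul_cancel₀ h0
    rw [← e1] at e3
    rw [if_pos (by simp)]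
    simp only [Lap, eastSol] at e2 e3 ⊢
    linear_combination e3 - eastCoeff n * e2
  · rw [lap_tip (by omega) (by omega) hy (by omega)] at e1
    rw [if_neg hxy']
    simp only [Lap, eastSol] at e1 e2 ⊢
    linear_combination tipInv (-2) n * e1 - eastCoeff n * e2

lemma lap_evenSol {n : ℕ} (hn : 2 ≤ n) (h0 : Lap (tip (-2) n) 0 0 ≠ 0) {x y : ℤ}
    (hx1 : 1 - (n : ℤ) ≤ x) (hx2 : x ≤ n + 1) (hy : |y| ≤ n) (hs : ¬ (y = 0 ∧ 1 ≤ x)) :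
    Lap (evenSol n) x y = if x = 0 ∧ (y = 1 ∨ y = -1) then 1 else 0 := by
  by_cases hxy : x = 0 ∧ y = 0
  · rw [hxy.1, hxy.2, (isSlitFun_evenSol hn).lap_zero (fluxSum_evenSol hn), if_neg (by omega)]
  have e1 := lap_shift (tip (-2) n) 1 x y
  have e2 := lap_shift (lef (-2) n) 1 x y
  have e3 := lap_punct (δ := -1) (n := n) (x := x) (y := y) (by omega) (by omega) hy (by omega)
  rw [lap_lef (by omega) (by omega) hy (by omega)] at e2
  by_cases hxy' : x = -1 ∧ y = 0
  · obtain ⟨rfl, rfl⟩ := hxy'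
    have e4 : tipInv (-2) n * Lap (tip (-2) n) (-1 + 1) 0 = 1 := inv_mul_cancel₀ h0
    rw [← e1] at e4
    rw [if_pos (by simp)] at e3
    rw [if_neg (by simp)]
    simp only [Lap, evenSol] at e2 e3 e4 ⊢
    linear_combination e3 - e4 - evenCoeff n * e2
  · rw [lap_tip (by omega) (by omega) hy (by omega)] at e1
    simp only [hxy', false_or] at e3
    rw [← e3]
    simp only [Lap, evenSol] at e1 e2 ⊢
    linear_combination -tipInv (-2) n * e1 - evenCoeff n * e2

lemma IsSlitFun.mulVec_eq {n : ℕ} (hn : 1 ≤ n) {s : Bool} {w : ℤ → ℤ → ℝ}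
    (hw : IsSlitFun n s w) {a b : Site n} (ha : a.1 = (0, 0)) (hb : b.1 = (1, 0))
    {g : Site n ⊕ Bool → ℝ} (hroot : ∀ β, g (Sum.inr β) = 0)
    (hslit : ∀ v : Site n, v.1.2 = 0 ∧ 1 ≤ foldCol s v.1.1 → g (Sum.inl v) = 0)
    (hlap : ∀ v : Site n, ¬ (v.1.2 = 0 ∧ 1 ≤ foldCol s v.1.1) →
      sheet (foldCol s v.1.1) v.1.2 * Lap w (foldCol s v.1.1) v.1.2 = g (Sum.inl v)) :
    (gridMatrix a b 1).mulVec (siteLift n (sector s w)) = g := by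
  funext v
  rcases v with v | β
  · by_cases hv : v.1.2 = 0 ∧ 1 ≤ foldCol s v.1.1
    · rw [hw.mulVec_of_slit hn a b hv.1 hv.2, hslit v hv]
    · rw [hw.mulVec_of_not_slit hn a b hv, hlap v hv]
  · rw [gridMatrix_mulVec_inr, hroot]
    have h0 := hw.slit 0 le_rfl
    have h1 := hw.slit 1 zero_le_one
    cases β <;> cases s <;> simp [siteLift, sector, foldCol, ha, hb, h0, h1]

lemma mulVec_oddSol {n : ℕ} (hn : 2 ≤ n) (h0 : Lap (tip 0 n) 0 0 ≠ 0) {a b N S : Site n}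
    (ha : a.1 = (0, 0)) (hb : b.1 = (1, 0)) (hN : N.1 = (1, 1)) (hS : S.1 = (1, -1)) :
    (gridMatrix a b 1).mulVec (siteLift n (sector false (oddSol n))) =
      Pi.single (Sum.inl N) 1 - Pi.single (Sum.inl S) 1 := by
  refine (isSlitFun_oddSol hn).mulVec_eq (by omega) ha hb (by simp) ?_ ?_
  · rintro ⟨⟨x, y⟩, hp⟩ hv
    simp only [foldCol, cond_false] at hv
    simp [Subtype.ext_iff, hN, hS, hv.1]
  · rintro ⟨⟨x, y⟩, hp⟩ hv
    obtain ⟨hx1, hx2, hy1, hy2⟩ := mem_boxPoints.1 hp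
    simp only [foldCol, cond_false] at hv hx1 hx2 hy1 hy2 ⊢
    rw [lap_oddSol h0 hx1 hx2 (abs_le.2 ⟨hy1, hy2⟩) hv]
    simp only [Pi.single_apply, Pi.sub_apply, Sum.inl.injEq, Subtype.ext_iff, hN, hS,
      Prod.mk.injEq, sheet]
    split_ifs <;> first | omega | norm_num

lemma mulVec_eastSol {n : ℕ} (hn : 2 ≤ n) (h0 : Lap (tip (-2) n) 0 0 ≠ 0) {a b E : Site n}
    (ha : a.1 = (0, 0)) (hb : b.1 = (1, 0)) (hE : E.1 = (2, 0)) :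
    (gridMatrix a b 1).mulVec (siteLift n (sector true (eastSol n))) =
      Pi.single (Sum.inl E) 1 := by
  refine (isSlitFun_eastSol hn).mulVec_eq (by omega) ha hb (by simp) ?_ ?_
  · rintro ⟨⟨x, y⟩, hp⟩ hv
    simp only [foldCol, cond_true] at hv
    simp only [Pi.single_apply, Sum.inl.injEq, Subtype.ext_iff, hE, Prod.mk.injEq]
    rw [if_neg (by omega)]
  · rintro ⟨⟨x, y⟩, hp⟩ hv
    obtain ⟨hx1, hx2, hy1, hy2⟩ := mem_boxPoints.1 hp
    simp only [foldCol, cond_true] at hv hx1 hx2 hy1 hy2 ⊢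
    rw [lap_eastSol hn h0 (by omega) (by omega) (abs_le.2 ⟨hy1, hy2⟩) hv]
    simp only [Pi.single_apply, Sum.inl.injEq, Subtype.ext_iff, hE, Prod.mk.injEq, sheet]
    split_ifs <;> first | omega | norm_num

lemma mulVec_evenSol {n : ℕ} (hn : 2 ≤ n) (h0 : Lap (tip (-2) n) 0 0 ≠ 0) {a b N S : Site n}
    (ha : a.1 = (0, 0)) (hb : b.1 = (1, 0)) (hN : N.1 = (1, 1)) (hS : S.1 = (1, -1)) :
    (gridMatrix a b 1).mulVec (siteLift n (sector true (evenSol n))) =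
      Pi.single (Sum.inl N) 1 + Pi.single (Sum.inl S) 1 := by
  refine (isSlitFun_evenSol hn).mulVec_eq (by omega) ha hb (by simp) ?_ ?_
  · rintro ⟨⟨x, y⟩, hp⟩ hv
    simp only [foldCol, cond_true] at hv
    simp [Subtype.ext_iff, hN, hS, hv.1]
  · rintro ⟨⟨x, y⟩, hp⟩ hv
    obtain ⟨hx1, hx2, hy1, hy2⟩ := mem_boxPoints.1 hp
    simp only [foldCol, cond_true] at hv hx1 hx2 hy1 hy2 ⊢
    rw [lap_evenSol hn h0 (by omega) (by omega) (abs_le.2 ⟨hy1, hy2⟩) hv]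
    simp only [Pi.single_apply, Pi.add_apply, Sum.inl.injEq, Subtype.ext_iff, hN, hS,
      Prod.mk.injEq, sheet]
    split_ifs <;> first | omega | norm_num

end Solutions

end TrunkDegree

namespace TrunkDegree

open Finset Filter Topology

section TrunkLimits

/-- The eigenvalue of the odd sector. -/
noncomputable def oddEig (n : ℕ) : ℝ := oddSol n 1 1

/-- The eigenvalue of the even sector. -/
noncomputable def evenEig (n : ℕ) : ℝ := eastSol n (-1) 0 + evenSol n 0 1

lemma det_gridMatrix_eig {n : ℕ} (hn : 2 ≤ n) (h0 : Lap (tip 0 n) 0 0 ≠ 0)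
    (h2 : Lap (tip (-2) n) 0 0 ≠ 0) {a b : Site n} (ha : a.1 = (0, 0)) (hb : b.1 = (1, 0))
    (t : ℝ) :
    (gridMatrix a b t).det =
      (gridMatrix a b 1).det * ((1 + (t - 1) * oddEig n) * (1 + (t - 1) * evenEig n)) := by
  let E : Site n := ⟨(2, 0), mem_boxPoints.2 ⟨by dsimp; omega, by dsimp; omega, by simp, by simp⟩⟩
  let N : Site n := ⟨(1, 1), mem_boxPoints.2 ⟨by dsimp; omega, by dsimp; omega, by dsimp; omega,
    by dsimp; omega⟩⟩
  let S : Site n := ⟨(1, -1), mem_boxPoints.2 ⟨by dsimp; omega, by dsimp; omega,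
    by dsimp; omega, by dsimp; omega⟩⟩
  have lift : ∀ (W : ℤ → ℤ → ℝ) (v : Site n), siteLift n W (Sum.inl v) = W v.1.1 v.1.2 :=
    fun _ _ => rfl
  have hev := isSlitFun_evenSol hn
  have hea := isSlitFun_eastSol hn
  have hod := isSlitFun_oddSol hn
  have key := det_gridMatrix_factor (E := E) (N := N) (S := S) hb rfl rfl rfl
    (mulVec_eastSol hn h2 ha hb rfl) (mulVec_evenSol hn h2 ha hb rfl rfl)
    (mulVec_oddSol hn h0 ha hb rfl rfl)
    (by simpa [lift, E, N, sector, foldCol, sheet] using fluxSum_eastSol hn)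
    (by simpa [lift, E, N, sector, foldCol, sheet] using fluxSum_evenSol hn)
    (by simp [lift, S, N, sector, foldCol, sheet, hea.even])
    (by simp [lift, S, N, sector, foldCol, sheet, hev.even])
    (by simp [lift, E, sector, foldCol, sheet, hod.slit 2 (by norm_num)])
    (by simp [lift, S, N, sector, foldCol, sheet, hod.even]) t
  simpa [lift, E, N, sector, foldCol, sheet, oddEig, evenEig] using key

lemma tip_tendsto (δ x y : ℤ) : Tendsto (fun n => tip δ n x y) atTop (𝓝 (slitHarm x y)) :=
  tipHit_tendsto δ x y

lemma lap_tip_tendsto (δ : ℤ) :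
    Tendsto (fun n => Lap (tip δ n) 0 0) atTop (𝓝 (√2 + 1)) := by
  have h := lap_slitHarm_of_neg (x := 0) le_rfl
  rw [if_pos rfl] at h
  rw [← h]
  unfold Lap
  exact ((((tip_tendsto δ _ _).const_mul 4).sub (tip_tendsto δ _ _)).sub
    (tip_tendsto δ _ _)).sub (tip_tendsto δ _ _) |>.sub (tip_tendsto δ _ _)

lemma sq_sqrt_two : √2 ^ 2 = (2 : ℝ) := Real.sq_sqrt zero_le_two

lemma tipInv_tendsto (δ : ℤ) : Tendsto (tipInv δ) atTop (𝓝 (√2 - 1)) := by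
  have hpos : √2 + 1 ≠ 0 := by positivity
  have h : (√2 + 1)⁻¹ = √2 - 1 := inv_eq_of_mul_eq_one_right <| by
    linear_combination sq_sqrt_two
  rw [← h]
  exact (lap_tip_tendsto δ).inv₀ hpos

lemma eventually_lap_tip_ne_zero (δ : ℤ) : ∀ᶠ n in atTop, Lap (tip δ n) 0 0 ≠ 0 :=
  (lap_tip_tendsto δ).eventually_ne (by positivity)

lemma lef_corner_tendsto (δ : ℤ) :
    Tendsto (fun n => lef δ n 1 1 / lef δ n 0 0) atTop (𝓝 (√2 / 2)) :=
  leftHit_corner_tendsto δ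

lemma oddEig_tendsto : Tendsto oddEig atTop (𝓝 (1 - √2 / 2)) := by
  have h : Tendsto (fun n => tip 1 n 0 1 - tipInv 0 n * tip 0 n 1 1 -
      (tip 1 n (-1) 0 - tipInv 0 n) * (lef 0 n 1 1 / lef 0 n 0 0)) atTop
      (𝓝 (1 / 2 - (√2 - 1) * ((√2 - 1) / 2) - (2 - √2 - (√2 - 1)) * (√2 / 2))) := by
    have h1 := tip_tendsto 1 0 1
    have h2 := tip_tendsto 0 1 1
    have h3 := tip_tendsto 1 (-1) 0
    rw [slitHarm_zero_one] at h1
    rw [slitHarm_one_one] at h2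
    rw [slitHarm_neg_one] at h3
    exact (h1.sub ((tipInv_tendsto 0).mul h2)).sub
      ((h3.sub (tipInv_tendsto 0)).mul (lef_corner_tendsto 0))
  convert h using 2
  · unfold oddEig oddSol oddCoeff punct
    norm_num
    ring
  · linear_combination (-1 / 2 : ℝ) * sq_sqrt_two

lemma fluxSum_tip_tendsto (δ : ℤ) : Tendsto (fun n => fluxSum (tip δ n)) atTop (𝓝 √2) := by
  have h := tip_tendsto δ 1 1
  rw [slitHarm_one_one] at h
  unfold fluxSum
  simp only [tip_tip]
  convert (h.const_mul 2).const_add 1 using 2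
  ring

lemma lef_zero_div_fluxSum_tendsto (δ : ℤ) :
    Tendsto (fun n => lef δ n 0 0 / fluxSum (lef δ n)) atTop (𝓝 (√2 - 1)) := by
  have h := ((lef_corner_tendsto δ).const_mul 2).const_add 1
  have hpos : 1 + 2 * (√2 / 2) ≠ 0 := by positivity
  have e : (1 + 2 * (√2 / 2))⁻¹ = √2 - 1 := inv_eq_of_mul_eq_one_right <| by
    linear_combination sq_sqrt_two
  rw [← e]
  refine (h.inv₀ hpos).congr' ?_
  filter_upwards [eventually_ge_atTop δ.natAbs] with n hn
  have h1 := lef_tip_pos (δ := δ) (n := n) (by omega) (by omega)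
  have h2 := fluxSum_lef_pos (δ := δ) (n := n) (by omega) (by omega)
  unfold fluxSum at h2 ⊢
  field_simp

lemma lef_corner_div_fluxSum_tendsto (δ : ℤ) :
    Tendsto (fun n => lef δ n 1 1 / fluxSum (lef δ n)) atTop (𝓝 (√2 / 2 * (√2 - 1))) := by
  refine ((lef_corner_tendsto δ).mul (lef_zero_div_fluxSum_tendsto δ)).congr' ?_
  filter_upwards [eventually_ge_atTop δ.natAbs] with n hn
  have h1 := lef_tip_pos (δ := δ) (n := n) (by omega) (by omega)
  exact div_mul_div_cancel₀ h1.ne'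

lemma evenEig_tendsto : Tendsto evenEig atTop (𝓝 (1 - √2 / 2)) := by
  have hi := tipInv_tendsto (-2)
  have hf := fluxSum_tip_tendsto (-2)
  have h1 := tip_tendsto (-1) 0 1
  have h2 := tip_tendsto (-2) 1 1
  have h3 := tip_tendsto (-1) (-1) 0
  rw [slitHarm_zero_one] at h1
  rw [slitHarm_one_one] at h2
  rw [slitHarm_neg_one] at h3
  have h : Tendsto (fun n => (tipInv (-2) n - tipInv (-2) n * fluxSum (tip (-2) n) *
      (lef (-2) n 0 0 / fluxSum (lef (-2) n))) + (tip (-1) n 0 1 - tipInv (-2) n * tip (-2) n 1 1 -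
      (tip (-1) n (-1) 0 + 2 * tip (-1) n 0 1 - tipInv (-2) n * fluxSum (tip (-2) n)) *
      (lef (-2) n 1 1 / fluxSum (lef (-2) n)))) atTop
      (𝓝 ((√2 - 1 - (√2 - 1) * √2 * (√2 - 1)) + (1 / 2 - (√2 - 1) * ((√2 - 1) / 2) -
        (2 - √2 + 2 * (1 / 2) - (√2 - 1) * √2) * (√2 / 2 * (√2 - 1))))) :=
    (hi.sub ((hi.mul hf).mul (lef_zero_div_fluxSum_tendsto (-2)))).add
      ((h1.sub (hi.mul h2)).sub (((h3.add (h1.const_mul 2)).sub (hi.mul hf)).mul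
        (lef_corner_div_fluxSum_tendsto (-2))))
  convert h using 2
  · unfold evenEig eastSol evenSol evenCoeff eastCoeff punct
    norm_num [tip_tip]
    ring
  · have h2 := sq_sqrt_two
    have h3 : √2 ^ 3 = 2 * √2 := by rw [pow_succ, h2]
    have h4 : √2 ^ 4 = 4 := by rw [show (4 : ℕ) = 2 * 2 from rfl, pow_mul, h2]; norm_num
    ring_nf
    rw [h3, h4]
    ring

end TrunkLimits

open Classical in
/-- The degree distribution, in terms of the number of neighbours besides the two on the trunk. -/
lemma tendsto_card_ratio (k : ℕ) (hk : k ≤ 2) :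
    Tendsto (fun n : ℕ =>
      (Nat.card {T : (gridGraph n).Subgraph //
        IsSpanningTree n T ∧ TrunkContains n T (hEdge 0) ∧
          (T.neighborSet (Sum.inl (1, 0))).ncard = k + 2} : ℝ) /
        (Nat.card {T : (gridGraph n).Subgraph //
          IsSpanningTree n T ∧ TrunkContains n T (hEdge 0)} : ℝ)) atTop
      (𝓝 (if k = 0 then 1 / 2 else if k = 1 then √2 - 1 else 3 / 2 - √2)) := by
  have h2 := sq_sqrt_two
  have hlim : Tendsto (fun n => if k = 0 then (1 - oddEig n) * (1 - evenEig n) else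
      if k = 1 then oddEig n * (1 - evenEig n) + evenEig n * (1 - oddEig n) else
        oddEig n * evenEig n) atTop
      (𝓝 (if k = 0 then 1 / 2 else if k = 1 then √2 - 1 else 3 / 2 - √2)) := by
    have hp := oddEig_tendsto
    have hq := evenEig_tendsto
    split_ifs
    · convert (hp.const_sub 1).mul (hq.const_sub 1) using 2
      linear_combination (-1 / 4 : ℝ) * h2
    · convert (hp.mul (hq.const_sub 1)).add (hq.mul (hp.const_sub 1)) using 2
      linear_combination (1 / 2 : ℝ) * h2
    · convert hp.mul hq using 2
      linear_combination (-1 / 4 : ℝ) * h2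
  refine hlim.congr' ?_
  filter_upwards [eventually_ge_atTop 2, eventually_lap_tip_ne_zero 0,
    eventually_lap_tip_ne_zero (-2)] with n hn h0 h2
  let a : Site n := ⟨(0, 0), mem_boxPoints.2 ⟨by simp, by simp, by simp, by simp⟩⟩
  let b : Site n := ⟨(1, 0), mem_boxPoints.2 ⟨by dsimp; omega, by dsimp; omega, by simp, by simp⟩⟩
  exact (card_ratio (by omega) (a := a) (b := b) rfl rfl
    (det_gridMatrix_eig hn h0 h2 rfl rfl) k hk).symm

end TrunkDegree

/-- Degree distribution on the spanning tree trunk: among spanning trees of `G_n`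
whose trunk contains `e₀`, the proportion of trees in which the vertex `(1,0)` has
degree `d` converges, as `n → ∞`, to `1/2` for `d = 2`, to `√2 - 1` for `d = 3`, and
to `3/2 - √2` for `d = 4`. -/
theorem trunk_degree_distribution :
    ∀ d : ℕ, (d = 2 ∨ d = 3 ∨ d = 4) →
      Filter.Tendsto
        (fun n : ℕ =>
          (Nat.card {T : (gridGraph n).Subgraph //
              IsSpanningTree n T ∧ TrunkContains n T (hEdge 0) ∧
                (T.neighborSet (Sum.inl (1, 0))).ncard = d} : ℝ) /
            (Nat.card {T : (gridGraph n).Subgraph //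
              IsSpanningTree n T ∧ TrunkContains n T (hEdge 0)} : ℝ))
        Filter.atTop
        (nhds (if d = 2 then 1 / 2 else if d = 3 then Real.sqrt 2 - 1
          else 3 / 2 - Real.sqrt 2)) := by
  rintro d (rfl | rfl | rfl)
  · simpa using TrunkDegree.tendsto_card_ratio 0 (by norm_num)
  · simpa using TrunkDegree.tendsto_card_ratio 1 (by norm_num)
  · simpa using TrunkDegree.tendsto_card_ratio 2 le_rfl
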